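/- Let w be a smooth non-negative function on ℝ supported on the interval (1,2) with bounded derivatives. For every sufficiently small ε > 0 there exists a constant C = C(ε, w) such that for every real K ≥ 2 and all positive integers α, β, γ, r₁, r₂ with K^{−ε} < r₁/r₂ < K^{ε}, the quantity E₂ = (1/(πK)) ∑_{k ≥ 2 even} ∑' T(k; n, m, c₁, c₂), where ∑' runs over positive integers n, m, c₁, c₂ with K^{4/3−ε} < n r₁/c₂ < K^{2−ε} and (n r₁)/(c₂ K^{ε}) < √(n m α β²)/c₁ < (n r₁ K^{ε})/c₂, satisfies |E₂| ≤ C K^{−1/15}. -/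

import Mathlib

noncomputable section

/-- e(x) = exp(2πi x) -/
def ee (x : ℝ) : ℂ := Complex.exp (2 * Real.pi * Complex.I * x)

/-- Bessel function of integer order: J_ℓ(x) = ∫_{-1/2}^{1/2} e(ℓt) e^{-ix sin(2πt)} dt -/
def besselJ (ℓ : ℕ) (x : ℝ) : ℂ :=
  ∫ t in (-(1:ℝ)/2)..(1/2), ee (ℓ * t) * Complex.exp (-Complex.I * x * Real.sin (2 * Real.pi * t))

/-- Kloosterman sum S(n,m;c) -/
def kloos (n m : ℤ) (c : ℕ) : ℂ :=
  ∑ b ∈ Finset.range c, if Nat.Coprime b c then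
    ee (((((n : ZMod c) * (b : ZMod c) + (m : ZMod c) * (b : ZMod c)⁻¹).val : ℕ) : ℝ) / c)
  else 0

/-- Λ_{k,j}(s) -/
def Lam (j : ℕ) (k : ℝ) (s : ℂ) : ℂ :=
  if j = 1 then (2 * Real.pi : ℂ) ^ (-s) * Complex.Gamma (s + (k : ℂ) - 1/2)
  else 8 * (2 * Real.pi : ℂ) ^ (-3*s - 3*(k:ℂ) + 3/2) * Complex.Gamma (s + 2*(k:ℂ) - 3/2) *
    Complex.Gamma (s + (k:ℂ) - 1/2) * Complex.Gamma (s + 1/2)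

/-- V_{k,j}(ξ), contour integral on Re s = 1 -/
def V (j : ℕ) (k : ℝ) (ξ : ℝ) : ℂ :=
  (1 / (2 * Real.pi * Complex.I)) * ∫ t : ℝ,
    (Lam j k (1/2 + (1 + (t:ℂ) * Complex.I)) / Lam j k (1/2)) *
      (ξ : ℂ) ^ (-(1 + (t:ℂ) * Complex.I)) / (1 + (t:ℂ) * Complex.I) * Complex.I

/-- Fourier transform ĥ(t) = ∫ h(v) e(−vt) dv -/
def fhat (h : ℝ → ℂ) (t : ℝ) : ℂ := ∫ v : ℝ, h v * ee (-(v * t))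

end

noncomputable section

/-- The summand T(k; n, m, c₁, c₂) from the paper. -/
def T (w : ℝ → ℝ) (K : ℝ) (α β γ r₁ r₂ : ℕ) (k n m c₁ c₂ : ℕ) : ℂ :=
  Complex.I ^ k *
  ((w ((k : ℝ) / K) * (((k : ℝ) - 1) / K) / Real.sqrt ((n : ℝ) * m) : ℝ) : ℂ) *
  (kloos ((n : ℤ) ^ 2) ((r₁ : ℤ) ^ 2) c₂ / (c₂ : ℂ)) *
  (kloos ((n : ℤ) * α * β ^ 2) (m : ℤ) c₁ / (c₁ : ℂ)) *
  besselJ (k - 1) (4 * Real.pi * n * r₁ / c₂) *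
  besselJ (2 * k - 1) (4 * Real.pi * Real.sqrt ((n : ℝ) * m * α * β ^ 2) / c₁) *
  V 1 (k : ℝ) (m : ℝ) *
  V 2 (k : ℝ) ((n : ℝ) * r₂ ^ 2 * α ^ 3 * β ^ 2 * γ ^ 2)

/-- The condition n r₁ / c₂ > K^{2-ε} defining E₁. -/
def cond1 (K ε : ℝ) (r₁ n c₂ : ℕ) : Prop :=
  (n : ℝ) * r₁ / c₂ > K ^ ((2:ℝ) - ε)

/-- The condition defining E₂. -/
def cond2 (K ε : ℝ) (α β r₁ n m c₁ c₂ : ℕ) : Prop :=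
  K ^ ((4:ℝ)/3 - ε) < (n : ℝ) * r₁ / c₂ ∧ (n : ℝ) * r₁ / c₂ < K ^ ((2:ℝ) - ε) ∧
  (n : ℝ) * r₁ / (c₂ * K ^ ε) < Real.sqrt ((n : ℝ) * m * α * β ^ 2) / c₁ ∧
  Real.sqrt ((n : ℝ) * m * α * β ^ 2) / c₁ < (n : ℝ) * r₁ * K ^ ε / c₂

end


section P1
open Complex MeasureTheory

noncomputable def JJ (ν : ℤ) (x : ℝ) : ℂ :=
  ∫ t in (-(1:ℝ)/2)..(1/2), Complex.exp (((2 * Real.pi * ν * t - x * Real.sin (2 * Real.pi * t) : ℝ) : ℂ) * I)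

lemma besselJ_eq_JJ (ℓ : ℕ) (x : ℝ) : besselJ ℓ x = JJ ℓ x := by
  unfold besselJ JJ ee
  congr 1; ext t
  rw [← Complex.exp_add]
  congr 1
  push_cast
  ring

lemma first_deriv_test (φ φ' φ'' : ℝ → ℝ) (a b l : ℝ) (hab : a ≤ b) (hl : 0 < l)
    (h1 : ∀ t, HasDerivAt φ (φ' t) t) (h2 : ∀ t, HasDerivAt φ' (φ'' t) t) (hc : Continuous φ'')
    (hpos : ∀ t ∈ Set.Icc a b, 0 ≤ φ'' t) (hlow : ∀ t ∈ Set.Icc a b, l ≤ |φ' t|) :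
    ‖∫ t in a..b, Complex.exp ((φ t : ℂ) * I)‖ ≤ 4 / l := by
  have hne : ∀ t ∈ Set.uIcc a b, φ' t ≠ 0 := by
    intro t ht
    rw [Set.uIcc_of_le hab] at ht
    intro h0
    have := hlow t ht
    rw [h0] at this; simp at this; linarith
  have hc1 : Continuous φ' := continuous_iff_continuousAt.2 fun t => (h2 t).continuousAt
  have hc0 : Continuous φ := continuous_iff_continuousAt.2 fun t => (h1 t).continuousAt
  have hu : ∀ t ∈ Set.uIcc a b, HasDerivAt (fun t => (((φ' t)⁻¹ : ℝ) : ℂ) ) (((-(φ'' t) / (φ' t)^2 : ℝ)) : ℂ) t := by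
    intro t ht
    exact ((h2 t).fun_inv (hne t ht)).ofReal_comp
  have hv : ∀ t ∈ Set.uIcc a b, HasDerivAt (fun t => -I * Complex.exp ((φ t : ℂ) * I)) ((φ' t : ℂ) * Complex.exp ((φ t : ℂ) * I)) t := by
    intro t ht
    have := (((h1 t).ofReal_comp.mul_const I).cexp).const_mul (-I)
    refine this.congr_deriv ?_
    linear_combination (-(φ' t : ℂ) * Complex.exp ((φ t : ℂ) * I)) * I_mul_I
  have hcu : ContinuousOn (fun t => (-(φ'' t) / (φ' t)^2 : ℝ)) (Set.uIcc a b) := by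
    apply ContinuousOn.div
    · exact hc.neg.continuousOn
    · exact (hc1.pow 2).continuousOn
    · intro t ht; exact pow_ne_zero 2 (hne t ht)
  have key := intervalIntegral.integral_mul_deriv_eq_deriv_mul hu hv
    ((Complex.continuous_ofReal.comp_continuousOn hcu).intervalIntegrable)
    ((by fun_prop : Continuous fun t => (φ' t : ℂ) * Complex.exp ((φ t : ℂ) * I)).intervalIntegrable _ _)
  have e1 : ∫ t in a..b, Complex.exp ((φ t : ℂ) * I) = ∫ t in a..b, (((φ' t)⁻¹ : ℝ) : ℂ) * ((φ' t : ℂ) * Complex.exp ((φ t : ℂ) * I)) := by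
    apply intervalIntegral.integral_congr
    intro t ht
    have := hne t ht
    have h' : (φ' t : ℂ) ≠ 0 := by exact_mod_cast this
    simp only
    push_cast
    field_simp
  have ha : a ∈ Set.Icc a b := ⟨le_refl _, hab⟩
  have hb : b ∈ Set.Icc a b := ⟨hab, le_refl _⟩
  have hinv : ∀ t ∈ Set.Icc a b, |(φ' t)⁻¹| ≤ 1 / l := by
    intro t ht
    rw [abs_inv, one_div]
    exact inv_anti₀ hl (hlow t ht)
  have nexp : ∀ t, ‖Complex.exp ((φ t : ℂ) * I)‖ = 1 := fun t => Complex.norm_exp_ofReal_mul_I _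
  have b3 : ‖∫ t in a..b, ((-(φ'' t) / (φ' t)^2 : ℝ) : ℂ) * (-I * Complex.exp ((φ t : ℂ) * I))‖ ≤ 2 / l := by
    calc _ ≤ ∫ t in a..b, (-(-(φ'' t) / (φ' t)^2)) := by
          apply intervalIntegral.norm_integral_le_of_norm_le hab
          · refine Filter.Eventually.of_forall fun t ht => ?_
            have ht' : t ∈ Set.Icc a b := ⟨ht.1.le, ht.2⟩
            rw [norm_mul, norm_mul, nexp, norm_neg, norm_I, Complex.norm_real, Real.norm_eq_abs]
            rw [neg_div, abs_neg, abs_of_nonneg (div_nonneg (hpos t ht') (by positivity))]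
            simp
          · exact (hcu.neg).intervalIntegrable
      _ = -((φ' b)⁻¹ - (φ' a)⁻¹) := by
          rw [intervalIntegral.integral_neg]
          congr 1
          apply intervalIntegral.integral_eq_sub_of_hasDerivAt
          · intro t ht; exact (h2 t).fun_inv (hne t ht)
          · exact hcu.intervalIntegrable
      _ ≤ 2 / l := by
          have := abs_le.1 (hinv a ha)
          have := abs_le.1 (hinv b hb)
          have : 2 / l = 1/l + 1/l := by ring
          linarith
  rw [e1, key]
  have na : ∀ t ∈ Set.Icc a b, ‖(((φ' t)⁻¹ : ℝ) : ℂ) * (-I * Complex.exp ((φ t : ℂ) * I))‖ ≤ 1 / l := by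
    intro t ht
    rw [norm_mul, norm_mul, nexp, norm_neg, norm_I, Complex.norm_real, Real.norm_eq_abs]
    simpa using hinv t ht
  calc _ ≤ ‖(((φ' b)⁻¹ : ℝ) : ℂ) * (-I * Complex.exp ((φ b : ℂ) * I))‖ + ‖(((φ' a)⁻¹ : ℝ) : ℂ) * (-I * Complex.exp ((φ a : ℂ) * I))‖ + _ :=
        (norm_sub_le _ _).trans (add_le_add_left (norm_sub_le _ _) _)
    _ ≤ 1/l + 1/l + 2/l := by
        gcongr
        · exact na b hb
        · exact na a ha
    _ = 4 / l := by ring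

lemma JJ_norm_le_one (ν : ℤ) (x : ℝ) : ‖JJ ν x‖ ≤ 1 := by
  unfold JJ
  have := intervalIntegral.norm_integral_le_of_norm_le_const (a := -(1:ℝ)/2) (b := 1/2) (C := 1)
    (f := fun t => Complex.exp (((2 * Real.pi * ν * t - x * Real.sin (2 * Real.pi * t) : ℝ) : ℂ) * I))
    (fun t _ => (Complex.norm_exp_ofReal_mul_I _).le)
  refine this.trans ?_
  norm_num

lemma cont_JJ (ν : ℤ) (x : ℝ) : Continuous (fun t : ℝ => Complex.exp (((2 * Real.pi * ν * t - x * Real.sin (2 * Real.pi * t) : ℝ) : ℂ) * I)) := by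
  fun_prop

lemma JJ_half (ν : ℤ) (x : ℝ) : ‖JJ ν x‖ ≤ 2 * ‖∫ t in (0:ℝ)..(1/2), Complex.exp (((2 * Real.pi * ν * t - x * Real.sin (2 * Real.pi * t) : ℝ) : ℂ) * I)‖ := by
  have hs : JJ ν x = (∫ t in (-(1:ℝ)/2)..0, Complex.exp (((2 * Real.pi * ν * t - x * Real.sin (2 * Real.pi * t) : ℝ) : ℂ) * I)) + ∫ t in (0:ℝ)..(1/2), Complex.exp (((2 * Real.pi * ν * t - x * Real.sin (2 * Real.pi * t) : ℝ) : ℂ) * I) := by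
    unfold JJ
    rw [intervalIntegral.integral_add_adjacent_intervals]
    · exact (cont_JJ ν x).intervalIntegrable _ _
    · exact (cont_JJ ν x).intervalIntegrable _ _
  have hneg : (∫ t in (-(1:ℝ)/2)..0, Complex.exp (((2 * Real.pi * ν * t - x * Real.sin (2 * Real.pi * t) : ℝ) : ℂ) * I)) = (starRingEnd ℂ) (∫ t in (0:ℝ)..(1/2), Complex.exp (((2 * Real.pi * ν * t - x * Real.sin (2 * Real.pi * t) : ℝ) : ℂ) * I)) := by
    have := intervalIntegral.integral_comp_neg (a := (0:ℝ)) (b := 1/2) (fun t => Complex.exp (((2 * Real.pi * ν * t - x * Real.sin (2 * Real.pi * t) : ℝ) : ℂ) * I))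
    rw [neg_zero, ← neg_div] at this
    rw [← this, intervalIntegral.integral_of_le (by norm_num), intervalIntegral.integral_of_le (by norm_num), ← integral_conj]
    congr 1; ext t
    rw [← Complex.exp_conj]
    congr 1
    rw [map_mul, conj_I, conj_ofReal]
    simp only [mul_neg, Real.sin_neg]
    push_cast; ring
  rw [hs, hneg]
  refine (norm_add_le _ _).trans ?_
  rw [RCLike.norm_conj]; linarith

lemma JJ_bound (ν : ℤ) (x : ℝ) (hν : 0 ≤ ν) (hx : 0 < x) (hνx : 2 * (ν:ℝ) ≤ x) :
    ‖JJ ν x‖ ≤ 12 / Real.sqrt x := by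
  have hsx : 0 < Real.sqrt x := Real.sqrt_pos.2 hx
  by_cases hx144 : x < 144
  · refine (JJ_norm_le_one ν x).trans ?_
    rw [le_div_iff₀ hsx, one_mul]
    rw [Real.sqrt_le_left (by norm_num)]
    norm_num; linarith
  push Not at hx144
  have hsx12 : 12 ≤ Real.sqrt x := by
    exact Real.le_sqrt_of_sq_le (by norm_num; linarith)
  refine (JJ_half ν x).trans ?_
  set q : ℝ := ν / x with hq
  have hν' : (0:ℝ) ≤ ν := by exact_mod_cast hν
  have hq0 : 0 ≤ q := by positivity
  have hq1 : q ≤ 1/2 := by rw [hq, div_le_iff₀ hx]; linarith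
  have hνq : (ν:ℝ) = x * q := by rw [hq]; field_simp
  set δ : ℝ := 1 / Real.sqrt x with hδ
  have hδ0 : 0 < δ := by positivity
  have hδ1 : δ ≤ 1/12 := by
    rw [hδ]; exact one_div_le_one_div_of_le (by norm_num) hsx12
  set t0 : ℝ := Real.arccos q / (2 * Real.pi) with ht0
  have hpi := Real.pi_pos
  have h2t0 : 2 * Real.pi * t0 = Real.arccos q := by rw [ht0]; field_simp
  have harc1 : Real.arccos q ≤ Real.pi / 2 := by rw [Real.arccos_le_pi_div_two]; exact hq0
  have harc2 : Real.pi / 3 ≤ Real.arccos q := by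
    have : Real.arccos (1/2) = Real.pi / 3 := by
      rw [← Real.cos_pi_div_three, Real.arccos_cos] <;> linarith
    rw [← this]
    exact Real.arccos_le_arccos hq1
  have hcos : Real.cos (2 * Real.pi * t0) = q := by
    rw [h2t0, Real.cos_arccos] <;> linarith
  have ht0a : 1/6 ≤ t0 := by
    have : Real.pi / 3 ≤ 2 * Real.pi * t0 := by rw [h2t0]; exact harc2
    by_contra h; push Not at h
    nlinarith
  have ht0b : t0 ≤ 1/4 := by
    have : 2 * Real.pi * t0 ≤ Real.pi / 2 := by rw [h2t0]; exact harc1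
    by_contra h; push Not at h
    nlinarith
  have hsd : 2 * δ ≤ Real.sin (Real.pi * δ) := by
    have := Real.mul_le_sin (x := Real.pi * δ) (by positivity) (by nlinarith)
    calc 2 * δ = 2 / Real.pi * (Real.pi * δ) := by field_simp
      _ ≤ _ := this
  have hsin_half : ∀ y, Real.pi / 6 ≤ y → y ≤ Real.pi - Real.pi/6 → 1/2 ≤ Real.sin y := by
    intro y hy1 hy2
    rw [← Real.sin_pi_div_six]
    by_cases hy : y ≤ Real.pi / 2
    · exact Real.sin_le_sin_of_le_of_le_pi_div_two (by linarith) hy hy1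
    · push Not at hy
      rw [← Real.sin_pi_sub y]
      exact Real.sin_le_sin_of_le_of_le_pi_div_two (by linarith) (by linarith) (by linarith)
  -- cos bounds
  have hL : ∀ t ∈ Set.Icc 0 (t0 - δ), q + 2 * δ ≤ Real.cos (2 * Real.pi * t) := by
    intro t ht
    have m : Real.cos (2 * Real.pi * (t0 - δ)) ≤ Real.cos (2 * Real.pi * t) := by
      apply Real.cos_le_cos_of_nonneg_of_le_pi
      · have := ht.1; positivity
      · nlinarith
      · have := ht.2; gcongr
    have e : Real.cos (2 * Real.pi * (t0 - δ)) - Real.cos (2 * Real.pi * t0) = 2 * Real.sin (2 * Real.pi * t0 - Real.pi * δ) * Real.sin (Real.pi * δ) := by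
      rw [Real.cos_sub_cos]
      have e1 : (2 * Real.pi * (t0 - δ) + 2 * Real.pi * t0) / 2 = 2 * Real.pi * t0 - Real.pi * δ := by ring
      have e2 : (2 * Real.pi * (t0 - δ) - 2 * Real.pi * t0) / 2 = -(Real.pi * δ) := by ring
      rw [e1, e2, Real.sin_neg]; ring
    have s1 := hsin_half (2 * Real.pi * t0 - Real.pi * δ) (by nlinarith) (by nlinarith)
    rw [hcos] at e
    nlinarith
  have hR : ∀ t ∈ Set.Icc (t0 + δ) (1/2), Real.cos (2 * Real.pi * t) ≤ q - 2 * δ := by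
    intro t ht
    have m : Real.cos (2 * Real.pi * t) ≤ Real.cos (2 * Real.pi * (t0 + δ)) := by
      apply Real.cos_le_cos_of_nonneg_of_le_pi
      · have : 0 ≤ t0 + δ := by linarith
        positivity
      · have := ht.2; nlinarith
      · have := ht.1; gcongr
    have e : Real.cos (2 * Real.pi * (t0 + δ)) - Real.cos (2 * Real.pi * t0) = -2 * Real.sin (2 * Real.pi * t0 + Real.pi * δ) * Real.sin (Real.pi * δ) := by
      rw [Real.cos_sub_cos]
      have e1 : (2 * Real.pi * (t0 + δ) + 2 * Real.pi * t0) / 2 = 2 * Real.pi * t0 + Real.pi * δ := by ring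
      have e2 : (2 * Real.pi * (t0 + δ) - 2 * Real.pi * t0) / 2 = (Real.pi * δ) := by ring
      rw [e1, e2]
    have s1 := hsin_half (2 * Real.pi * t0 + Real.pi * δ) (by nlinarith) (by nlinarith)
    rw [hcos] at e
    nlinarith
  set φ : ℝ → ℝ := fun t => 2 * Real.pi * ν * t - x * Real.sin (2 * Real.pi * t) with hφ
  have d1 : ∀ t, HasDerivAt φ (2 * Real.pi * x * (q - Real.cos (2 * Real.pi * t))) t := by
    intro t
    have h := ((hasDerivAt_id t).const_mul (2 * Real.pi * ν)).fun_sub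
      ((((hasDerivAt_id t).const_mul (2 * Real.pi)).sin).const_mul x)
    refine h.congr_deriv ?_
    rw [hνq]; simp; ring
  have d2 : ∀ t, HasDerivAt (fun t => 2 * Real.pi * x * (q - Real.cos (2 * Real.pi * t))) (4 * Real.pi^2 * x * Real.sin (2 * Real.pi * t)) t := by
    intro t
    have h := ((((hasDerivAt_id t).const_mul (2 * Real.pi)).cos).const_sub q).const_mul (2 * Real.pi * x)
    refine h.congr_deriv ?_
    simp; ring
  have hsinpos : ∀ t ∈ Set.Icc (0:ℝ) (1/2), 0 ≤ 4 * Real.pi^2 * x * Real.sin (2 * Real.pi * t) := by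
    intro t ht
    have : 0 ≤ Real.sin (2 * Real.pi * t) := by
      apply Real.sin_nonneg_of_nonneg_of_le_pi
      · have := ht.1; positivity
      · have := ht.2; nlinarith
    positivity
  have hl : 0 < 4 * Real.pi * x * δ := by positivity
  have I1 := first_deriv_test φ _ _ 0 (t0 - δ) (4 * Real.pi * x * δ) (by linarith) hl d1 d2 (by fun_prop)
    (fun t ht => hsinpos t ⟨ht.1, by linarith [ht.2]⟩) (by
      intro t ht
      have := hL t ht
      rw [abs_mul, abs_of_pos (by positivity : 0 < 2 * Real.pi * x), abs_of_nonpos (by linarith)]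
      have : 2 * δ ≤ -(q - Real.cos (2 * Real.pi * t)) := by linarith
      calc 4 * Real.pi * x * δ = 2 * Real.pi * x * (2 * δ) := by ring
        _ ≤ _ := by gcongr)
  have I2 := first_deriv_test φ _ _ (t0 + δ) (1/2) (4 * Real.pi * x * δ) (by linarith) hl d1 d2 (by fun_prop)
    (fun t ht => hsinpos t ⟨by linarith [ht.1], ht.2⟩) (by
      intro t ht
      have := hR t ht
      rw [abs_mul, abs_of_pos (by positivity : 0 < 2 * Real.pi * x), abs_of_nonneg (by linarith)]
      have : 2 * δ ≤ (q - Real.cos (2 * Real.pi * t)) := by linarith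
      calc 4 * Real.pi * x * δ = 2 * Real.pi * x * (2 * δ) := by ring
        _ ≤ _ := by gcongr)
  have I3 : ‖∫ t in (t0 - δ)..(t0 + δ), Complex.exp ((φ t : ℂ) * I)‖ ≤ 2 * δ := by
    have := intervalIntegral.norm_integral_le_of_norm_le_const (a := t0 - δ) (b := t0 + δ) (C := 1)
      (f := fun t => Complex.exp ((φ t : ℂ) * I)) (fun t _ => (Complex.norm_exp_ofReal_mul_I _).le)
    refine this.trans ?_
    rw [abs_of_pos (by linarith)]; linarith
  have hcφ := cont_JJ ν x
  have hsplit : (∫ t in (0:ℝ)..(1/2), Complex.exp ((φ t : ℂ) * I)) = (∫ t in (0:ℝ)..(t0-δ), Complex.exp ((φ t : ℂ) * I)) + (∫ t in (t0-δ)..(t0+δ), Complex.exp ((φ t : ℂ) * I)) + ∫ t in (t0+δ)..(1/2), Complex.exp ((φ t : ℂ) * I) := by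
    rw [intervalIntegral.integral_add_adjacent_intervals (hcφ.intervalIntegrable _ _) (hcφ.intervalIntegrable _ _),
      intervalIntegral.integral_add_adjacent_intervals (hcφ.intervalIntegrable _ _) (hcφ.intervalIntegrable _ _)]
  change 2 * ‖∫ t in (0:ℝ)..(1/2), Complex.exp ((φ t : ℂ) * I)‖ ≤ _
  rw [hsplit]
  have hl2 : 4 / (4 * Real.pi * x * δ) ≤ δ := by
    rw [div_le_iff₀ hl]
    have : x * δ * δ = 1 := by
      rw [hδ]; field_simp; rw [Real.sq_sqrt hx.le]
    have h3 := Real.pi_gt_three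
    nlinarith
  have := norm_add₃_le (a := ∫ t in (0:ℝ)..(t0-δ), Complex.exp ((φ t : ℂ) * I)) (b := ∫ t in (t0-δ)..(t0+δ), Complex.exp ((φ t : ℂ) * I)) (c := ∫ t in (t0+δ)..(1/2), Complex.exp ((φ t : ℂ) * I))
  have h12 : 12 / Real.sqrt x = 12 * δ := by rw [hδ]; ring
  rw [h12]
  linarith

lemma JJ_rec (ν : ℤ) (x : ℝ) (hx : x ≠ 0) : JJ (ν+1) x + JJ (ν-1) x = ((2 * ν / x : ℝ) : ℂ) * JJ ν x := by
  have key : ∫ t in (-(1:ℝ)/2)..(1/2), (((2 * Real.pi * ν - x * (2 * Real.pi * Real.cos (2 * Real.pi * t)) : ℝ) : ℂ) * I) * Complex.exp (((2 * Real.pi * ν * t - x * Real.sin (2 * Real.pi * t) : ℝ) : ℂ) * I) = 0 := by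
    rw [intervalIntegral.integral_eq_sub_of_hasDerivAt (f := fun t => Complex.exp (((2 * Real.pi * ν * t - x * Real.sin (2 * Real.pi * t) : ℝ) : ℂ) * I))]
    · have a1 : Real.sin (2 * Real.pi * (1/2)) = 0 := by
        rw [show 2 * Real.pi * (1/2) = Real.pi by ring, Real.sin_pi]
      have a2 : Real.sin (2 * Real.pi * (-1/2)) = 0 := by
        rw [show 2 * Real.pi * (-1/2) = -Real.pi by ring, Real.sin_neg, Real.sin_pi, neg_zero]
      rw [a1, a2, sub_eq_zero, Complex.exp_eq_exp_iff_exists_int]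
      refine ⟨ν, ?_⟩
      push_cast; ring
    · intro t _
      have h := ((hasDerivAt_id t).const_mul (2 * Real.pi * ν)).fun_sub
        ((((hasDerivAt_id t).const_mul (2 * Real.pi)).sin).const_mul x)
      have h2 := (h.ofReal_comp.mul_const I).cexp
      refine h2.congr_deriv ?_
      simp; ring
    · apply Continuous.intervalIntegrable
      fun_prop
  have e : ∀ t : ℝ, (((2 * Real.pi * ν - x * (2 * Real.pi * Real.cos (2 * Real.pi * t)) : ℝ) : ℂ) * I) * Complex.exp (((2 * Real.pi * ν * t - x * Real.sin (2 * Real.pi * t) : ℝ) : ℂ) * I)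
     = (2 * Real.pi * ν * I) * Complex.exp (((2 * Real.pi * ν * t - x * Real.sin (2 * Real.pi * t) : ℝ) : ℂ) * I)
       - (Real.pi * x * I) * (Complex.exp (((2 * Real.pi * (ν+1 : ℤ) * t - x * Real.sin (2 * Real.pi * t) : ℝ) : ℂ) * I) + Complex.exp (((2 * Real.pi * (ν-1 : ℤ) * t - x * Real.sin (2 * Real.pi * t) : ℝ) : ℂ) * I)) := by
    intro t
    have p1 : Complex.exp (((2 * Real.pi * (ν+1 : ℤ) * t - x * Real.sin (2 * Real.pi * t) : ℝ) : ℂ) * I) = Complex.exp (((2 * Real.pi * ν * t - x * Real.sin (2 * Real.pi * t) : ℝ) : ℂ) * I) * Complex.exp ((2 * Real.pi * t : ℂ) * I) := by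
      rw [← Complex.exp_add]; congr 1; push_cast; ring
    have p2 : Complex.exp (((2 * Real.pi * (ν-1 : ℤ) * t - x * Real.sin (2 * Real.pi * t) : ℝ) : ℂ) * I) = Complex.exp (((2 * Real.pi * ν * t - x * Real.sin (2 * Real.pi * t) : ℝ) : ℂ) * I) * Complex.exp (-(2 * Real.pi * t : ℂ) * I) := by
      rw [← Complex.exp_add]; congr 1; push_cast; ring
    rw [p1, p2]
    have c : 2 * Complex.cos (2 * Real.pi * t : ℂ) = Complex.exp ((2 * Real.pi * t : ℂ) * I) + Complex.exp (-(2 * Real.pi * t : ℂ) * I) := Complex.two_cos _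
    rw [← mul_add, ← c]
    push_cast; ring
  simp_rw [e] at key
  rw [intervalIntegral.integral_sub, intervalIntegral.integral_const_mul, intervalIntegral.integral_const_mul,
    intervalIntegral.integral_add] at key
  · change (2 * Real.pi * ν * I) * JJ ν x - (Real.pi * x * I) * (JJ (ν+1) x + JJ (ν-1) x) = 0 at key
    have hpi : (Real.pi : ℂ) ≠ 0 := by exact_mod_cast Real.pi_ne_zero
    have hx' : (x : ℂ) ≠ 0 := by exact_mod_cast hx
    push_cast
    field_simp
    have : (Real.pi * I) * (2 * ν * JJ ν x - x * (JJ (ν+1) x + JJ (ν-1) x)) = 0 := by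
      linear_combination key
    rcases mul_eq_zero.1 this with h | h
    · exact absurd h (mul_ne_zero hpi I_ne_zero)
    · linear_combination -h
  · exact (cont_JJ _ x).intervalIntegrable _ _
  · exact (cont_JJ _ x).intervalIntegrable _ _
  · exact ((cont_JJ _ x).const_mul _).intervalIntegrable _ _ 
  · exact (((cont_JJ _ x).add (cont_JJ _ x)).const_mul _).intervalIntegrable _ _ 

end P1


section P2
open Complex

lemma sd2 (J : ℤ → ℂ) (y : ℝ) (hr : ∀ ν, J (ν+1) + J (ν-1) = ((2 * ν / y : ℝ) : ℂ) * J ν) (ν : ℤ) :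
    J (ν+2) + J (ν-2) + 2 * J ν = ((4 * ν^2 / y^2 : ℝ) : ℂ) * J ν + ((2 / y : ℝ) : ℂ) * (J (ν+1) - J (ν-1)) := by
  have h0 := hr ν
  have h1 := hr (ν+1)
  have h2 := hr (ν-1)
  rw [show ν + 1 + 1 = ν + 2 by ring, show ν + 1 - 1 = ν by ring] at h1
  rw [show ν - 1 + 1 = ν by ring, show ν - 1 - 1 = ν - 2 by ring] at h2
  push_cast at *
  linear_combination h1 + h2 + (2 * ν / y : ℂ) * h0

lemma sd2_bound (J : ℤ → ℂ) (y B : ℝ) (hy : 0 < y) (hr : ∀ ν, J (ν+1) + J (ν-1) = ((2 * ν / y : ℝ) : ℂ) * J ν) (ν : ℤ)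
    (hb : ∀ i : ℤ, |i| ≤ 1 → ‖J (ν + i)‖ ≤ B) :
    ‖J (ν+2) + J (ν-2) + 2 * J ν‖ ≤ (4 * ν^2 / y^2 + 4 / y) * B := by
  rw [sd2 J y hr ν]
  have b0 := hb 0 (by simp)
  have b1 := hb 1 (by simp)
  have b2 := hb (-1) (by simp)
  simp only [add_zero, ← sub_eq_add_neg] at b0 b1 b2
  refine (norm_add_le _ _).trans ?_
  rw [norm_mul, norm_mul, Complex.norm_real, Complex.norm_real, Real.norm_of_nonneg (by positivity), Real.norm_of_nonneg (by positivity)]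
  calc _ ≤ 4 * ν^2 / y^2 * B + 2 / y * (B + B) := by
        gcongr
        exact (norm_sub_le _ _).trans (add_le_add b1 b2)
    _ = _ := by ring

lemma f_sd (J : ℤ → ℂ) (X K B : ℝ) (hK : 2 ≤ K) (hX : 12 * K ≤ X)
    (hr : ∀ ν, J (ν+1) + J (ν-1) = ((2 * ν / X : ℝ) : ℂ) * J ν)
    (hb : ∀ ν : ℤ, 0 ≤ ν → (ν:ℝ) ≤ 4 * K + 3 → ‖J ν‖ ≤ B) (j : ℤ) (hj : 2 ≤ j) (hjK : (j:ℝ) ≤ K) :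
    ‖J (2*j+1) + J (2*j-3) + 2 * J (2*j-1) - ((16 * j^2 / X^2 : ℝ) : ℂ) * J (2*j-1)‖ ≤ 6 / X * B := by
  have h := sd2 J X hr (2*j-1)
  rw [show 2*j-1+2 = 2*j+1 by ring, show 2*j-1-2 = 2*j-3 by ring, show 2*j-1+1 = 2*j by ring, show 2*j-1-1 = 2*j-2 by ring] at h
  have hX0 : 0 < X := by linarith
  have hj' : (2:ℝ) ≤ j := by exact_mod_cast hj
  have b0 : ‖J (2*j-1)‖ ≤ B := hb _ (by omega) (by push_cast; linarith)
  have b1 : ‖J (2*j)‖ ≤ B := hb _ (by omega) (by push_cast; linarith)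
  have b2 : ‖J (2*j-2)‖ ≤ B := hb _ (by omega) (by push_cast; linarith)
  have hB : 0 ≤ B := (norm_nonneg _).trans b0
  have e : J (2*j+1) + J (2*j-3) + 2 * J (2*j-1) - ((16 * j^2 / X^2 : ℝ) : ℂ) * J (2*j-1) =
      ((-((16 * j - 4) / X^2) : ℝ) : ℂ) * J (2*j-1) + ((2 / X : ℝ) : ℂ) * (J (2*j) - J (2*j-2)) := by
    rw [h]; push_cast; ring
  rw [e]
  refine (norm_add_le _ _).trans ?_
  rw [norm_mul, norm_mul, Complex.norm_real, Complex.norm_real, norm_neg, Real.norm_of_nonneg (div_nonneg (by linarith) (by positivity)), Real.norm_of_nonneg (by positivity)]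
  have c1 : (16 * j - 4) / X^2 ≤ 2 / X := by
    rw [div_le_div_iff₀ (by positivity) hX0]
    nlinarith
  calc _ ≤ 2 / X * B + 2 / X * (B + B) := by
        gcongr
        exact (norm_sub_le _ _).trans (add_le_add b1 b2)
    _ = _ := by ring

set_option maxHeartbeats 1000000 in
lemma g_sd (J : ℤ → ℂ) (y K B κ : ℝ) (hK : 2 ≤ K) (hy : 12 * K ≤ y) (hκ : 1 ≤ κ) (hKy : K^4 ≤ κ * y^3)
    (hr : ∀ ν, J (ν+1) + J (ν-1) = ((2 * ν / y : ℝ) : ℂ) * J ν)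
    (hb : ∀ ν : ℤ, 0 ≤ ν → (ν:ℝ) ≤ 4 * K + 3 → ‖J ν‖ ≤ B) (j : ℤ) (hj : 2 ≤ j) (hjK : (j:ℝ) ≤ K) :
    ‖J (4*j+3) + J (4*j-5) - 2 * J (4*j-1) + ((256 * j^2 / y^2 : ℝ) : ℂ) * J (4*j-1)‖ ≤ 5000 * κ / y * B := by
  have h0 := sd2 J y hr (4*j-1)
  have h1 := sd2 J y hr (4*j+1)
  have h2 := sd2 J y hr (4*j-3)
  have hδ := sd2_bound J y B (by linarith) hr (4*j-1) (by
    intro i hi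
    rw [abs_le] at hi
    have hi1 : (i:ℝ) ≤ 1 := by exact_mod_cast hi.2
    exact hb _ (by omega) (by push_cast; linarith))
  rw [show 4*j-1+2 = 4*j+1 by ring, show 4*j-1-2 = 4*j-3 by ring, show 4*j-1+1 = 4*j by ring, show 4*j-1-1 = 4*j-2 by ring] at h0
  rw [show 4*j-1+2 = 4*j+1 by ring, show 4*j-1-2 = 4*j-3 by ring] at hδ
  rw [show 4*j+1+2 = 4*j+3 by ring, show 4*j+1-2 = 4*j-1 by ring, show 4*j+1+1 = 4*j+2 by ring, show 4*j+1-1 = 4*j by ring] at h1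
  rw [show 4*j-3+2 = 4*j-1 by ring, show 4*j-3-2 = 4*j-5 by ring, show 4*j-3+1 = 4*j-2 by ring, show 4*j-3-1 = 4*j-4 by ring] at h2
  have hy0 : 0 < y := by linarith
  have hj' : (2:ℝ) ≤ j := by exact_mod_cast hj
  have bb : ∀ i : ℤ, -5 ≤ i → i ≤ 3 → ‖J (4*j+i)‖ ≤ B := by
    intro i hi hi2
    have hi1 : (i:ℝ) ≤ 3 := by exact_mod_cast hi2
    exact hb _ (by omega) (by push_cast; linarith)
  have b0 : ‖J (4*j-1)‖ ≤ B := bb (-1) (by norm_num) (by norm_num)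
  have b1 : ‖J (4*j+1)‖ ≤ B := bb (1) (by norm_num) (by norm_num)
  have b3 : ‖J (4*j-3)‖ ≤ B := bb (-3) (by norm_num) (by norm_num)
  have b4 : ‖J (4*j)‖ ≤ B := by simpa using bb 0 (by norm_num) (by norm_num)
  have b5 : ‖J (4*j-2)‖ ≤ B := bb (-2) (by norm_num) (by norm_num)
  have b6 : ‖J (4*j-4)‖ ≤ B := bb (-4) (by norm_num) (by norm_num)
  have b7 : ‖J (4*j+2)‖ ≤ B := bb (2) (by norm_num) (by norm_num)
  have hB : 0 ≤ B := (norm_nonneg _).trans b0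
  have e : J (4*j+3) + J (4*j-5) - 2 * J (4*j-1) + ((256 * j^2 / y^2 : ℝ) : ℂ) * J (4*j-1) =
      ((16 * (8 * j - 1) / y^2 : ℝ) : ℂ) * J (4*j-1)
      + ((2 / y : ℝ) : ℂ) * (J (4*j+2) - J (4*j-4) - 3 * (J (4*j) - J (4*j-2)))
      + ((4 * (4*j-1)^2 / y^2 : ℝ) : ℂ) * (J (4*j+1) + J (4*j-3) + 2 * J (4*j-1))
      + ((4 * (16*j) / y^2 : ℝ) : ℂ) * J (4*j+1) - ((4 * (16*j - 8) / y^2 : ℝ) : ℂ) * J (4*j-3) := by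
    push_cast at *
    linear_combination h1 + h2 - 2 * h0
  have hP : ∀ r : ℝ, 0 ≤ r → ‖(r:ℂ)‖ = r := fun r hr => by rw [Complex.norm_real, Real.norm_of_nonneg hr]
  have n1 : ‖((16 * (8 * j - 1) / y^2 : ℝ) : ℂ) * J (4*j-1)‖ ≤ 11 / y * B := by
    rw [norm_mul, hP _ (div_nonneg (by linarith) (by positivity))]
    refine mul_le_mul ?_ b0 (norm_nonneg _) (by positivity)
    rw [div_le_div_iff₀ (by positivity) hy0]; nlinarith
  have n2 : ‖((2 / y : ℝ) : ℂ) * (J (4*j+2) - J (4*j-4) - 3 * (J (4*j) - J (4*j-2)))‖ ≤ 16 / y * B := by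
    rw [norm_mul, hP _ (by positivity)]
    have : ‖J (4*j+2) - J (4*j-4) - 3 * (J (4*j) - J (4*j-2))‖ ≤ 8 * B := by
      refine (norm_sub_le _ _).trans ?_
      rw [norm_mul]
      have p1 := norm_sub_le (J (4*j+2)) (J (4*j-4))
      have p2 := norm_sub_le (J (4*j)) (J (4*j-2))
      norm_num
      linarith
    calc _ ≤ 2 / y * (8 * B) := by gcongr
      _ = _ := by ring
  have hq : 4 * ((4*j-1:ℤ):ℝ)^2 / y^2 ≤ 64 * K^2 / y^2 := by
    push_cast
    refine div_le_div_of_nonneg_right ?_ (by positivity)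
    nlinarith
  have n3 : ‖((4 * (4*j-1)^2 / y^2 : ℝ) : ℂ) * (J (4*j+1) + J (4*j-3) + 2 * J (4*j-1))‖ ≤ (4096 * κ / y + 2 / y) * B := by
    rw [norm_mul, hP _ (by positivity)]
    have hq' : 4 * (4*(j:ℝ)-1)^2 / y^2 ≤ 64 * K^2 / y^2 := by push_cast at hq; exact hq
    calc _ ≤ 64 * K^2 / y^2 * ((64 * K^2 / y^2 + 4 / y) * B) := by
          refine mul_le_mul hq' (hδ.trans ?_) (norm_nonneg _) (by positivity)
          gcongr
      _ = (4096 * K^4 / y^4 + 256 * K^2 / y^3) * B := by field_simp; ring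
      _ ≤ _ := by
          refine mul_le_mul_of_nonneg_right (add_le_add ?_ ?_) hB
          · rw [div_le_div_iff₀ (by positivity) hy0]
            nlinarith [mul_le_mul_of_nonneg_right hKy hy0.le]
          · rw [div_le_div_iff₀ (by positivity) hy0]
            have : 144 * K^2 ≤ y^2 := by nlinarith
            nlinarith [mul_le_mul_of_nonneg_right this hy0.le]
  have n4 : ‖((4 * (16*j) / y^2 : ℝ) : ℂ) * J (4*j+1)‖ ≤ 6 / y * B := by
    rw [norm_mul, hP _ (by positivity)]
    refine mul_le_mul ?_ b1 (norm_nonneg _) (by positivity)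
    rw [div_le_div_iff₀ (by positivity) hy0]; nlinarith
  have n5 : ‖((4 * (16*j-8) / y^2 : ℝ) : ℂ) * J (4*j-3)‖ ≤ 6 / y * B := by
    rw [norm_mul, hP _ (div_nonneg (by linarith) (by positivity))]
    refine mul_le_mul ?_ b3 (norm_nonneg _) (by positivity)
    rw [div_le_div_iff₀ (by positivity) hy0]; nlinarith
  rw [e]
  have q1 := norm_add₃_le (a := ((16 * (8 * j - 1) / y^2 : ℝ) : ℂ) * J (4*j-1)) (b := ((2 / y : ℝ) : ℂ) * (J (4*j+2) - J (4*j-4) - 3 * (J (4*j) - J (4*j-2)))) (c := ((4 * (4*j-1)^2 / y^2 : ℝ) : ℂ) * (J (4*j+1) + J (4*j-3) + 2 * J (4*j-1)))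
  refine (norm_sub_le _ _).trans ((add_le_add_left (norm_add_le _ _) _).trans ?_)
  have hfin : 11 / y * B + 16 / y * B + (4096 * κ / y + 2 / y) * B + 6 / y * B + 6 / y * B ≤ 5000 * κ / y * B := by
    have : 41 / y ≤ 41 * κ / y := by gcongr; linarith
    have h2 : 0 ≤ (863 * κ / y) * B := by positivity
    have h3 : 41 / y * B ≤ 41 * κ / y * B := by gcongr
    have e1 : 11 / y * B + 16 / y * B + (4096 * κ / y + 2 / y) * B + 6 / y * B + 6 / y * B = 41 / y * B + 4096 * κ / y * B := by ring
    have e2 : 5000 * κ / y * B = 41 * κ / y * B + 4096 * κ / y * B + 863 * κ / y * B := by ring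
    linarith
  linarith

noncomputable def ff (X : ℝ) (j : ℤ) : ℂ := (-1 : ℂ)^j * JJ (2*j-1) X
noncomputable def gg (Y : ℝ) (j : ℤ) : ℂ := JJ (4*j-1) Y

lemma zp (j : ℤ) : ‖(-1:ℂ)^j‖ = 1 := by simp

set_option maxHeartbeats 1000000 in
lemma KS (X Y K κ : ℝ) (a b : ℕ) (hK : 2 ≤ K) (hκ : 1 ≤ κ) (hX : 12 * K ≤ X) (hY : 12 * K ≤ Y)
    (hKY : K^4 ≤ κ * Y^3) (ha : 2 ≤ a) (hab : a ≤ b) (hb : (b:ℝ) ≤ K + 1) :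
    ‖∑ j ∈ Finset.Ico a b, ((j:ℂ)^2) * (ff X j * gg Y j)‖ * |256 / Y^2 - 16 / X^2| ≤
      2000000 * κ * K * (1/X + 1/Y) / (Real.sqrt X * Real.sqrt Y) := by
  have hX0 : 0 < X := by linarith
  have hY0 : 0 < Y := by linarith
  set B := 12 / Real.sqrt X with hB
  set B' := 12 / Real.sqrt Y with hB'
  have hB0 : 0 ≤ B := by positivity
  have hB0' : 0 ≤ B' := by positivity
  have bX : ∀ ν : ℤ, 0 ≤ ν → (ν:ℝ) ≤ 4 * K + 3 → ‖JJ ν X‖ ≤ B := fun ν h1 h2 => JJ_bound ν X h1 hX0 (by linarith)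
  have bY : ∀ ν : ℤ, 0 ≤ ν → (ν:ℝ) ≤ 4 * K + 3 → ‖JJ ν Y‖ ≤ B' := fun ν h1 h2 => JJ_bound ν Y h1 hY0 (by linarith)
  have rX : ∀ ν : ℤ, JJ (ν+1) X + JJ (ν-1) X = ((2 * ν / X : ℝ) : ℂ) * JJ ν X := fun ν => JJ_rec ν X hX0.ne'
  have rY : ∀ ν : ℤ, JJ (ν+1) Y + JJ (ν-1) Y = ((2 * ν / Y : ℝ) : ℂ) * JJ ν Y := fun ν => JJ_rec ν Y hY0.ne'
  have hP : ∀ r : ℝ, 0 ≤ r → ‖(r:ℂ)‖ = r := fun r hr => by rw [Complex.norm_real, Real.norm_of_nonneg hr]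
  have fb : ∀ j : ℤ, 1 ≤ j → (j:ℝ) ≤ K + 1 → ‖ff X j‖ ≤ B := by
    intro j h1 h2
    unfold ff
    rw [norm_mul, zp, one_mul]
    exact bX _ (by omega) (by push_cast; linarith)
  have gb : ∀ j : ℤ, 1 ≤ j → (j:ℝ) ≤ K + 1 → ‖gg Y j‖ ≤ B' := by
    intro j h1 h2
    exact bY _ (by omega) (by push_cast; linarith)
  have hm1 : (-1:ℂ) ≠ 0 := by norm_num
  have fp : ∀ j : ℤ, (-1:ℂ)^(j+1) = -(-1:ℂ)^j := fun j => by rw [zpow_add₀ hm1]; simp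
  have fm : ∀ j : ℤ, (-1:ℂ)^(j-1) = -(-1:ℂ)^j := fun j => by rw [zpow_sub₀ hm1]; simp [div_neg]
  -- errors
  set e : ℤ → ℂ := fun j => ff X (j+1) + ff X (j-1) - 2 * ff X j + ((16 * j^2 / X^2 : ℝ) : ℂ) * ff X j with he
  set e' : ℤ → ℂ := fun j => gg Y (j+1) + gg Y (j-1) - 2 * gg Y j + ((256 * j^2 / Y^2 : ℝ) : ℂ) * gg Y j with he'
  have heb : ∀ j : ℤ, 2 ≤ j → (j:ℝ) ≤ K → ‖e j‖ ≤ 6 / X * B := by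
    intro j h1 h2
    have := f_sd (fun ν => JJ ν X) X K B hK hX rX bX j h1 h2
    have e0 : e j = -(-1:ℂ)^j * (JJ (2*j+1) X + JJ (2*j-3) X + 2 * JJ (2*j-1) X - ((16 * j^2 / X^2 : ℝ) : ℂ) * JJ (2*j-1) X) := by
      simp only [he, ff, fp, fm]
      rw [show 2 * (j+1) - 1 = 2*j+1 by ring, show 2 * (j-1) - 1 = 2*j-3 by ring]
      ring
    rw [e0, norm_mul, norm_neg, zp, one_mul]
    exact this
  have heb' : ∀ j : ℤ, 2 ≤ j → (j:ℝ) ≤ K → ‖e' j‖ ≤ 5000 * κ / Y * B' := by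
    intro j h1 h2
    have := g_sd (fun ν => JJ ν Y) Y K B' κ hK hY hκ hKY rY bY j h1 h2
    have e0 : e' j = (JJ (4*j+3) Y + JJ (4*j-5) Y - 2 * JJ (4*j-1) Y + ((256 * j^2 / Y^2 : ℝ) : ℂ) * JJ (4*j-1) Y) := by
      simp only [he', gg]
      rw [show 4 * (j+1) - 1 = 4*j+3 by ring, show 4 * (j-1) - 1 = 4*j-5 by ring]
    rw [e0]
    exact this
  set W : ℕ → ℂ := fun j => ff X j * gg Y (j-1) - ff X (j-1) * gg Y j with hW
  have tel : ∑ j ∈ Finset.Ico a b, (W (j+1) - W j) = W b - W a := Finset.sum_Ico_sub _ hab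
  have Wid : ∀ j : ℕ, W (j+1) - W j = ((256 / Y^2 - 16 / X^2 : ℝ) : ℂ) * ((j:ℂ)^2 * (ff X j * gg Y j)) + (e j * gg Y j - ff X j * e' j) := by
    intro j
    simp only [hW, he, he']
    push_cast
    rw [show (j:ℤ) + 1 - 1 = j by ring]
    ring
  have Wb : ∀ j : ℕ, 2 ≤ j → (j:ℝ) ≤ K + 1 → ‖W j‖ ≤ (K * (6 / X) + K * (24 / Y)) * (B * B') := by
    intro j h1 h2
    have h1' : (2:ℝ) ≤ j := by exact_mod_cast h1
    have d1 : ff X j - ff X (j-1) = (-1:ℂ)^(j:ℤ) * (((2 * (2 * j - 2) / X : ℝ) : ℂ) * JJ (2*j-2) X) := by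
      have := rX (2*j-2)
      rw [show (2*j-2 + 1 : ℤ) = 2*j-1 by ring, show (2*j-2 - 1 : ℤ) = 2*j-3 by ring] at this
      simp only [ff, fm]
      rw [show (2 * ((j:ℤ)-1) - 1 : ℤ) = 2*j-3 by ring]
      push_cast at *
      linear_combination (-1:ℂ)^(j:ℤ) * this
    have d2 : gg Y j - gg Y (j-1) = ((2 * (4 * j - 2) / Y : ℝ) : ℂ) * JJ (4*j-2) Y - ((2 * (4 * j - 4) / Y : ℝ) : ℂ) * JJ (4*j-4) Y := by
      have h1 := rY (4*j-2)
      have h2 := rY (4*j-4)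
      rw [show (4*j-2 + 1 : ℤ) = 4*j-1 by ring, show (4*j-2 - 1 : ℤ) = 4*j-3 by ring] at h1
      rw [show (4*j-4 + 1 : ℤ) = 4*j-3 by ring, show (4*j-4 - 1 : ℤ) = 4*j-5 by ring] at h2
      simp only [gg]
      rw [show (4 * ((j:ℤ)-1) - 1 : ℤ) = 4*j-5 by ring]
      push_cast at *
      linear_combination h1 - h2
    have n1 : ‖ff X j - ff X (j-1)‖ ≤ K * (6 / X) * B := by
      rw [d1, norm_mul, zp, one_mul, norm_mul, hP _ (div_nonneg (by linarith) hX0.le)]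
      have := bX (2*j-2) (by omega) (by push_cast; linarith)
      calc _ ≤ 6 * K / X * B := mul_le_mul (div_le_div_of_nonneg_right (by linarith) hX0.le) this (norm_nonneg _) (by positivity)
        _ = _ := by ring
    have n2 : ‖gg Y j - gg Y (j-1)‖ ≤ K * (24 / Y) * B' := by
      rw [d2]
      refine (norm_sub_le _ _).trans ?_
      rw [norm_mul, hP _ (div_nonneg (by linarith) hY0.le), norm_mul, hP _ (div_nonneg (by linarith) hY0.le)]
      have t1 := bY (4*j-2) (by omega) (by push_cast; linarith)
      have t2 := bY (4*j-4) (by omega) (by push_cast; linarith)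
      calc _ ≤ 12 * K / Y * B' + 12 * K / Y * B' := add_le_add (mul_le_mul (div_le_div_of_nonneg_right (by linarith) hY0.le) t1 (norm_nonneg _) (by positivity)) (mul_le_mul (div_le_div_of_nonneg_right (by linarith) hY0.le) t2 (norm_nonneg _) (by positivity))
        _ = _ := by ring
    have e0 : W j = (ff X j - ff X (j-1)) * gg Y (j-1) - ff X (j-1) * (gg Y j - gg Y (j-1)) := by
      simp only [hW]; ring
    rw [e0]
    refine (norm_sub_le _ _).trans ?_
    rw [norm_mul, norm_mul]
    have g1 := gb (j-1) (by omega) (by push_cast; linarith)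
    have f1 := fb (j-1) (by omega) (by push_cast; linarith)
    calc _ ≤ K * (6 / X) * B * B' + B * (K * (24 / Y) * B') := by gcongr
      _ = _ := by ring
  have main : ((256 / Y^2 - 16 / X^2 : ℝ) : ℂ) * ∑ j ∈ Finset.Ico a b, ((j:ℂ)^2) * (ff X j * gg Y j) = W b - W a - ∑ j ∈ Finset.Ico a b, (e j * gg Y j - ff X j * e' j) := by
    rw [← tel, Finset.sum_congr rfl (fun j _ => Wid j), Finset.sum_add_distrib, Finset.mul_sum]
    ring
  have ha' : (a:ℝ) ≤ b := by exact_mod_cast hab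
  have errb : ‖∑ j ∈ Finset.Ico a b, (e j * gg Y j - ff X j * e' j)‖ ≤ K * ((6 / X + 5000 * κ / Y) * (B * B')) := by
    calc _ ≤ ∑ j ∈ Finset.Ico a b, (6 / X + 5000 * κ / Y) * (B * B') := by
          apply norm_sum_le_of_le
          intro j hj
          rw [Finset.mem_Ico] at hj
          have hjb : (j:ℝ) + 1 ≤ b := by exact_mod_cast hj.2
          have p1 := heb j (by omega) (by push_cast; linarith)
          have p2 := heb' j (by omega) (by push_cast; linarith)
          have p3 := fb j (by omega) (by push_cast; linarith)
          have p4 := gb j (by omega) (by push_cast; linarith)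
          refine (norm_sub_le _ _).trans ?_
          rw [norm_mul, norm_mul]
          calc _ ≤ 6 / X * B * B' + B * (5000 * κ / Y * B') := by gcongr
            _ = _ := by ring
      _ = ((b - a : ℕ) : ℝ) * ((6 / X + 5000 * κ / Y) * (B * B')) := by simp
      _ ≤ _ := by
          gcongr
          rw [Nat.cast_sub hab]
          have : (2:ℝ) ≤ a := by exact_mod_cast ha
          linarith
  have := congrArg norm main
  rw [norm_mul, Complex.norm_real, Real.norm_eq_abs] at this
  rw [mul_comm, this]
  have wb := Wb b (by omega) hb
  have wa := Wb a ha (by linarith)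
  calc _ ≤ ‖W b‖ + ‖W a‖ + K * ((6 / X + 5000 * κ / Y) * (B * B')) := (norm_sub_le _ _).trans (add_le_add (norm_sub_le _ _) errb)
    _ ≤ (K * (6 / X) + K * (24 / Y)) * (B * B') + (K * (6 / X) + K * (24 / Y)) * (B * B') + K * ((6 / X + 5000 * κ / Y) * (B * B')) := by gcongr
    _ = (18 * (1/X) + 48 * (1/Y) + 5000 * κ * (1/Y)) * K * (B * B') := by ring
    _ ≤ (10000 * κ * (1/X + 1/Y)) * K * (B * B') := by
        gcongr
        have hx : 0 < 1/X := by positivity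
        have hy : 0 < 1/Y := by positivity
        nlinarith [mul_le_mul_of_nonneg_right hκ hx.le, mul_le_mul_of_nonneg_right hκ hy.le]
    _ = 1440000 * κ * K * (1/X + 1/Y) / (Real.sqrt X * Real.sqrt Y) := by rw [hB, hB']; ring
    _ ≤ _ := by gcongr; norm_num

end P2


section P3
open Complex MeasureTheory Set

lemma Gm_le (s : ℂ) (hs : 0 < s.re) : ‖Complex.Gamma s‖ ≤ Real.Gamma s.re := by
  rw [Complex.Gamma_eq_integral hs, Complex.GammaIntegral, Real.Gamma_eq_integral hs]
  refine (norm_integral_le_integral_norm _).trans (le_of_eq ?_)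
  refine setIntegral_congr_fun measurableSet_Ioi fun x hx => ?_
  rw [norm_mul, Complex.norm_real, Real.norm_of_nonneg (Real.exp_pos _).le, Complex.norm_cpow_eq_rpow_re_of_pos hx]
  simp

lemma Gm_dec (a t : ℝ) (ha : 0 ≤ a) : ‖Complex.Gamma (1 + t * I + a)‖ ≤ Real.Gamma (a + 3) * (1 + t^2)⁻¹ := by
  set s : ℂ := 1 + t * I + a with hs
  have hre : s.re = 1 + a := by simp [hs]
  have him : s.im = t := by simp [hs]
  have h0 : s ≠ 0 := fun h => by rw [h] at hre; simp at hre; linarith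
  have h1 : s + 1 ≠ 0 := fun h => by
    have := congrArg re h
    simp [hre] at this; linarith
  have e1 := Complex.Gamma_add_one s h0
  have e2 := Complex.Gamma_add_one (s+1) h1
  have b := Gm_le (s + 1 + 1) (by simp [hre]; linarith)
  rw [e2, e1, norm_mul, norm_mul] at b
  have hre2 : (s + 1 + 1).re = a + 3 := by simp [hre]; ring
  rw [hre2] at b
  have n0 : Real.sqrt (1 + t^2) ≤ ‖s‖ := by
    rw [Complex.norm_eq_sqrt_sq_add_sq, hre, him]
    exact Real.sqrt_le_sqrt (by nlinarith)
  have n1 : Real.sqrt (1 + t^2) ≤ ‖s+1‖ := by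
    rw [Complex.norm_eq_sqrt_sq_add_sq]
    simp only [add_re, add_im, hre, him, one_re, one_im]
    exact Real.sqrt_le_sqrt (by nlinarith)
  have hp : 0 < 1 + t^2 := by positivity
  rw [← div_eq_mul_inv, le_div_iff₀ hp]
  calc ‖Complex.Gamma s‖ * (1 + t^2) = Real.sqrt (1+t^2) * (Real.sqrt (1+t^2) * ‖Complex.Gamma s‖) := by
        rw [← mul_assoc, Real.mul_self_sqrt hp.le, mul_comm]
    _ ≤ ‖s+1‖ * (‖s‖ * ‖Complex.Gamma s‖) := by gcongr
    _ ≤ _ := b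

lemma Gm_cont (a : ℝ) (ha : 0 ≤ a) : Continuous fun t : ℝ => Complex.Gamma (1 + t * I + a) := by
  rw [continuous_iff_continuousAt]
  intro t
  have : ContinuousAt Complex.Gamma (1 + t * I + a) := by
    refine (Complex.differentiableAt_Gamma _ fun m h => ?_).continuousAt
    have := congrArg re h
    simp at this
    have hm : (0:ℝ) ≤ m := by positivity
    linarith
  exact ContinuousAt.comp (f := fun t : ℝ => (1 + t * I + a : ℂ)) this (by fun_prop)

lemma cp_cont (x : ℝ) (hx : 0 < x) : Continuous fun t : ℝ => (x:ℂ) ^ (-(1 + (t:ℂ) * I)) := by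
  refine Continuous.const_cpow (by fun_prop) (Or.inl (by exact_mod_cast hx.ne'))

lemma Gm_int (a : ℝ) (ha : 0 ≤ a) : Integrable fun t : ℝ => Complex.Gamma (1 + t * I + a) := by
  refine Integrable.mono' (integrable_inv_one_add_sq.const_mul (Real.Gamma (a+3))) (Gm_cont a ha).aestronglyMeasurable ?_
  exact Filter.Eventually.of_forall fun t => Gm_dec a t ha

lemma MI (i : ℕ) (x : ℝ) (hx : 0 < x) :
    ∫ t : ℝ, (x:ℂ) ^ (-(1 + (t:ℂ) * I)) * Complex.Gamma (1 + t * I + (i:ℝ)) = ((2 * Real.pi * (x^i * Real.exp (-x)) : ℝ) : ℂ) := by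
  set f : ℝ → ℂ := fun y => ((y:ℂ)^((i:ℝ):ℂ)) • ((Real.exp (-y) : ℝ):ℂ) with hf
  have hm : ∀ t : ℝ, mellin f (1 + t * I) = Complex.Gamma (1 + t * I + (i:ℝ)) := by
    intro t
    rw [hf, mellin_cpow_smul, Complex.Gamma_eq_integral (by simp; positivity), Complex.GammaIntegral_eq_mellin]
  have h := mellinInv_mellin_eq 1 f hx ?_ ?_ ?_
  · rw [mellinInv] at h
    simp only [ofReal_one, hm] at h
    have hpi : (Real.pi:ℂ) ≠ 0 := by exact_mod_cast Real.pi_ne_zero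
    simp only [smul_eq_mul] at h
    rw [hf] at h
    simp only [smul_eq_mul, ofReal_natCast, cpow_natCast] at h
    rw [one_div, inv_smul_eq_iff₀ (by positivity)] at h
    simp only [ofReal_natCast]
    rw [h]
    simp
  · rw [hf, MellinConvergent]
    have := Real.GammaIntegral_convergent (s := i + 1) (by positivity)
    have h2 : IntegrableOn (fun y : ℝ => ((Real.exp (-y) * y ^ ((i:ℝ) + 1 - 1) : ℝ) : ℂ)) (Ioi 0) := Integrable.ofReal this
    refine h2.congr_fun ?_ measurableSet_Ioi
    intro y hy
    simp [mul_comm]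
  · rw [VerticalIntegrable]
    simp only [ofReal_one, hm]
    exact Gm_int i (by positivity)
  · rw [hf]
    simp only [ofReal_natCast, cpow_natCast]
    fun_prop

noncomputable def v1 (k : ℕ) (ξ : ℝ) : ℝ := ∑ i ∈ Finset.range k, (2 * Real.pi * ξ)^i * Real.exp (-(2 * Real.pi * ξ)) / i.factorial

lemma Gsum (s : ℂ) (hs : 0 < s.re) (k : ℕ) : ∑ i ∈ Finset.range (k+1), Complex.Gamma (s + i) / (i.factorial : ℂ) = Complex.Gamma (s + (k+1)) / (Complex.Gamma (k+1) * s) := by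
  have h0 : s ≠ 0 := fun h => by rw [h] at hs; simp at hs
  induction k with
  | zero =>
    simp [Complex.Gamma_add_one s h0]
    field_simp
  | succ k ih =>
    rw [Finset.sum_range_succ, ih]
    have h1 : s + (k+1) ≠ 0 := fun h => by
      have := congrArg re h
      simp at this
      have hk : (0:ℝ) ≤ k := by positivity
      linarith
    have e1 := Complex.Gamma_add_one _ h1
    have hf : (k.factorial : ℂ) ≠ 0 := by exact_mod_cast k.factorial_ne_zero
    have hk1 : (k:ℂ) + 1 ≠ 0 := by exact_mod_cast k.succ_ne_zero
    rw [Complex.Gamma_nat_eq_factorial]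
    have e3 : Complex.Gamma (((k+1:ℕ):ℂ)+1) = (k+1) * k.factorial := by
      rw [Complex.Gamma_nat_eq_factorial, Nat.factorial_succ]; push_cast; ring
    rw [e3, Nat.factorial_succ]
    push_cast
    rw [show s + (k + 1 + 1) = s + (k+1) + 1 by ring, e1]
    field_simp
    ring

lemma V1_eq (k : ℕ) (hk : 1 ≤ k) (ξ : ℝ) (hξ : 0 < ξ) : V 1 k ξ = (v1 k ξ : ℂ) := by
  obtain ⟨k, rfl⟩ : ∃ k', k = k' + 1 := ⟨k-1, by omega⟩
  have hx : 0 < 2 * Real.pi * ξ := by positivity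
  have key : ∀ t : ℝ, (Lam 1 (k+1:ℕ) (1/2 + (1 + (t:ℂ) * Complex.I)) / Lam 1 (k+1:ℕ) (1/2)) *
      (ξ : ℂ) ^ (-(1 + (t:ℂ) * Complex.I)) / (1 + (t:ℂ) * Complex.I) * Complex.I =
      Complex.I * ∑ i ∈ Finset.range (k+1), (((2 * Real.pi * ξ : ℝ):ℂ) ^ (-(1 + (t:ℂ) * I)) * Complex.Gamma (1 + t * I + (i:ℝ))) / (i.factorial : ℂ) := by
    intro t
    have hG := Gsum (1 + t * I) (by simp) k
    have h1 : (1 + t * I : ℂ) ≠ 0 := fun h => by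
      have := congrArg re h
      simp at this
    have e : ∑ i ∈ Finset.range (k+1), (((2 * Real.pi * ξ : ℝ):ℂ) ^ (-(1 + (t:ℂ) * I)) * Complex.Gamma (1 + t * I + (i:ℝ))) / (i.factorial : ℂ) = ((2 * Real.pi * ξ : ℝ):ℂ) ^ (-(1 + (t:ℂ) * I)) * ∑ i ∈ Finset.range (k+1), Complex.Gamma (1 + t * I + i) / (i.factorial : ℂ) := by
      rw [Finset.mul_sum]
      refine Finset.sum_congr rfl fun i _ => ?_
      push_cast; ring
    rw [e, hG]
    have e2 : ((2 * Real.pi * ξ : ℝ):ℂ) ^ (-(1 + (t:ℂ) * I)) = ((2 * Real.pi : ℝ):ℂ) ^ (-(1 + (t:ℂ) * I)) * (ξ:ℂ) ^ (-(1 + (t:ℂ) * I)) := by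
      rw [ofReal_mul]
      exact mul_cpow_ofReal_nonneg (by positivity) hξ.le _
    have hpi : (2 * Real.pi : ℂ) ≠ 0 := by
      exact_mod_cast (by positivity : (2 * Real.pi : ℝ) ≠ 0)
    have e3 : (2 * Real.pi : ℂ) ^ (-(1/2 + (1 + (t:ℂ) * Complex.I))) = (2 * Real.pi : ℂ) ^ (-(1/2):ℂ) * (2 * Real.pi : ℂ) ^ (-(1 + (t:ℂ) * I)) := by
      rw [← cpow_add _ _ hpi]; congr 1; ring
    have hc : (2 * Real.pi : ℂ) ^ (-(1/2):ℂ) ≠ 0 := by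
      rw [Ne, cpow_eq_zero_iff]; tauto
    have hGk : Complex.Gamma (k+1) ≠ 0 := by
      rw [Complex.Gamma_nat_eq_factorial]; exact_mod_cast k.factorial_ne_zero
    rw [e2]
    simp only [Lam, if_true]
    rw [e3, show (1/2 + (1 + (t:ℂ) * I) + (((k+1:ℕ):ℝ):ℂ) - 1/2) = 1 + t * I + (k+1) by push_cast; ring,
      show (1/2 + (((k+1:ℕ):ℝ):ℂ) - 1/2) = (k:ℂ)+1 by push_cast; ring]
    push_cast
    field_simp
  rw [V]
  simp_rw [key]
  rw [integral_const_mul, integral_finsetSum]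
  · simp_rw [integral_div, MI _ _ hx, v1]
    rw [← mul_assoc, Finset.mul_sum]
    push_cast
    refine Finset.sum_congr rfl fun i _ => ?_
    have hpi : (Real.pi:ℂ) ≠ 0 := by exact_mod_cast Real.pi_ne_zero
    field_simp
  · intro i _
    refine Integrable.div_const ?_ _
    refine (Gm_int i (by positivity)).bdd_mul (c := (2 * Real.pi * ξ)⁻¹) (cp_cont _ hx).aestronglyMeasurable ?_
    refine Filter.Eventually.of_forall fun t => ?_
    rw [Complex.norm_cpow_eq_rpow_re_of_pos hx]
    simp [Real.rpow_neg_one]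

end P3


section P3b
open Complex MeasureTheory Set

lemma v1_nonneg (k : ℕ) (ξ : ℝ) (h : 0 ≤ ξ) : 0 ≤ v1 k ξ := by
  unfold v1; positivity

lemma v1_mono (k : ℕ) (ξ : ℝ) (h : 0 ≤ ξ) : v1 k ξ ≤ v1 (k+1) ξ := by
  unfold v1
  rw [Finset.sum_range_succ]
  have : 0 ≤ (2 * Real.pi * ξ)^k * Real.exp (-(2 * Real.pi * ξ)) / k.factorial := by positivity
  linarith

lemma v1_decay (k A : ℕ) (ξ : ℝ) (h : 0 ≤ ξ) : v1 k ξ * ξ^A ≤ ((k:ℝ)+A)^A := by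
  set x := 2 * Real.pi * ξ with hx
  have hx0 : 0 ≤ x := by positivity
  have hxi : ξ ≤ x := by nlinarith [Real.pi_gt_three]
  have e : v1 k ξ = Real.exp (-x) * ∑ i ∈ Finset.range k, x^i / i.factorial := by
    unfold v1
    rw [Finset.mul_sum]
    exact Finset.sum_congr rfl fun i _ => by ring
  have h1 : (∑ i ∈ Finset.range k, x^i / i.factorial) * x^A ≤ ((k:ℝ)+A)^A * Real.exp x := by
    calc (∑ i ∈ Finset.range k, x^i / i.factorial) * x^A ≤ ∑ i ∈ Finset.range k, ((k:ℝ)+A)^A * (x^(A+i) / (A+i).factorial) := by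
          rw [Finset.sum_mul]
          refine Finset.sum_le_sum fun i hi => ?_
          rw [Finset.mem_range] at hi
          have hfa : ((A+i).factorial : ℝ) ≤ i.factorial * ((k:ℝ)+A)^A := by
            have a1 := Nat.factorial_mul_ascFactorial i A
            have a2 := Nat.ascFactorial_le_pow_add i A
            have a3 : (i+A)^A ≤ (k+A)^A := Nat.pow_le_pow_left (by omega) _
            have : (A+i).factorial ≤ i.factorial * (k+A)^A := by
              rw [add_comm, ← a1]; exact Nat.mul_le_mul_left _ (a2.trans a3)
            exact_mod_cast this
          have f1 : (0:ℝ) < i.factorial := by positivity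
          have f2 : (0:ℝ) < (A+i).factorial := by positivity
          rw [div_mul_eq_mul_div, ← mul_div_assoc, div_le_div_iff₀ f1 f2, pow_add]
          have : 0 ≤ x^i * x^A := by positivity
          nlinarith [mul_le_mul_of_nonneg_left hfa this]
      _ = ((k:ℝ)+A)^A * ∑ i ∈ Finset.range k, (x^(A+i) / (A+i).factorial) := by rw [Finset.mul_sum]
      _ ≤ ((k:ℝ)+A)^A * Real.exp x := by
          gcongr
          refine le_trans ?_ (Real.sum_le_exp_of_nonneg hx0 (A+k))
          rw [Finset.sum_range_add]
          have : 0 ≤ ∑ i ∈ Finset.range A, x^i / i.factorial := by positivity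
          linarith
  calc v1 k ξ * ξ^A ≤ v1 k ξ * x^A := by
        have := v1_nonneg k ξ h
        gcongr
    _ = Real.exp (-x) * ((∑ i ∈ Finset.range k, x^i / i.factorial) * x^A) := by rw [e]; ring
    _ ≤ Real.exp (-x) * (((k:ℝ)+A)^A * Real.exp x) := by gcongr
    _ = ((k:ℝ)+A)^A * (Real.exp (-x) * Real.exp x) := by ring
    _ = _ := by rw [← Real.exp_add]; simp

lemma v1_le (k : ℕ) (ξ : ℝ) (h : 0 ≤ ξ) : v1 k ξ ≤ 1 := by
  simpa using v1_decay k 0 ξ h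

noncomputable def om (a : ℝ) (x : ℝ) : ℝ := Real.exp (-x) * x^(a-1)

noncomputable def PP (a : ℝ) (φ : ℝ → ℝ) (c : ℝ) : ℝ := (∫ x in Ioi (0:ℝ), φ (c/x) * om a x) / Real.Gamma a

structure Gd (φ : ℝ → ℝ) : Prop where
  nn : ∀ c, 0 < c → 0 ≤ φ c
  le1 : ∀ c, 0 < c → φ c ≤ 1
  anti : AntitoneOn φ (Ioi 0)

lemma om_int (a : ℝ) (ha : 0 < a) : IntegrableOn (om a) (Ioi 0) := Real.GammaIntegral_convergent ha

lemma om_nn (a x : ℝ) (hx : 0 < x) : 0 ≤ om a x := by unfold om; positivity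

lemma om_I (a : ℝ) (ha : 0 < a) : ∫ x in Ioi (0:ℝ), om a x = Real.Gamma a := (Real.Gamma_eq_integral ha).symm

lemma om_succ (a x : ℝ) (hx : 0 < x) : om (a+1) x = x * om a x := by
  unfold om
  rw [show a + 1 - 1 = (a - 1) + 1 by ring, Real.rpow_add_one hx.ne']
  ring

lemma Gd.mono {φ : ℝ → ℝ} (h : Gd φ) {c : ℝ} (hc : 0 < c) : MonotoneOn (fun x => φ (c/x)) (Ioi 0) := by
  intro x hx y hy hxy
  exact h.anti (div_pos hc hy) (div_pos hc hx) (div_le_div_of_nonneg_left hc.le hx hxy)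

lemma Gd.int {φ : ℝ → ℝ} (h : Gd φ) {c a : ℝ} (hc : 0 < c) (ha : 0 < a) : IntegrableOn (fun x => φ (c/x) * om a x) (Ioi 0) := by
  refine Integrable.bdd_mul (c := 1) (om_int a ha) (aemeasurable_restrict_of_monotoneOn measurableSet_Ioi (h.mono hc)).aestronglyMeasurable ?_
  refine (ae_restrict_iff' measurableSet_Ioi).2 (Filter.Eventually.of_forall fun x hx => ?_)
  rw [Real.norm_of_nonneg (h.nn _ (div_pos hc hx))]
  exact h.le1 _ (div_pos hc hx)

lemma Gd.PP {φ : ℝ → ℝ} (h : Gd φ) {a : ℝ} (ha : 0 < a) : Gd (PP a φ) := by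
  have hG := Real.Gamma_pos_of_pos ha
  refine ⟨fun c hc => ?_, fun c hc => ?_, fun c hc d hd hcd => ?_⟩
  · refine div_nonneg (setIntegral_nonneg measurableSet_Ioi fun x hx => ?_) hG.le
    exact mul_nonneg (h.nn _ (div_pos hc hx)) (om_nn a x hx)
  · unfold _root_.PP
    rw [div_le_one hG, ← om_I a ha]
    refine setIntegral_mono_on (h.int hc ha) (om_int a ha) measurableSet_Ioi fun x hx => ?_
    exact mul_le_of_le_one_left (om_nn a x hx) (h.le1 _ (div_pos hc hx))
  · refine div_le_div_of_nonneg_right ?_ hG.le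
    refine setIntegral_mono_on (h.int hd ha) (h.int hc ha) measurableSet_Ioi fun x hx => ?_
    exact mul_le_mul_of_nonneg_right (h.anti (show (0:ℝ) < c / x from div_pos hc hx) (show (0:ℝ) < d / x from div_pos hd hx) (div_le_div_of_nonneg_right hcd (le_of_lt hx))) (om_nn a x hx)

lemma Gd.PP_succ {φ : ℝ → ℝ} (h : Gd φ) {a c : ℝ} (ha : 0 < a) (hc : 0 < c) : _root_.PP a φ c ≤ _root_.PP (a+1) φ c := by
  have hG := Real.Gamma_pos_of_pos ha
  unfold _root_.PP
  rw [Real.Gamma_add_one ha.ne', div_le_div_iff₀ hG (by positivity)]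
  have i1 := h.int hc ha
  have i2 := h.int hc (a := a+1) (by linarith)
  have j1 := om_int a ha
  have j2 := om_int (a+1) (by linarith)
  have key : φ (c/a) * ((∫ x in Ioi (0:ℝ), om (a+1) x) - a * ∫ x in Ioi (0:ℝ), om a x) ≤ (∫ x in Ioi (0:ℝ), φ (c/x) * om (a+1) x) - a * ∫ x in Ioi (0:ℝ), φ (c/x) * om a x := by
    rw [← integral_const_mul, ← integral_const_mul, ← integral_sub j2 (j1.const_mul a), ← integral_sub i2 (i1.const_mul a), ← integral_const_mul]
    refine setIntegral_mono_on ((j2.sub (j1.const_mul a)).const_mul _) (i2.sub (i1.const_mul a)) measurableSet_Ioi fun x hx => ?_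
    rw [om_succ a x hx]
    have hm := h.mono hc
    have ho := om_nn a x hx
    have : 0 ≤ (φ (c/x) - φ (c/a)) * (x - a) := by
      rcases le_total x a with hxa | hxa
      · have := hm hx ha hxa
        simp only at this
        nlinarith
      · have := hm ha hx hxa
        simp only at this
        nlinarith
    nlinarith [mul_nonneg this ho]
  rw [om_I _ ha, om_I _ (by linarith), Real.Gamma_add_one ha.ne', sub_self, mul_zero] at key
  nlinarith

lemma PP_le_PP {φ ψ : ℝ → ℝ} (h : Gd φ) (h' : Gd ψ) {a c : ℝ} (ha : 0 < a) (hc : 0 < c) (hle : ∀ x, 0 < x → φ x ≤ ψ x) :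
    PP a φ c ≤ PP a ψ c := by
  refine div_le_div_of_nonneg_right ?_ (Real.Gamma_pos_of_pos ha).le
  refine setIntegral_mono_on (h.int hc ha) (h'.int hc ha) measurableSet_Ioi fun x hx => ?_
  exact mul_le_mul_of_nonneg_right (hle _ (div_pos hc hx)) (om_nn a x hx)

lemma Gam_add (a : ℕ) (ha : 1 ≤ a) (A : ℕ) : Real.Gamma ((a:ℝ) + A) ≤ Real.Gamma a * ((a:ℝ)+A)^A := by
  induction A with
  | zero => simp
  | succ A ih =>
    have h1 : (1:ℝ) ≤ a := by exact_mod_cast ha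
    have h0 : (0:ℝ) < (a:ℝ) + A := by positivity
    have hG := Real.Gamma_pos_of_pos (show (0:ℝ) < a by linarith)
    push_cast
    rw [← add_assoc, Real.Gamma_add_one h0.ne']
    calc _ ≤ ((a:ℝ) + A + 1) * (Real.Gamma a * ((a:ℝ)+A+1)^A) := by
          refine mul_le_mul (by linarith) (ih.trans ?_) (Real.Gamma_pos_of_pos h0).le (by positivity)
          refine mul_le_mul_of_nonneg_left (pow_le_pow_left₀ h0.le (by linarith) _) hG.le
      _ = _ := by ring

lemma PP_decay {φ : ℝ → ℝ} (h : Gd φ) {c M : ℝ} (a A : ℕ) (ha : 1 ≤ a) (hc : 0 < c) (hd : ∀ x, 0 < x → φ x * x^A ≤ M) :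
    PP a φ c * c^A ≤ M * ((a:ℝ)+A)^A := by
  have ha0 : (0:ℝ) < a := by exact_mod_cast ha
  have hG := Real.Gamma_pos_of_pos ha0
  have hM : 0 ≤ M := (mul_nonneg (h.nn 1 one_pos) (by positivity)).trans (hd 1 one_pos)
  unfold PP
  rw [div_mul_eq_mul_div, div_le_iff₀ hG, ← integral_mul_const]
  calc ∫ x in Ioi (0:ℝ), φ (c/x) * om a x * c^A ≤ ∫ x in Ioi (0:ℝ), M * om (a + A) x := by
        refine setIntegral_mono_on ((h.int hc ha0).mul_const _) ((om_int _ (by positivity)).const_mul _) measurableSet_Ioi fun x hx => ?_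
        have hx0 : (0:ℝ) < x := hx
        have e : om ((a:ℝ)+A) x = x^A * om a x := by
          unfold om
          rw [show (a:ℝ) + A - 1 = (a - 1) + A by ring, Real.rpow_add_natCast hx0.ne']
          ring
        have := hd (c/x) (div_pos hc hx)
        rw [div_pow, ← mul_div_assoc, div_le_iff₀ (by positivity)] at this
        rw [e]
        nlinarith [mul_le_mul_of_nonneg_right this (om_nn a x hx)]
    _ = M * Real.Gamma (a + A) := by rw [integral_const_mul, om_I _ (by positivity)]
    _ ≤ M * (Real.Gamma a * ((a:ℝ)+A)^A) := by
        gcongr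
        exact Gam_add a ha A
    _ = _ := by ring

noncomputable def ex (c : ℝ) : ℝ := Real.exp (-c)

lemma ex_Gd : Gd ex := ⟨fun c _ => (Real.exp_pos _).le, fun c hc => by unfold ex; simp [hc.le], fun c _ d _ h => by unfold ex; gcongr⟩

noncomputable def v2 (k : ℕ) (ξ : ℝ) : ℝ := PP ((2 * k - 1 : ℕ):ℝ) (PP (k:ℝ) ex) ((2 * Real.pi)^3 * ξ)

lemma v2_bds (k : ℕ) (hk : 1 ≤ k) (ξ : ℝ) (h : 0 < ξ) : 0 ≤ v2 k ξ ∧ v2 k ξ ≤ 1 := by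
  have hk0 : (0:ℝ) < k := by exact_mod_cast hk
  have hk1 : (0:ℝ) < (2 * k - 1 : ℕ) := by
    have : 0 < 2 * k - 1 := by omega
    exact_mod_cast this
  have := (ex_Gd.PP hk0).PP hk1
  exact ⟨this.nn _ (by positivity), this.le1 _ (by positivity)⟩

lemma v2_mono (k : ℕ) (hk : 1 ≤ k) (ξ : ℝ) (h : 0 < ξ) : v2 k ξ ≤ v2 (k+1) ξ := by
  have hk0 : (0:ℝ) < k := by exact_mod_cast hk
  have hk1 : (0:ℝ) < (2 * k - 1 : ℕ) := by
    have : 0 < 2 * k - 1 := by omega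
    exact_mod_cast this
  have hc : 0 < (2 * Real.pi)^3 * ξ := by positivity
  unfold v2
  have g1 := ex_Gd.PP hk0
  have g2 := ex_Gd.PP (a := (k:ℝ)+1) (by linarith)
  refine (PP_le_PP g1 g2 hk1 hc fun x hx => ex_Gd.PP_succ hk0 hx).trans ?_
  rw [show 2 * (k+1) - 1 = 2 * k - 1 + 1 + 1 by omega]
  push_cast
  exact (g2.PP_succ hk1 hc).trans (g2.PP_succ (by linarith) hc)

lemma v2_decay (k A : ℕ) (hk : 1 ≤ k) (ξ : ℝ) (h : 0 < ξ) : v2 k ξ * ξ^A ≤ A.factorial * (2*(k:ℝ)+A)^A * (2*(k:ℝ)+A)^A := by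
  have hk0 : (0:ℝ) < k := by exact_mod_cast hk
  have hc : 0 < (2 * Real.pi)^3 * ξ := by positivity
  have hxi : ξ ≤ (2 * Real.pi)^3 * ξ := by
    have : 1 ≤ (2 * Real.pi)^3 := one_le_pow₀ (by linarith [Real.pi_gt_three])
    nlinarith
  have h1 : ∀ x, 0 < x → ex x * x^A ≤ A.factorial := by
    intro x hx
    unfold ex
    rw [Real.exp_neg, inv_mul_le_iff₀ (Real.exp_pos _)]
    have := Real.pow_div_factorial_le_exp x hx.le A
    rwa [div_le_iff₀ (by positivity)] at this
  have d1 := fun x hx => PP_decay (c := x) ex_Gd k A hk hx h1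
  have d2 := PP_decay (ex_Gd.PP hk0) (2*k-1) A (by omega) hc d1
  have hb := (v2_bds k hk ξ h).1
  have hcast : ((2*k-1:ℕ):ℝ) ≤ 2 * k := by
    rw [Nat.cast_sub (by omega)]; push_cast; linarith
  calc v2 k ξ * ξ^A ≤ v2 k ξ * ((2 * Real.pi)^3 * ξ)^A := by gcongr
    _ ≤ _ := d2
    _ ≤ _ := by
      gcongr
      linarith

end P3b


section P3c
open Complex MeasureTheory Set

lemma om_mellin (a t : ℝ) (ha : 0 ≤ a) : ∫ x in Ioi (0:ℝ), ((om a x : ℝ):ℂ) * (x:ℂ)^(1 + (t:ℂ) * I) = Complex.Gamma (1 + t * I + a) := by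
  rw [Complex.Gamma_eq_integral (by simp; linarith), Complex.GammaIntegral]
  refine setIntegral_congr_fun measurableSet_Ioi fun x hx => ?_
  have hx0 : (0:ℝ) < x := hx
  have hxc : (x:ℂ) ≠ 0 := by exact_mod_cast hx0.ne'
  simp only [om]
  rw [ofReal_mul, Complex.ofReal_cpow hx0.le, mul_assoc, ← cpow_add _ _ hxc]
  congr 2
  push_cast; ring

lemma PT (φ : ℝ → ℝ) (Φ : ℝ → ℂ) (hΦ : Integrable Φ) (h : ∀ c : ℝ, 0 < c → (φ c : ℂ) = (1/(2*Real.pi)) * ∫ t : ℝ, Φ t * (c:ℂ)^(-(1 + (t:ℂ) * I)))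
    (a c : ℝ) (ha : 0 < a) (hc : 0 < c) :
    (PP a φ c : ℂ) = (1/(2*Real.pi)) * ∫ t : ℝ, (Φ t * Complex.Gamma (1 + t * I + a) / Complex.Gamma a) * (c:ℂ)^(-(1 + (t:ℂ) * I)) := by
  have e1 : (PP a φ c : ℂ) = (∫ x in Ioi (0:ℝ), ∫ t : ℝ, ((om a x : ℝ):ℂ) * (x:ℂ)^(1 + (t:ℂ) * I) * (Φ t * (c:ℂ)^(-(1 + (t:ℂ) * I)))) * (1 / (2*Real.pi)) / Complex.Gamma a := by
    unfold PP
    rw [ofReal_div, Complex.Gamma_ofReal]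
    congr 1
    rw [← integral_complex_ofReal, ← integral_mul_const]
    refine setIntegral_congr_fun measurableSet_Ioi fun x hx => ?_
    have hx0 : (0:ℝ) < x := hx
    rw [ofReal_mul, h _ (div_pos hc hx0), mul_assoc, mul_comm]
    congr 1
    rw [mul_comm, ← integral_const_mul]
    refine integral_congr_ae (Filter.Eventually.of_forall fun t => ?_)
    simp only
    have : ((c / x : ℝ):ℂ)^(-(1 + (t:ℂ) * I)) = (x:ℂ)^(1 + (t:ℂ) * I) * (c:ℂ)^(-(1 + (t:ℂ) * I)) := by
      rw [div_eq_mul_inv, ofReal_mul, mul_cpow_ofReal_nonneg hc.le (by positivity), ofReal_inv, inv_cpow, cpow_neg (x:ℂ), inv_inv, mul_comm]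
      rw [Complex.arg_ofReal_of_nonneg hx0.le]
      exact Real.pi_pos.ne
    rw [this]; ring
  have e2 : (∫ x in Ioi (0:ℝ), ∫ t : ℝ, ((om a x : ℝ):ℂ) * (x:ℂ)^(1 + (t:ℂ) * I) * (Φ t * (c:ℂ)^(-(1 + (t:ℂ) * I)))) =
      ∫ t : ℝ, Complex.Gamma (1 + t * I + a) * (Φ t * (c:ℂ)^(-(1 + (t:ℂ) * I))) := by
    rw [integral_integral_swap]
    · refine integral_congr_ae (Filter.Eventually.of_forall fun t => ?_)
      simp only
      rw [integral_mul_const, om_mellin a t ha.le]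
    · have hI : Integrable (fun z : ℝ × ℝ => (om (a+1) z.1) * (‖Φ z.2‖ * c⁻¹)) ((volume.restrict (Ioi (0:ℝ))).prod volume) :=
        Integrable.mul_prod (om_int (a+1) (by linarith)) (hΦ.norm.mul_const _)
      refine Integrable.mono' hI ?_ ?_
      · refine AEStronglyMeasurable.mul ?_ ?_
        · refine Measurable.aestronglyMeasurable ?_
          unfold om
          fun_prop
        · exact (hΦ.aestronglyMeasurable.mul (cp_cont c hc).aestronglyMeasurable).comp_snd
      · have : ∀ᵐ x ∂(volume.restrict (Ioi (0:ℝ))), 0 < x := ae_restrict_mem measurableSet_Ioi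
        have h2 : ∀ᵐ z ∂((volume.restrict (Ioi (0:ℝ))).prod (volume : Measure ℝ)), 0 < z.1 :=
          Measure.quasiMeasurePreserving_fst.ae this
        filter_upwards [h2] with z hz
        simp only [Function.uncurry]
        rw [norm_mul, norm_mul, norm_mul, Complex.norm_real, Real.norm_of_nonneg (om_nn a _ hz), norm_cpow_eq_rpow_re_of_pos hz, norm_cpow_eq_rpow_re_of_pos hc, om_succ a _ hz]
        simp [Real.rpow_neg_one]
        exact le_of_eq (by ring)
  rw [e1, e2, mul_comm, mul_div_assoc]
  rw [← integral_div]
  refine congrArg₂ _ rfl ?_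
  refine integral_congr_ae (Filter.Eventually.of_forall fun t => ?_)
  simp only
  ring

lemma V2_eq (k : ℕ) (hk : 1 ≤ k) (ξ : ℝ) (hξ : 0 < ξ) : V 2 k ξ = (v2 k ξ : ℂ) := by
  have hpi : (Real.pi:ℂ) ≠ 0 := by exact_mod_cast Real.pi_ne_zero
  have hk0 : (0:ℝ) < k := by exact_mod_cast hk
  have hk1 : (0:ℝ) < (2 * k - 1 : ℕ) := by
    have : 0 < 2 * k - 1 := by omega
    exact_mod_cast this
  have hc : 0 < (2 * Real.pi)^3 * ξ := by positivity
  have s0 : ∀ c : ℝ, 0 < c → (ex c : ℂ) = (1/(2*Real.pi)) * ∫ t : ℝ, Complex.Gamma (1 + t * I + (0:ℝ)) * (c:ℂ)^(-(1 + (t:ℂ) * I)) := by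
    intro c hc
    have := MI 0 c hc
    simp only [mul_comm, Nat.cast_zero] at this ⊢
    rw [this]
    unfold ex
    push_cast
    field_simp
  have i0 := Gm_int 0 le_rfl
  have bd : ∀ a : ℝ, 0 < a → ∀ Φ : ℝ → ℂ, Integrable Φ → Integrable fun t : ℝ => Φ t * Complex.Gamma (1 + t * I + a) / Complex.Gamma a := by
    intro a ha Φ hΦ
    refine Integrable.div_const ?_ _
    refine hΦ.mul_bdd (c := Real.Gamma (1 + a)) (Gm_cont a ha.le).aestronglyMeasurable (Filter.Eventually.of_forall fun t => ?_)
    have := Gm_le (1 + t * I + a) (by simp; linarith)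
    simpa using this
  have s1 := fun c hc => PT ex _ i0 s0 k c hk0 hc
  have i1 := bd k hk0 _ i0
  have s2 := PT (PP k ex) _ i1 s1 (2*k-1:ℕ) _ hk1 hc
  rw [v2, s2, V]
  have hI : (1:ℂ) / (2 * Real.pi * I) = 1 / (2 * Real.pi) * I⁻¹ := by field_simp
  rw [hI, mul_assoc, ← integral_const_mul]
  congr 1
  refine integral_congr_ae (Filter.Eventually.of_forall fun t => ?_)
  simp only
  have h1 : (1 + t * I : ℂ) ≠ 0 := fun h => by
    have := congrArg re h
    simp at this
  have h2pi : (2 * Real.pi : ℂ) ≠ 0 := by simp [hpi]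
  set s : ℂ := 1 + t * I with hs
  have kc : ((2*k-1:ℕ):ℝ) = 2 * k - 1 := by rw [Nat.cast_sub (by omega)]; push_cast; ring
  have g1 : Complex.Gamma k ≠ 0 := Complex.Gamma_ne_zero_of_re_pos (by simpa using hk0)
  have g2 : Complex.Gamma (2 * k - 1) ≠ 0 := Complex.Gamma_ne_zero_of_re_pos (by simp; rw [kc] at hk1; linarith)
  have e2 : (((2 * Real.pi)^3 * ξ : ℝ):ℂ) ^ (-s) = (2 * Real.pi:ℂ) ^ (-(3*s)) * (ξ:ℂ) ^ (-s) := by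
    rw [ofReal_mul, mul_cpow_ofReal_nonneg (by positivity) hξ.le]
    congr 1
    have := Complex.cpow_nat_mul (2 * Real.pi : ℂ) 3 (-s)
    rw [show -(3 * s) = (3:ℕ) * -s by push_cast; ring, cpow_nat_mul' ]
    · push_cast; rfl
    · rw [show (2 * Real.pi : ℂ) = ((2 * Real.pi : ℝ) : ℂ) by push_cast; rfl, Complex.arg_ofReal_of_nonneg (by positivity)]
      simp [Real.pi_pos]
    · rw [show (2 * Real.pi : ℂ) = ((2 * Real.pi : ℝ) : ℂ) by push_cast; rfl, Complex.arg_ofReal_of_nonneg (by positivity)]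
      simp [Real.pi_pos.le]
  have e3 : (2 * Real.pi:ℂ) ^ (-3*(1/2+s) - 3 * (k:ℂ) + 3/2) = (2 * Real.pi:ℂ) ^ (-(3*s)) * (2 * Real.pi:ℂ) ^ (-3*(1/2) - 3 * (k:ℂ) + 3/2) := by
    rw [← cpow_add _ _ h2pi]; congr 1; ring
  have hcp : (2 * Real.pi:ℂ) ^ (-3*(1/2) - 3 * (k:ℂ) + 3/2) ≠ 0 := by
    rw [Ne, cpow_eq_zero_iff]; tauto
  rw [e2, kc]
  simp only [Lam, OfNat.ofNat_ne_one, if_false]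
  push_cast
  rw [e3, show (1/2 + s + 2 * (k:ℂ) - 3/2) = s + (2 * k - 1) by ring, show (1/2 + s + (k:ℂ) - 1/2) = s + k by ring,
    show (1/2 + s + 1/2) = s + 1 by ring, Complex.Gamma_add_one s h1, show (1/2 + 2 * (k:ℂ) - 3/2) = 2 * k - 1 by ring,
    show (1/2 + (k:ℂ) - 1/2) = k by ring, show (1/2 + 1/2:ℂ) = 1 by norm_num, Complex.Gamma_one, add_zero]
  field_simp

end P3c


section P4
open Complex

lemma abel (a : ℕ) (z : ℕ → ℂ) (u : ℕ → ℝ) (S U U' : ℝ) (b : ℕ)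
    (hS : ∀ b', a ≤ b' → b' ≤ b → ‖∑ j ∈ Finset.Ico a b', z j‖ ≤ S)
    (hU : ∀ b', a ≤ b' → b' ≤ b → |u b'| ≤ U) (hU' : ∑ j ∈ Finset.Ico a b, |u (j+1) - u j| ≤ U') :
    ∀ b', a ≤ b' → b' ≤ b → ‖∑ j ∈ Finset.Ico a b', (u j : ℂ) * z j‖ ≤ (U + U') * S := by
  intro b' h1 h2
  have hS0 : 0 ≤ S := (norm_nonneg _).trans (hS b' h1 h2)
  have id : ∑ j ∈ Finset.Ico a b', (u j : ℂ) * z j = u b' * (∑ j ∈ Finset.Ico a b', z j) - ∑ j ∈ Finset.Ico a b', ((u (j+1) - u j : ℝ) : ℂ) * ∑ i ∈ Finset.Ico a (j+1), z i := by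
    clear hS hU hU' h2
    induction b', h1 using Nat.le_induction with
    | base => simp
    | succ c hc ih =>
      rw [Finset.sum_Ico_succ_top hc, ih, Finset.sum_Ico_succ_top hc (fun j => ((u (j+1) - u j : ℝ) : ℂ) * ∑ i ∈ Finset.Ico a (j+1), z i), Finset.sum_Ico_succ_top hc z]
      push_cast
      ring
  rw [id]
  refine (norm_sub_le _ _).trans ?_
  rw [norm_mul, Complex.norm_real, Real.norm_eq_abs, add_mul]
  refine add_le_add (mul_le_mul (hU _ h1 h2) (hS _ h1 h2) (norm_nonneg _) ((abs_nonneg _).trans (hU _ h1 h2))) ?_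
  calc _ ≤ ∑ j ∈ Finset.Ico a b', |u (j+1) - u j| * S := by
        apply norm_sum_le_of_le
        intro j hj
        rw [Finset.mem_Ico] at hj
        rw [norm_mul, Complex.norm_real, Real.norm_eq_abs]
        exact mul_le_mul_of_nonneg_left (hS _ (by omega) (by omega)) (abs_nonneg _)
    _ = (∑ j ∈ Finset.Ico a b', |u (j+1) - u j|) * S := by rw [Finset.sum_mul]
    _ ≤ (∑ j ∈ Finset.Ico a b, |u (j+1) - u j|) * S := by
        gcongr
    _ ≤ _ := by gcongr

lemma abel_mono (a : ℕ) (z : ℕ → ℂ) (u : ℕ → ℝ) (S U : ℝ) (b : ℕ)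
    (hS : ∀ b', a ≤ b' → b' ≤ b → ‖∑ j ∈ Finset.Ico a b', z j‖ ≤ S)
    (h0 : ∀ j, a ≤ j → 0 ≤ u j) (hm : ∀ j, a ≤ j → u j ≤ u (j+1)) (hab : a ≤ b) (hU : u b ≤ U) :
    ∀ b', a ≤ b' → b' ≤ b → ‖∑ j ∈ Finset.Ico a b', (u j : ℂ) * z j‖ ≤ 2 * U * S := by
  have mono : ∀ b', a ≤ b' → b' ≤ b → u b' ≤ u b := by
    intro b' h1 h2
    induction b, h2 using Nat.le_induction with
    | base => exact le_rfl
    | succ c hc ih =>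
      have := ih (fun b'' p q => hS b'' p (by omega)) (by omega) ((hm c (by omega)).trans hU)
      exact this.trans (hm c (by omega))
  have := abel a z u S U U b hS (fun b' h1 h2 => by rw [abs_of_nonneg (h0 _ h1)]; exact (mono b' h1 h2).trans hU) ?_
  · intro b' h1 h2
    have := this b' h1 h2
    rwa [← two_mul] at this
  · calc _ = ∑ j ∈ Finset.Ico a b, (u (j+1) - u j) := by
          refine Finset.sum_congr rfl fun j hj => ?_
          rw [Finset.mem_Ico] at hj
          rw [abs_of_nonneg]
          linarith [hm j hj.1]
      _ = u b - u a := Finset.sum_Ico_sub _ hab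
      _ ≤ _ := by linarith [h0 a le_rfl]

lemma v1_mono2 (k : ℕ) (ξ : ℝ) (h : 0 ≤ ξ) : v1 (2*k) ξ ≤ v1 (2*(k+1)) ξ :=
  (v1_mono _ _ h).trans (v1_mono _ _ h)
lemma v2_mono2 (k : ℕ) (hk : 1 ≤ k) (ξ : ℝ) (h : 0 < ξ) : v2 (2*k) ξ ≤ v2 (2*(k+1)) ξ :=
  (v2_mono _ (by omega) _ h).trans (v2_mono _ (by omega) _ h)

/-- from bounds for prefix sums of `j² z_j` to weighted sums -/
lemma wsum (w : ℝ → ℝ) (M₀ M₁ K μ ξ S : ℝ) (a b : ℕ) (z : ℕ → ℂ) (hw0 : ∀ u, |w u| ≤ M₀) (hw1 : ∀ x y, |w x - w y| ≤ M₁ * |x - y|)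
    (hK : 2 ≤ K) (ha : 2 ≤ a) (hab : a ≤ b) (hKa : K ≤ 2 * a) (hb : (b:ℝ) ≤ K + 1) (hμ : 0 < μ) (hξ : 0 < ξ)
    (hS : ∀ b', a ≤ b' → b' ≤ b → ‖∑ j ∈ Finset.Ico a b', (j:ℂ)^2 * z j‖ ≤ S) :
    ‖∑ j ∈ Finset.Ico a b, ((w (2*j/K) * ((2*j-1)/K) * v1 (2*j) μ * v2 (2*j) ξ : ℝ) : ℂ) * z j‖ ≤ 400 * (M₀ + 2 * M₁) * v1 (2*b) μ * v2 (2*b) ξ * S / K^2 := by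
  have hK0 : 0 < K := by linarith
  have ha0 : (2:ℝ) ≤ a := by exact_mod_cast ha
  have hM0 : 0 ≤ M₀ := (abs_nonneg _).trans (hw0 0)
  have hM1 : 0 ≤ M₁ := by
    have := (abs_nonneg _).trans (hw1 1 0)
    simpa using this
  have hS0 : 0 ≤ S := (norm_nonneg _).trans (hS b hab le_rfl)
  have s1 : ∀ b', a ≤ b' → b' ≤ b → ‖∑ j ∈ Finset.Ico a b', ((1/(j:ℝ)^2 : ℝ) : ℂ) * ((j:ℂ)^2 * z j)‖ ≤ (4/K^2 + 4/K^2) * S := by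
    refine abel a _ (fun j => 1/(j:ℝ)^2) S _ _ b hS ?_ ?_
    · intro b' h1 h2
      have : (a:ℝ) ≤ b' := by exact_mod_cast h1
      have hb0 : (0:ℝ) < b' := by linarith
      rw [abs_of_nonneg (by positivity), div_le_div_iff₀ (by positivity) (by positivity)]
      nlinarith
    · calc _ = ∑ j ∈ Finset.Ico a b, -((1/((j+1:ℕ):ℝ)^2) - 1/(j:ℝ)^2) := by
            refine Finset.sum_congr rfl fun j hj => ?_
            rw [Finset.mem_Ico] at hj
            have : (a:ℝ) ≤ j := by exact_mod_cast hj.1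
            have hj0 : (0:ℝ) < j := by linarith
            rw [abs_of_nonpos]
            rw [sub_nonpos]
            refine one_div_le_one_div_of_le (by positivity) ?_
            push_cast
            nlinarith
        _ = -(1/(b:ℝ)^2 - 1/(a:ℝ)^2) := by rw [Finset.sum_neg_distrib, Finset.sum_Ico_sub (fun j => 1/(j:ℝ)^2) hab]
        _ ≤ 1/(a:ℝ)^2 := by
            have : 0 ≤ 1/(b:ℝ)^2 := by positivity
            linarith
        _ ≤ 4/K^2 := by
            rw [div_le_div_iff₀ (by positivity) (by positivity)]
            nlinarith
  have e1 : ∀ j, a ≤ j → ((1/(j:ℝ)^2 : ℝ) : ℂ) * ((j:ℂ)^2 * z j) = z j := by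
    intro j hj
    have : (j:ℂ) ≠ 0 := by
      have : j ≠ 0 := by omega
      exact_mod_cast this
    push_cast
    field_simp
  have s1' : ∀ b', a ≤ b' → b' ≤ b → ‖∑ j ∈ Finset.Ico a b', z j‖ ≤ (4/K^2 + 4/K^2) * S := by
    intro b' h1 h2
    rw [← Finset.sum_congr rfl (fun j hj => e1 j (Finset.mem_Ico.1 hj).1)]
    exact s1 b' h1 h2
  have hbK : (2 * (b:ℝ) - 1) / K ≤ 3 := by
    rw [div_le_iff₀ hK0]; linarith
  have s2 := abel_mono a _ (fun j => (2*j-1)/K) _ 3 b s1' (fun j hj => by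
      have : (a:ℝ) ≤ j := by exact_mod_cast hj
      exact div_nonneg (by linarith) hK0.le) (fun j hj => by
      refine div_le_div_of_nonneg_right ?_ hK0.le
      push_cast; linarith) hab hbK
  have s3 := abel_mono a _ (fun j => v1 (2*j) μ) _ _ b s2 (fun j hj => v1_nonneg _ _ hμ.le) (fun j hj => v1_mono2 j μ hμ.le) hab le_rfl
  have s4 := abel_mono a _ (fun j => v2 (2*j) ξ) _ _ b s3 (fun j hj => (v2_bds _ (by omega) _ hξ).1) (fun j hj => v2_mono2 j (by omega) ξ hξ) hab le_rfl
  have s5 := abel a _ (fun j => w (2*j/K)) _ M₀ (2 * M₁) b s4 (fun j _ _ => hw0 _) (by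
    calc _ ≤ ∑ j ∈ Finset.Ico a b, M₁ * (2 / K) := by
          refine Finset.sum_le_sum fun j _ => (hw1 _ _).trans (le_of_eq ?_)
          congr 1
          rw [show 2 * ((j+1:ℕ):ℝ)/K - 2 * j / K = 2 / K by push_cast; ring, abs_of_nonneg (by positivity)]
      _ = ((b - a : ℕ):ℝ) * (M₁ * (2/K)) := by simp
      _ ≤ K * (M₁ * (2/K)) := by
          gcongr
          rw [Nat.cast_sub hab]; linarith
      _ = _ := by field_simp)
  have := s5 b hab le_rfl
  have e2 : ∑ j ∈ Finset.Ico a b, ((w (2*j/K) * ((2*j-1)/K) * v1 (2*j) μ * v2 (2*j) ξ : ℝ) : ℂ) * z j =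
     ∑ j ∈ Finset.Ico a b, ((w (2*j/K) : ℝ):ℂ) * (((v2 (2*j) ξ : ℝ):ℂ) * (((v1 (2*j) μ : ℝ):ℂ) * ((((2*j-1)/K:ℝ):ℂ) * z j))) := by
    refine Finset.sum_congr rfl fun j hj => ?_
    push_cast; ring
  rw [e2]
  refine this.trans ?_
  have p1 := v1_nonneg (2*b) μ hμ.le
  have p2 := (v2_bds (2*b) (by omega) ξ hξ).1
  have : 0 ≤ (M₀ + 2 * M₁) * v1 (2*b) μ * v2 (2*b) ξ * S / K^2 := by positivity
  calc _ = 192 * ((M₀ + 2 * M₁) * v1 (2*b) μ * v2 (2*b) ξ * S / K^2) := by ring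
    _ ≤ 400 * ((M₀ + 2 * M₁) * v1 (2*b) μ * v2 (2*b) ξ * S / K^2) := by linarith
    _ = _ := by ring

end P4


section P4b
open Complex

noncomputable def Qc (α β γ r₁ r₂ n m c₁ c₂ : ℕ) : ℝ :=
  1 / Real.sqrt ((n:ℝ) * m) * (‖kloos ((n : ℤ) ^ 2) ((r₁ : ℤ) ^ 2) c₂‖ / c₂) * (‖kloos ((n : ℤ) * α * β ^ 2) (m : ℤ) c₁‖ / c₁)

lemma Tterm (w : ℝ → ℝ) (K : ℝ) (α β γ r₁ r₂ j n m c₁ c₂ : ℕ) (hj : 1 ≤ j) (hn : 1 ≤ n) (hm : 1 ≤ m) (hα : 0 < α) (hβ : 0 < β) (hγ : 0 < γ) (hr : 0 < r₂) :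
    T w K α β γ r₁ r₂ (2*j) n m c₁ c₂ = ((1 / Real.sqrt ((n : ℝ) * m) : ℝ) : ℂ) *
      (kloos ((n : ℤ) ^ 2) ((r₁ : ℤ) ^ 2) c₂ / (c₂ : ℂ)) * (kloos ((n : ℤ) * α * β ^ 2) (m : ℤ) c₁ / (c₁ : ℂ)) *
      (((w (2*j/K) * ((2*j-1)/K) * v1 (2*j) m * v2 (2*j) ((n : ℝ) * r₂ ^ 2 * α ^ 3 * β ^ 2 * γ ^ 2) : ℝ) : ℂ) *
        (ff (4 * Real.pi * n * r₁ / c₂) j * gg (4 * Real.pi * Real.sqrt ((n : ℝ) * m * α * β ^ 2) / c₁) j)) := by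
  have h1 : (0:ℝ) < m := by exact_mod_cast hm
  have h2 : (0:ℝ) < n := by exact_mod_cast hn
  unfold T
  rw [V1_eq _ (by omega) _ h1, V2_eq _ (by omega) _ (by positivity), besselJ_eq_JJ, besselJ_eq_JJ]
  unfold ff gg
  rw [show ((2 * j - 1 : ℕ) : ℤ) = 2 * (j:ℤ) - 1 by omega, show ((2 * (2 * j) - 1 : ℕ) : ℤ) = 4 * (j:ℤ) - 1 by omega, pow_mul, Complex.I_sq, zpow_natCast]
  push_cast
  ring

set_option maxHeartbeats 1000000 in
lemma Tsum (w : ℝ → ℝ) (M₀ M₁ K κ ρ : ℝ) (a b : ℕ) (hw0 : ∀ u, |w u| ≤ M₀) (hw1 : ∀ x y, |w x - w y| ≤ M₁ * |x - y|)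
    (hK : 2 ≤ K) (ha : 2 ≤ a) (hab : a ≤ b) (hKa : K ≤ 2 * a) (hb : (b:ℝ) ≤ K + 1)
    (α β γ r₁ r₂ n m c₁ c₂ : ℕ) (hn : 1 ≤ n) (hm : 1 ≤ m) (hα : 0 < α) (hβ : 0 < β) (hγ : 0 < γ) (hr : 0 < r₂)
    (X Y : ℝ) (eX : X = 4 * Real.pi * n * r₁ / c₂) (eY : Y = 4 * Real.pi * Real.sqrt ((n : ℝ) * m * α * β ^ 2) / c₁)
    (hκ : 1 ≤ κ) (hX : 12 * K ≤ X) (hY : 12 * K ≤ Y) (hKY : K^4 ≤ κ * Y^3) (hXY : X ≤ κ * Y) (hYX : Y ≤ κ * X)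
    (hρ : 0 < ρ) (hnρ : n * Y^2 = 16 * X^2 * ρ) :
    ‖∑ j ∈ Finset.Ico a b, T w K α β γ r₁ r₂ (2*j) n m c₁ c₂‖ ≤
      400 * (M₀ + 2 * M₁) * (Qc α β γ r₁ r₂ n m c₁ c₂ * v1 (2*b) m * v2 (2*b) ((n : ℝ) * r₂ ^ 2 * α ^ 3 * β ^ 2 * γ ^ 2)) * (144 * K * κ / X) ∧
    ‖∑ j ∈ Finset.Ico a b, T w K α β γ r₁ r₂ (2*j) n m c₁ c₂‖ * |n - ρ| ≤
      400 * (M₀ + 2 * M₁) * (Qc α β γ r₁ r₂ n m c₁ c₂ * v1 (2*b) m * v2 (2*b) ((n : ℝ) * r₂ ^ 2 * α ^ 3 * β ^ 2 * γ ^ 2)) * (250000 * κ^3 * ρ / K) := by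
  have h1 : (0:ℝ) < m := by exact_mod_cast hm
  have h2 : (0:ℝ) < n := by exact_mod_cast hn
  have hX0 : 0 < X := by linarith
  have hY0 : 0 < Y := by linarith
  have hK0 : 0 < K := by linarith
  set ξ := (n : ℝ) * r₂ ^ 2 * α ^ 3 * β ^ 2 * γ ^ 2 with hξ
  have hξ0 : 0 < ξ := by positivity
  have hM0 : 0 ≤ M₀ := (abs_nonneg _).trans (hw0 0)
  have hM1 : 0 ≤ M₁ := by
    have := (abs_nonneg _).trans (hw1 1 0)
    simpa using this
  have p1 := v1_nonneg (2*b) m h1.le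
  have p2 := (v2_bds (2*b) (by omega) ξ hξ0).1
  have hQ : 0 ≤ Qc α β γ r₁ r₂ n m c₁ c₂ := by unfold Qc; positivity
  have base : ‖∑ j ∈ Finset.Ico a b, T w K α β γ r₁ r₂ (2*j) n m c₁ c₂‖ = Qc α β γ r₁ r₂ n m c₁ c₂ *
     ‖∑ j ∈ Finset.Ico a b, ((w (2*j/K) * ((2*j-1)/K) * v1 (2*j) m * v2 (2*j) ξ : ℝ) : ℂ) * (ff X j * gg Y j)‖ := by
    rw [Finset.sum_congr rfl (fun j hj => Tterm w K α β γ r₁ r₂ j n m c₁ c₂ (by rw [Finset.mem_Ico] at hj; omega) hn hm hα hβ hγ hr),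
      ← Finset.mul_sum, norm_mul, ← eX, ← eY]
    congr 1
    unfold Qc
    rw [norm_mul, norm_mul, norm_div, norm_div, Complex.norm_real, Real.norm_of_nonneg (by positivity), Complex.norm_natCast, Complex.norm_natCast]
  have sXY : 1 / (Real.sqrt X * Real.sqrt Y) ≤ κ / X := by
    rw [div_le_div_iff₀ (by positivity) hX0, one_mul, ← Real.sqrt_mul hX0.le]
    have : X / κ ≤ Real.sqrt (X * Y) := by
      apply Real.le_sqrt_of_sq_le
      rw [div_pow, div_le_iff₀ (by positivity)]
      have : κ * Y ≤ κ^2 * Y := by nlinarith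
      nlinarith
    rwa [div_le_iff₀' (by linarith)] at this
  have app := fun S hS => wsum w M₀ M₁ K m ξ S a b (fun j => ff X j * gg Y j) hw0 hw1 hK ha hab hKa hb h1 hξ0 hS
  have fin : ∀ S, (∀ b', a ≤ b' → b' ≤ b → ‖∑ j ∈ Finset.Ico a b', (j:ℂ)^2 * (ff X j * gg Y j)‖ ≤ S) →
     ‖∑ j ∈ Finset.Ico a b, T w K α β γ r₁ r₂ (2*j) n m c₁ c₂‖ ≤ 400 * (M₀ + 2 * M₁) * (Qc α β γ r₁ r₂ n m c₁ c₂ * v1 (2*b) m * v2 (2*b) ξ) * (S / K^2) := by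
    intro S hS
    rw [base]
    refine (mul_le_mul_of_nonneg_left (app S hS) hQ).trans (le_of_eq ?_)
    ring
  constructor
  · refine (fin (K^3 * (144 * κ / X)) ?_).trans (le_of_eq ?_)
    · intro b' q1 q2
      have q2' : (b':ℝ) ≤ b := by exact_mod_cast q2
      have q1' : (a:ℝ) ≤ b' := by exact_mod_cast q1
      have ha0 : (2:ℝ) ≤ a := by exact_mod_cast ha
      calc _ ≤ ∑ j ∈ Finset.Ico a b', K^2 * (144 * (κ / X)) := by
            apply norm_sum_le_of_le
            intro j hj
            rw [Finset.mem_Ico] at hj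
            have hj1 : (j:ℝ) + 1 ≤ b' := by exact_mod_cast hj.2
            have hj2 : (a:ℝ) ≤ j := by exact_mod_cast hj.1
            have n1 : ‖ff X j‖ ≤ 12 / Real.sqrt X := by
              unfold ff
              rw [norm_mul, zp, one_mul]
              exact JJ_bound _ X (by omega) hX0 (by push_cast; linarith)
            have n2 : ‖gg Y j‖ ≤ 12 / Real.sqrt Y := JJ_bound _ Y (by omega) hY0 (by push_cast; linarith)
            rw [norm_mul, norm_mul, norm_pow, Complex.norm_natCast]
            have hjK : (j:ℝ) ≤ K := by linarith
            calc (j:ℝ)^2 * (‖ff X j‖ * ‖gg Y j‖) ≤ K^2 * (12 / Real.sqrt X * (12 / Real.sqrt Y)) := by gcongr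
              _ = K^2 * (144 * (1 / (Real.sqrt X * Real.sqrt Y))) := by ring
              _ ≤ _ := by gcongr
        _ = ((b' - a : ℕ) : ℝ) * (K^2 * (144 * (κ / X))) := by simp
        _ ≤ K * (K^2 * (144 * (κ / X))) := by
            gcongr
            rw [Nat.cast_sub q1]; linarith
        _ = _ := by ring
    · congr 1
      field_simp
  · rcases eq_or_ne ((n:ℝ) - ρ) 0 with h0 | h0
    · rw [h0, abs_zero, mul_zero]
      positivity
    have hab0 : 0 < |(n:ℝ) - ρ| := abs_pos.2 h0
    have hh := fin (250000 * κ^3 * K * ρ / |(n:ℝ) - ρ|) ?_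
    · refine (mul_le_mul_of_nonneg_right hh hab0.le).trans (le_of_eq ?_)
      rw [mul_assoc]
      congr 1
      field_simp
    · intro b' q1 q2
      have q2' : (b':ℝ) ≤ b := by exact_mod_cast q2
      have := KS X Y K κ a b' hK hκ hX hY hKY ha q1 (by linarith)
      have e : |256 / Y^2 - 16 / X^2| = 16 * |(n:ℝ) - ρ| / (X^2 * ρ) := by
        have : 256 / Y^2 - 16 / X^2 = 16 * ((n:ℝ) - ρ) / (X^2 * ρ) := by
          field_simp
          linear_combination (-16) * hnρ
        rw [this, abs_div, abs_mul, abs_of_pos (by positivity : 0 < X^2 * ρ)]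
        norm_num
      rw [e] at this
      set N := ‖∑ j ∈ Finset.Ico a b', (j:ℂ)^2 * (ff X j * gg Y j)‖ with hN
      have hY1 : 1 / Y ≤ κ / X := by
        rw [div_le_div_iff₀ hY0 hX0]; linarith
      have hX1 : 1 / X ≤ κ / X := by gcongr
      have b2 : 2000000 * κ * K * (1/X + 1/Y) / (Real.sqrt X * Real.sqrt Y) ≤ 4000000 * κ^3 * K / X^2 := by
        calc _ = 2000000 * κ * K * (1/X + 1/Y) * (1 / (Real.sqrt X * Real.sqrt Y)) := by ring
          _ ≤ 2000000 * κ * K * (κ/X + κ/X) * (κ / X) := by gcongr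
          _ = _ := by field_simp; ring
      have b3 := this.trans b2
      rw [le_div_iff₀ hab0]
      rw [mul_div_assoc', div_le_div_iff₀ (by positivity) (by positivity)] at b3
      have hX2 : 0 < 16 * X^2 := by positivity
      refine le_of_mul_le_mul_right ?_ hX2
      linarith

end P4b


section P5a
open Complex

noncomputable def Kz (c : ℕ) [NeZero c] (x y : ZMod c) : ℂ :=
  ∑ b : ZMod c, (if IsUnit b then ZMod.stdAddChar (y * b⁻¹) else 0) * ZMod.stdAddChar (x * b)

lemma sumZ (c : ℕ) [NeZero c] (f : ZMod c → ℂ) : ∑ b : ZMod c, f b = ∑ b ∈ Finset.range c, f (b : ZMod c) := by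
  symm
  refine Finset.sum_bij' (fun b _ => (b : ZMod c)) (fun x _ => x.val) ?_ ?_ ?_ ?_ ?_
  · simp
  · intro x _; simpa using ZMod.val_lt x
  · intro b hb; rw [Finset.mem_range] at hb; exact ZMod.val_cast_of_lt hb
  · intro x _; simp
  · simp

lemma std_ee (c : ℕ) [NeZero c] (x : ZMod c) : ee ((x.val : ℝ) / c) = ZMod.stdAddChar x := by
  rw [ZMod.stdAddChar_apply, ZMod.toCircle_apply, ee]
  congr 1
  push_cast
  ring

lemma kloos_eq (c : ℕ) [NeZero c] (n m : ℤ) : kloos n m c = Kz c n m := by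
  unfold kloos Kz
  rw [sumZ]
  refine Finset.sum_congr rfl fun b _ => ?_
  by_cases h : Nat.Coprime b c
  · rw [if_pos h, if_pos ((ZMod.isUnit_iff_coprime b c).2 h), std_ee, ← AddChar.map_add_eq_mul, add_comm]
  · rw [if_neg h, if_neg (fun h' => h ((ZMod.isUnit_iff_coprime b c).1 h')), zero_mul]

lemma std_norm (c : ℕ) [NeZero c] (x : ZMod c) : ‖(ZMod.stdAddChar x : ℂ)‖ = 1 := by
  rw [ZMod.stdAddChar_apply]; exact Circle.norm_coe _

lemma kloos_le (c : ℕ) (n m : ℤ) : ‖kloos n m c‖ ≤ c := by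
  rcases Nat.eq_zero_or_pos c with rfl | hc
  · simp [kloos]
  haveI : NeZero c := ⟨hc.ne'⟩
  rw [kloos_eq]
  unfold Kz
  calc _ ≤ ∑ b : ZMod c, (1:ℝ) := by
        apply norm_sum_le_of_le
        intro b _
        rw [norm_mul, std_norm, mul_one]
        split_ifs
        · rw [std_norm]
        · simp
    _ = c := by simp

lemma pars (c : ℕ) [NeZero c] (y : ZMod c) : ∑ x : ZMod c, ‖Kz c x y‖^2 ≤ (c:ℝ)^2 := by
  set u : ZMod c → ℂ := fun b => if IsUnit b then ZMod.stdAddChar (y * b⁻¹) else 0 with hu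
  have hun : ∀ b, ‖u b‖ ≤ 1 := by
    intro b
    simp only [hu]
    split_ifs
    · rw [std_norm]
    · simp
  have key : ((∑ x : ZMod c, ‖Kz c x y‖^2 : ℝ) : ℂ) = ((c * ∑ b : ZMod c, ‖u b‖^2 : ℝ) : ℂ) := by
    push_cast
    have e1 : ∀ x : ZMod c, ((‖Kz c x y‖:ℂ))^2 = ∑ b : ZMod c, ∑ b' : ZMod c, (u b * (starRingEnd ℂ) (u b')) * ZMod.stdAddChar (x * (b - b')) := by
      intro x
      rw [← Complex.mul_conj']
      unfold Kz
      rw [map_sum, Finset.sum_mul_sum]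
      refine Finset.sum_congr rfl fun b _ => Finset.sum_congr rfl fun b' _ => ?_
      rw [map_mul (starRingEnd ℂ), mul_sub, sub_eq_add_neg, AddChar.map_add_eq_mul]
      have : (starRingEnd ℂ) (ZMod.stdAddChar (x * b')) = ZMod.stdAddChar (-(x * b')) := by
        rw [AddChar.map_neg_eq_conj]
      rw [this]
      ring
    simp_rw [e1]
    rw [Finset.sum_comm, Finset.mul_sum]
    refine Finset.sum_congr rfl fun b _ => ?_
    rw [Finset.sum_comm]
    simp_rw [← Finset.mul_sum, AddChar.sum_mulShift _ (ZMod.isPrimitive_stdAddChar c), sub_eq_zero]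
    simp only [mul_ite, mul_zero, Finset.sum_ite_eq, Finset.mem_univ, if_true, ZMod.card, Nat.cast_ite, Nat.cast_zero]
    rw [Complex.mul_conj', mul_comm]
  have key' := Complex.ofReal_injective key
  rw [key']
  have : ∑ b : ZMod c, ‖u b‖^2 ≤ ∑ b : ZMod c, (1:ℝ) := Finset.sum_le_sum fun b _ => pow_le_one₀ (norm_nonneg _) (hun b)
  simp only [Finset.sum_const, Finset.card_univ, ZMod.card, nsmul_eq_mul, mul_one] at this
  nlinarith [(Nat.cast_nonneg c : (0:ℝ) ≤ c)]

lemma fiber_sum (c : ℕ) [NeZero c] (f : ZMod c → ℝ) (hf : ∀ x, 0 ≤ f x) (g : ZMod c → ZMod c) (N : ℝ)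
    (hN : ∀ y, ((Finset.univ.filter fun x => g x = y).card : ℝ) ≤ N) : ∑ x, f (g x) ≤ N * ∑ x, f x := by
  classical
  rw [← Finset.sum_fiberwise (s := Finset.univ) (g := g), Finset.mul_sum]
  refine Finset.sum_le_sum fun y _ => ?_
  rw [Finset.sum_congr rfl (g := fun _ => f y) (by intro x hx; rw [Finset.mem_filter] at hx; rw [hx.2])]
  rw [Finset.sum_const, nsmul_eq_mul]
  exact mul_le_mul_of_nonneg_right (hN y) (hf y)

lemma fib_mul (c : ℕ) [NeZero c] (a : ℕ) (ha : 0 < a) (y : ZMod c) :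
    (Finset.univ.filter fun x : ZMod c => x * (a : ZMod c) = y).card ≤ a := by
  have hc : 0 < c := Nat.pos_of_ne_zero (NeZero.ne c)
  have := Finset.card_le_card_of_injOn (s := Finset.univ.filter fun x : ZMod c => x * (a : ZMod c) = y) (t := Finset.range a) (fun x => (x.val * a) / c) ?_ ?_
  · simpa using this
  · intro x _
    simp only [Finset.coe_range, Set.mem_Iio]
    have h1 := ZMod.val_lt x
    rw [Nat.div_lt_iff_lt_mul hc]
    nlinarith
  · intro x hx x' hx' h
    have hx1 : x * (a : ZMod c) = y := by simpa using hx
    have hx1' : x' * (a : ZMod c) = y := by simpa using hx'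
    have e : (x.val * a) % c = (x'.val * a) % c := by
      have : ((x.val * a : ℕ) : ZMod c) = ((x'.val * a : ℕ) : ZMod c) := by
        push_cast
        rw [ZMod.natCast_zmod_val, ZMod.natCast_zmod_val, hx1, hx1']
      exact (ZMod.natCast_eq_natCast_iff' _ _ _).1 this
    have h2 : x.val * a = x'.val * a := by
      rw [← Nat.div_add_mod (x.val * a) c, ← Nat.div_add_mod (x'.val * a) c, e]
      simp only at h
      rw [h]
    exact ZMod.val_injective c (Nat.eq_of_mul_eq_mul_right ha h2)

end P5a


section P5b

noncomputable def Nf (c : ℕ) : ℕ := ∑ d ∈ c.divisors, Nat.gcd d (c / d)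

noncomputable def HH (N : ℕ) : ℝ := ∑ t ∈ Finset.Icc 1 N, 1 / (t:ℝ)

lemma cnt_sq (c d e : ℕ) [NeZero c] (hde : d * e = c) (x₀ : ZMod c) :
    (Finset.univ.filter fun x : ZMod c => (d:ℤ) ∣ (x.val:ℤ) - x₀.val ∧ (e:ℤ) ∣ (x.val:ℤ) + x₀.val).card ≤ Nat.gcd d e := by
  have hc : 0 < c := Nat.pos_of_ne_zero (NeZero.ne c)
  have hL : 0 < Nat.lcm d e := by
    apply Nat.pos_of_ne_zero
    intro h
    rw [Nat.lcm_eq_zero_iff] at h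
    rcases h with h | h <;> (subst h; simp at hde; omega)
  have := Finset.card_le_card_of_injOn (s := Finset.univ.filter fun x : ZMod c => (d:ℤ) ∣ (x.val:ℤ) - x₀.val ∧ (e:ℤ) ∣ (x.val:ℤ) + x₀.val) (t := Finset.range (Nat.gcd d e)) (fun x => x.val / Nat.lcm d e) ?_ ?_
  · simpa using this
  · intro x _
    simp only [Finset.coe_range, Set.mem_Iio]
    rw [Nat.div_lt_iff_lt_mul hL, Nat.gcd_mul_lcm, hde]
    exact ZMod.val_lt x
  · intro x hx x' hx' h
    have h1 : (d:ℤ) ∣ (x.val:ℤ) - x₀.val ∧ (e:ℤ) ∣ (x.val:ℤ) + x₀.val := by simpa using hx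
    have h2 : (d:ℤ) ∣ (x'.val:ℤ) - x₀.val ∧ (e:ℤ) ∣ (x'.val:ℤ) + x₀.val := by simpa using hx'
    have g1 : (d:ℤ) ∣ (x.val:ℤ) - x'.val := by
      have := dvd_sub h1.1 h2.1
      ring_nf at this ⊢; exact this
    have g2 : (e:ℤ) ∣ (x.val:ℤ) - x'.val := by
      have := dvd_sub h1.2 h2.2
      ring_nf at this ⊢; exact this
    have m1 : x'.val ≡ x.val [MOD d] := (Nat.modEq_iff_dvd).2 g1
    have m2 : x'.val ≡ x.val [MOD e] := (Nat.modEq_iff_dvd).2 g2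
    have m3 : x'.val ≡ x.val [MOD (Nat.lcm d e)] := by
      rw [Nat.modEq_iff_dvd]
      have g3 : ((Int.lcm d e : ℕ) : ℤ) ∣ (x.val:ℤ) - x'.val := Int.coe_lcm_dvd g1 g2
      exact g3
    simp only at h
    apply ZMod.val_injective c
    rw [← Nat.div_add_mod x.val (Nat.lcm d e), ← Nat.div_add_mod x'.val (Nat.lcm d e), h, m3]

lemma fib_sq (c : ℕ) [NeZero c] (y : ZMod c) :
    (Finset.univ.filter fun x : ZMod c => x ^ 2 = y).card ≤ Nf c := by
  classical
  have hc : 0 < c := Nat.pos_of_ne_zero (NeZero.ne c)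
  rcases (Finset.univ.filter fun x : ZMod c => x ^ 2 = y).eq_empty_or_nonempty with h | ⟨x₀, hx₀⟩
  · rw [h]; simp
  have h0 : x₀ ^ 2 = y := by simpa using hx₀
  have hsub : (Finset.univ.filter fun x : ZMod c => x ^ 2 = y) ⊆ c.divisors.biUnion (fun d => Finset.univ.filter fun x : ZMod c => (d:ℤ) ∣ (x.val:ℤ) - x₀.val ∧ ((c / d : ℕ):ℤ) ∣ (x.val:ℤ) + x₀.val) := by
    intro x hx
    have hx1 : x ^ 2 = y := by simpa using hx
    rw [Finset.mem_biUnion]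
    have hdvd : (c:ℤ) ∣ ((x.val:ℤ) - x₀.val) * ((x.val:ℤ) + x₀.val) := by
      rw [← ZMod.intCast_zmod_eq_zero_iff_dvd]
      push_cast
      rw [ZMod.natCast_zmod_val, ZMod.natCast_zmod_val]
      linear_combination hx1 - h0
    set d := Int.gcd ((x.val:ℤ) - x₀.val) c with hd
    have hdc : d ∣ c := by
      exact Int.natCast_dvd_natCast.1 (Int.gcd_dvd_right ((x.val:ℤ) - x₀.val) c)
    have hdp : 0 < d := Nat.pos_of_dvd_of_pos hdc hc
    refine ⟨d, by simp [hdc, hc.ne'], ?_⟩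
    rw [Finset.mem_filter]
    refine ⟨Finset.mem_univ _, Int.gcd_dvd_left _ _, ?_⟩
    have hcd : ((c / d : ℕ):ℤ) = (c:ℤ) / (d:ℤ) := by simp
    rw [hcd]
    have hcop : IsCoprime ((c:ℤ) / (d:ℤ)) (((x.val:ℤ) - x₀.val) / d) := by
      rw [Int.isCoprime_iff_gcd_eq_one, Int.gcd_comm]
      exact Int.gcd_ediv_gcd_ediv_gcd hdp
    refine hcop.dvd_of_dvd_mul_left ?_
    obtain ⟨u, hu⟩ := hdvd
    obtain ⟨a, ha⟩ : (d:ℤ) ∣ (x.val:ℤ) - x₀.val := Int.gcd_dvd_left _ _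
    obtain ⟨b, hb⟩ : (d:ℤ) ∣ (c:ℤ) := by exact_mod_cast hdc
    have hd0 : (d:ℤ) ≠ 0 := by exact_mod_cast hdp.ne'
    rw [ha, Int.mul_ediv_cancel_left _ hd0]
    have hbb : (c:ℤ) / d = b := by rw [hb, Int.mul_ediv_cancel_left _ hd0]
    rw [hbb]
    refine ⟨u, ?_⟩
    rw [ha, hb] at hu
    apply mul_left_cancel₀ hd0
    linear_combination hu
  refine (Finset.card_le_card hsub).trans (Finset.card_biUnion_le.trans ?_)
  unfold Nf
  refine Finset.sum_le_sum fun d hd => ?_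
  exact cnt_sq c d (c/d) (Nat.mul_div_cancel' (Nat.dvd_of_mem_divisors hd)) x₀

lemma HH_nonneg (N : ℕ) : 0 ≤ HH N := Finset.sum_nonneg fun t _ => by positivity

lemma sum_dvd (C g : ℕ) (hg : 0 < g) :
    ∑ d ∈ Finset.Icc 1 C, (if g ∣ d then 1 / (d:ℝ) else 0) ≤ HH C / g := by
  classical
  rw [← Finset.sum_filter]
  have hsub : (Finset.Icc 1 C).filter (fun d => g ∣ d) ⊆ (Finset.Icc 1 C).image (fun t => g * t) := by
    intro d hd
    rw [Finset.mem_filter, Finset.mem_Icc] at hd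
    obtain ⟨t, ht⟩ := hd.2
    rw [Finset.mem_image]
    refine ⟨t, ?_, ht.symm⟩
    rw [Finset.mem_Icc]
    constructor
    · rcases Nat.eq_zero_or_pos t with h | h
      · subst h; omega
      · exact h
    · nlinarith [hd.1.2]
  calc _ ≤ ∑ d ∈ (Finset.Icc 1 C).image (fun t => g * t), 1 / (d:ℝ) :=
        Finset.sum_le_sum_of_subset_of_nonneg hsub (fun _ _ _ => by positivity)
    _ = ∑ t ∈ Finset.Icc 1 C, 1 / ((g * t : ℕ):ℝ) := Finset.sum_image (fun a _ b _ h => Nat.eq_of_mul_eq_mul_left hg h)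
    _ = HH C / g := by
        unfold HH
        rw [Finset.sum_div]
        refine Finset.sum_congr rfl fun t _ => ?_
        push_cast
        rw [div_div, mul_comm]

lemma Nf_sum (C : ℕ) : ∑ c ∈ Finset.Icc 1 C, (Nf c : ℝ) / c ≤ HH C ^ 3 := by
  classical
  have h1 : ∀ c ∈ Finset.Icc 1 C, (Nf c : ℝ) / c ≤ ∑ d ∈ Finset.Icc 1 C, ∑ e ∈ Finset.Icc 1 C, if d * e = c then (Nat.gcd d e : ℝ) / (d * e) else 0 := by
    intro c hc
    rw [Finset.mem_Icc] at hc
    unfold Nf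
    push_cast
    rw [Finset.sum_div]
    have hsub : c.divisors ⊆ Finset.Icc 1 C := by
      intro d hd
      rw [Finset.mem_Icc]
      have := Nat.divisor_le hd
      exact ⟨Nat.pos_of_mem_divisors hd, by omega⟩
    refine (Finset.sum_le_sum ?_).trans (Finset.sum_le_sum_of_subset_of_nonneg hsub (fun d _ _ => Finset.sum_nonneg fun e _ => by split_ifs <;> positivity))
    intro d hd
    have hdd := Nat.mul_div_cancel' (Nat.dvd_of_mem_divisors hd)
    have hmem : c / d ∈ Finset.Icc 1 C := by
      rw [Finset.mem_Icc]
      have h3 := Nat.divisor_le hd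
      have h4 := Nat.pos_of_mem_divisors hd
      exact ⟨Nat.div_pos h3 h4, (Nat.div_le_self _ _).trans hc.2⟩
    refine le_trans ?_ (Finset.single_le_sum (f := fun e => if d * e = c then (Nat.gcd d e : ℝ) / (d * e) else 0) (fun e _ => by split_ifs <;> positivity) hmem)
    simp only [hdd, if_true]
    rw [← Nat.cast_mul, hdd]
  refine (Finset.sum_le_sum h1).trans ?_
  rw [Finset.sum_comm]
  have h2 : ∀ d ∈ Finset.Icc 1 C, ∑ c ∈ Finset.Icc 1 C, ∑ e ∈ Finset.Icc 1 C, (if d * e = c then (Nat.gcd d e : ℝ) / (d * e) else 0) ≤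
      ∑ e ∈ Finset.Icc 1 C, ∑ g ∈ Finset.Icc 1 C, g * ((if g ∣ d then 1 / (d:ℝ) else 0) * (if g ∣ e then 1 / (e:ℝ) else 0)) := by
    intro d hd
    rw [Finset.sum_comm]
    refine Finset.sum_le_sum fun e he => ?_
    rw [Finset.sum_ite_eq]
    have hd' := Finset.mem_Icc.1 hd
    have he' := Finset.mem_Icc.1 he
    have hmem : Nat.gcd d e ∈ Finset.Icc 1 C := by
      rw [Finset.mem_Icc]
      exact ⟨Nat.gcd_pos_of_pos_left _ hd'.1, (Nat.gcd_le_left _ hd'.1).trans hd'.2⟩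
    have h5 : (Nat.gcd d e : ℝ) / (d * e) ≤ ∑ g ∈ Finset.Icc 1 C, g * ((if g ∣ d then 1 / (d:ℝ) else 0) * (if g ∣ e then 1 / (e:ℝ) else 0)) := by
      refine le_trans (le_of_eq ?_) (Finset.single_le_sum (f := fun g : ℕ => (g:ℝ) * ((if g ∣ d then 1 / (d:ℝ) else 0) * (if g ∣ e then 1 / (e:ℝ) else 0))) (fun g _ => by split_ifs <;> positivity) hmem)
      simp only [Nat.gcd_dvd_left, Nat.gcd_dvd_right, if_true]
      rw [div_eq_mul_one_div, one_div_mul_one_div]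
    split_ifs
    · exact h5
    · exact le_trans (by positivity) h5
  refine (Finset.sum_le_sum h2).trans ?_
  calc _ = ∑ g ∈ Finset.Icc 1 C, (g:ℝ) * ((∑ d ∈ Finset.Icc 1 C, (if g ∣ d then 1 / (d:ℝ) else 0)) * (∑ e ∈ Finset.Icc 1 C, (if g ∣ e then 1 / (e:ℝ) else 0))) := by
        simp_rw [Finset.sum_mul_sum, Finset.mul_sum]
        rw [Finset.sum_comm]
        conv_rhs => rw [Finset.sum_comm' (t' := Finset.Icc 1 C) (s' := fun _ => Finset.Icc 1 C) (by simp)]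
        rw [Finset.sum_comm]
        refine Finset.sum_congr rfl fun d _ => ?_
        rw [Finset.sum_comm]
    _ ≤ ∑ g ∈ Finset.Icc 1 C, (g:ℝ) * ((HH C / g) * (HH C / g)) := by
        refine Finset.sum_le_sum fun g hg => ?_
        have hg0 := (Finset.mem_Icc.1 hg).1
        have hs := sum_dvd C g hg0
        have hs0 : 0 ≤ ∑ d ∈ Finset.Icc 1 C, (if g ∣ d then 1 / (d:ℝ) else 0) := Finset.sum_nonneg fun d _ => by split_ifs <;> positivity
        exact mul_le_mul_of_nonneg_left (mul_le_mul hs hs hs0 (hs0.trans hs)) (Nat.cast_nonneg _)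
    _ = HH C ^ 3 := by
        have : HH C ^ 3 = HH C ^ 2 * HH C := by ring
        rw [this]
        nth_rewrite 4 [HH]
        rw [Finset.mul_sum]
        refine Finset.sum_congr rfl fun g hg => ?_
        have hg0 : (g:ℝ) ≠ 0 := by
          have := (Finset.mem_Icc.1 hg).1
          positivity
        field_simp

lemma Kz_sq_sum (c : ℕ) [NeZero c] (y : ZMod c) : ∑ x : ZMod c, ‖Kz c (x ^ 2) y‖^2 ≤ (Nf c : ℝ) * (c:ℝ)^2 :=
  (fiber_sum c (fun x => ‖Kz c x y‖^2) (fun _ => by positivity) (fun x => x ^ 2) (Nf c) (fun y' => by exact_mod_cast fib_sq c y')).trans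
    (mul_le_mul_of_nonneg_left (pars c y) (Nat.cast_nonneg _))

lemma Kz_mul_sum (c : ℕ) [NeZero c] (a : ℕ) (ha : 0 < a) (y : ZMod c) : ∑ x : ZMod c, ‖Kz c (x * (a : ZMod c)) y‖^2 ≤ (a : ℝ) * (c:ℝ)^2 :=
  (fiber_sum c (fun x => ‖Kz c x y‖^2) (fun _ => by positivity) (fun x => x * a) a (fun y' => by exact_mod_cast fib_mul c a ha y')).trans
    (mul_le_mul_of_nonneg_left (pars c y) (Nat.cast_nonneg _))

lemma Nf_pos (c : ℕ) (hc : 0 < c) : 1 ≤ Nf c := by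
  unfold Nf
  have : 1 ∈ c.divisors := by simp [hc.ne']
  refine le_trans ?_ (Finset.single_le_sum (f := fun d => Nat.gcd d (c/d)) (fun _ _ => Nat.zero_le _) this)
  simp

end P5b


section P5c

lemma sum_inj_le (s t : Finset ℕ) (f h : ℕ → ℝ) (e : ℕ → ℕ) (hh : ∀ x, 0 ≤ h x) (hm : ∀ x ∈ s, e x ∈ t)
    (hi : ∀ x ∈ s, ∀ y ∈ s, e x = e y → x = y) (hf : ∀ x ∈ s, f x ≤ h (e x)) : ∑ x ∈ s, f x ≤ ∑ y ∈ t, h y := by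
  classical
  calc _ ≤ ∑ x ∈ s, h (e x) := Finset.sum_le_sum hf
    _ = ∑ y ∈ s.image e, h y := (Finset.sum_image (fun a ha b hb hab => hi a ha b hb hab)).symm
    _ ≤ _ := Finset.sum_le_sum_of_subset_of_nonneg (by
        intro y hy
        obtain ⟨x, hx, rfl⟩ := Finset.mem_image.1 hy
        exact hm x hx) (fun _ _ _ => hh _)

lemma sum_abs (N b : ℕ) : ∑ q ∈ Finset.range N, 1 / (|(q:ℝ) - b| + 1) ≤ 2 * HH N := by
  classical
  rw [← Finset.sum_filter_add_sum_filter_not (Finset.range N) (fun q => q < b), two_mul]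
  unfold HH
  apply add_le_add
  · refine sum_inj_le _ _ _ (fun t => 1 / (t:ℝ)) (fun q => min b N - q) (fun _ => by positivity) ?_ ?_ ?_
    · intro x hx
      rw [Finset.mem_filter, Finset.mem_range] at hx
      simp only [Finset.mem_Icc]
      omega
    · intro x hx y hy hxy
      rw [Finset.mem_filter, Finset.mem_range] at hx hy
      omega
    · intro x hx
      rw [Finset.mem_filter, Finset.mem_range] at hx
      have h1 : x < min b N := by omega
      have h2 : min b N ≤ b := by omega
      have h3 : 0 < min b N - x := by omega
      have h4 : ((min b N - x : ℕ):ℝ) ≤ b - x := by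
        rw [Nat.cast_sub h1.le]
        have : ((min b N : ℕ):ℝ) ≤ b := by exact_mod_cast h2
        linarith
      apply one_div_le_one_div_of_le
      · exact_mod_cast h3
      · have := neg_abs_le ((x:ℝ) - b)
        linarith
  · refine sum_inj_le _ _ _ (fun t => 1 / (t:ℝ)) (fun q => q - b + 1) (fun _ => by positivity) ?_ ?_ ?_
    · intro x hx
      rw [Finset.mem_filter, Finset.mem_range] at hx
      simp only [Finset.mem_Icc]
      omega
    · intro x hx y hy hxy
      rw [Finset.mem_filter, Finset.mem_range] at hx hy
      omega
    · intro x hx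
      rw [Finset.mem_filter, Finset.mem_range] at hx
      have h1 : b ≤ x := by omega
      simp only [Nat.cast_add, Nat.cast_sub h1, Nat.cast_one]
      apply one_div_le_one_div_of_le
      · have : (b:ℝ) ≤ x := by exact_mod_cast h1
        linarith
      · have := le_abs_self ((x:ℝ) - b)
        linarith

lemma range_blocks (c N : ℕ) (f : ℕ → ℝ) : ∑ n ∈ Finset.range (N * c), f n = ∑ q ∈ Finset.range N, ∑ i ∈ Finset.range c, f (q * c + i) := by
  induction N with
  | zero => simp
  | succ N ih => rw [Nat.succ_mul, Finset.sum_range_add, ih, Finset.sum_range_succ]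

lemma sumZR (c : ℕ) [NeZero c] (f : ZMod c → ℝ) : ∑ b : ZMod c, f b = ∑ b ∈ Finset.range c, f (b : ZMod c) := by
  have := sumZ c (fun x => (f x : ℂ))
  exact_mod_cast this

lemma block (c : ℕ) [NeZero c] (G : ZMod c → ℝ) (hG : ∀ x, 0 ≤ G x) (B : ℝ) (hB : ∑ x, G x ≤ B) (g : ℕ → ℝ)
    (E ρ : ℝ) (hρ : 0 ≤ ρ) (hgE : ∀ n, g n ≤ E) (hgρ : ∀ n, g n * |(n:ℝ) - ρ| ≤ E * c) (hg0 : ∀ n, 0 ≤ g n) (N : ℕ) :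
    ∑ n ∈ Finset.range (N * c), G n * g n ≤ 6 * E * B * HH N := by
  have hc : (0:ℝ) < c := by exact_mod_cast Nat.pos_of_ne_zero (NeZero.ne c)
  have hE : 0 ≤ E := (hg0 0).trans (hgE 0)
  have hB0 : 0 ≤ B := (Finset.sum_nonneg fun x _ => hG x).trans hB
  set b := ⌊ρ / c⌋₊ with hb
  have hb1 : (b:ℝ) * c ≤ ρ := by
    rw [← le_div_iff₀ hc]; exact Nat.floor_le (by positivity)
  have hb2 : ρ < ((b:ℝ) + 1) * c := by
    rw [← div_lt_iff₀ hc]; exact Nat.lt_floor_add_one _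
  rw [range_blocks]
  have h1 : ∀ q ∈ Finset.range N, ∑ i ∈ Finset.range c, G ((q * c + i : ℕ) : ZMod c) * g (q * c + i) ≤ 3 * E * B * (1 / (|(q:ℝ) - b| + 1)) := by
    intro q _
    have h2 : ∀ i ∈ Finset.range c, G ((q * c + i : ℕ) : ZMod c) * g (q * c + i) ≤ G (i : ZMod c) * (3 * E * (1 / (|(q:ℝ) - b| + 1))) := by
      intro i hi
      have hi1 : (i:ℝ) < c := by exact_mod_cast Finset.mem_range.1 hi
      have hi0 : (0:ℝ) ≤ i := Nat.cast_nonneg i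
      have e : ((q * c + i : ℕ) : ZMod c) = (i : ZMod c) := by push_cast; simp
      rw [e]
      refine mul_le_mul_of_nonneg_left ?_ (hG _)
      rw [mul_one_div, le_div_iff₀ (by positivity)]
      have hd : (|(q:ℝ) - b| - 1) * c ≤ |((q * c + i : ℕ):ℝ) - ρ| := by
        push_cast
        rcases le_total (b:ℝ) q with h | h
        · rw [abs_of_nonneg (by linarith : (0:ℝ) ≤ q - b)]
          refine le_trans ?_ (le_abs_self _)
          nlinarith
        · rw [abs_of_nonpos (by linarith : (q:ℝ) - b ≤ 0)]
          refine le_trans ?_ (neg_le_abs _)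
          nlinarith
      have h5 := hgρ (q * c + i)
      have h6 := hgE (q * c + i)
      have h7 := hg0 (q * c + i)
      have h8 : g (q * c + i) * ((|(q:ℝ) - b| - 1) * c) ≤ E * c := (mul_le_mul_of_nonneg_left hd h7).trans h5
      have h9 : g (q * c + i) * (|(q:ℝ) - b| - 1) ≤ E := by
        rw [← mul_assoc] at h8
        exact le_of_mul_le_mul_right h8 hc
      linarith
    refine (Finset.sum_le_sum h2).trans ?_
    rw [← Finset.sum_mul, ← sumZR]
    have h3 : 0 ≤ 3 * E * (1 / (|(q:ℝ) - b| + 1)) := by positivity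
    calc _ ≤ B * (3 * E * (1 / (|(q:ℝ) - b| + 1))) := mul_le_mul_of_nonneg_right hB h3
      _ = _ := by ring
  refine (Finset.sum_le_sum h1).trans ?_
  rw [← Finset.mul_sum]
  have := mul_le_mul_of_nonneg_left (sum_abs N b) (by positivity : 0 ≤ 3 * E * B)
  linarith

lemma CSl (c₁ c₂ : ℕ) [NeZero c₁] [NeZero c₂] (G₁ : ZMod c₁ → ℝ) (G₂ : ZMod c₂ → ℝ) (h1 : ∀ x, 0 ≤ G₁ x) (h2 : ∀ x, 0 ≤ G₂ x)
    (B₁ B₂ : ℝ) (hB₁ : ∑ x, G₁ x ^ 2 ≤ B₁) (hB₂ : ∑ x, G₂ x ^ 2 ≤ B₂) (A : ℕ → ℝ) (S : Finset ℕ) (N : ℕ) (hS : ∀ n ∈ S, n < N)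
    (U D ρ : ℝ) (hU : 0 ≤ U) (hρ : 0 ≤ ρ) (hA0 : ∀ n ∈ S, 0 ≤ A n) (hA : ∀ n ∈ S, A n ≤ G₁ n * G₂ n * U) (hA' : ∀ n ∈ S, A n * |(n:ℝ) - ρ| ≤ G₁ n * G₂ n * D)
    (hU1 : U * c₁ ≤ D) (hU2 : U * c₂ ≤ D) : (∑ n ∈ S, A n) ^ 2 ≤ 36 * HH N ^ 2 * D ^ 2 * (B₁ / c₁) * (B₂ / c₂) := by
  have hc₁ : (0:ℝ) < c₁ := by exact_mod_cast Nat.pos_of_ne_zero (NeZero.ne c₁)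
  have hc₂ : (0:ℝ) < c₂ := by exact_mod_cast Nat.pos_of_ne_zero (NeZero.ne c₂)
  have hD : 0 ≤ D := le_trans (by positivity) hU1
  set g : ℕ → ℝ := fun n => if |(n:ℝ) - ρ| = 0 then U else min U (D / |(n:ℝ) - ρ|) with hg
  have hg0 : ∀ n, 0 ≤ g n := by
    intro n; simp only [hg]; split_ifs
    · exact hU
    · exact le_min hU (by positivity)
  have hgU : ∀ n, g n ≤ U := by
    intro n; simp only [hg]; split_ifs
    · exact le_rfl
    · exact min_le_left _ _
  have hgD : ∀ n, g n * |(n:ℝ) - ρ| ≤ D := by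
    intro n; simp only [hg]; split_ifs with h
    · rw [h]; simpa using hD
    · have hp : 0 < |(n:ℝ) - ρ| := lt_of_le_of_ne (abs_nonneg _) (Ne.symm h)
      calc _ ≤ (D / |(n:ℝ) - ρ|) * |(n:ℝ) - ρ| := mul_le_mul_of_nonneg_right (min_le_right _ _) hp.le
        _ = D := div_mul_cancel₀ _ h
  have hAg : ∀ n ∈ S, A n ≤ G₁ n * G₂ n * g n := by
    intro n hn
    simp only [hg]; split_ifs with h
    · exact hA n hn
    · have hp : 0 < |(n:ℝ) - ρ| := lt_of_le_of_ne (abs_nonneg _) (Ne.symm h)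
      rcases min_cases U (D / |(n:ℝ) - ρ|) with h' | h'
      · rw [h'.1]; exact hA n hn
      · rw [h'.1, ← mul_div_assoc, le_div_iff₀ hp]; exact hA' n hn
  have hE1 : U ≤ D / c₁ := by rw [le_div_iff₀ hc₁]; exact hU1
  have hE2 : U ≤ D / c₂ := by rw [le_div_iff₀ hc₂]; exact hU2
  have b1 := block c₁ (fun x => G₁ x ^ 2) (fun _ => by positivity) B₁ hB₁ g (D / c₁) ρ hρ (fun n => (hgU n).trans hE1)
    (fun n => by rw [div_mul_cancel₀ _ hc₁.ne']; exact hgD n) hg0 N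
  have b2 := block c₂ (fun x => G₂ x ^ 2) (fun _ => by positivity) B₂ hB₂ g (D / c₂) ρ hρ (fun n => (hgU n).trans hE2)
    (fun n => by rw [div_mul_cancel₀ _ hc₂.ne']; exact hgD n) hg0 N
  have hsub1 : S ⊆ Finset.range (N * c₁) := by
    intro n hn
    rw [Finset.mem_range]
    have : 0 < c₁ := by exact_mod_cast hc₁
    nlinarith [hS n hn]
  have hsub2 : S ⊆ Finset.range (N * c₂) := by
    intro n hn
    rw [Finset.mem_range]
    have : 0 < c₂ := by exact_mod_cast hc₂
    nlinarith [hS n hn]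
  have s1 := (Finset.sum_le_sum_of_subset_of_nonneg (f := fun n : ℕ => G₁ n ^ 2 * g n) hsub1 (fun n _ _ => mul_nonneg (by positivity) (hg0 n))).trans b1
  have s2 := (Finset.sum_le_sum_of_subset_of_nonneg (f := fun n : ℕ => G₂ n ^ 2 * g n) hsub2 (fun n _ _ => mul_nonneg (by positivity) (hg0 n))).trans b2
  have s1' : 0 ≤ ∑ n ∈ S, G₁ n ^ 2 * g n := Finset.sum_nonneg fun n _ => mul_nonneg (by positivity) (hg0 n)
  have s2' : 0 ≤ ∑ n ∈ S, G₂ n ^ 2 * g n := Finset.sum_nonneg fun n _ => mul_nonneg (by positivity) (hg0 n)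
  calc (∑ n ∈ S, A n) ^ 2 ≤ (∑ n ∈ S, G₁ n * G₂ n * g n) ^ 2 := by
        apply pow_le_pow_left₀ (Finset.sum_nonneg hA0) (Finset.sum_le_sum hAg)
    _ ≤ (∑ n ∈ S, G₁ n ^ 2 * g n) * (∑ n ∈ S, G₂ n ^ 2 * g n) := by
        apply Finset.sum_sq_le_sum_mul_sum_of_sq_eq_mul
        · intro n _; exact mul_nonneg (by positivity) (hg0 n)
        · intro n _; exact mul_nonneg (by positivity) (hg0 n)
        · intro n _; ring
    _ ≤ (6 * (D / c₁) * B₁ * HH N) * (6 * (D / c₂) * B₂ * HH N) := mul_le_mul s1 s2 s2' (s1'.trans s1)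
    _ = _ := by ring

end P5c


section P5d
open Real

lemma logs (K ε n m α β γ r₁ r₂ c₁ c₂ : ℝ) (hK : 1 ≤ K) (hε : 0 < ε) (hε1 : ε < 1/1000)
    (hn : 1 ≤ n) (hm : 1 ≤ m) (hα : 1 ≤ α) (hβ : 1 ≤ β) (hγ : 1 ≤ γ) (hr₁ : 1 ≤ r₁) (hr₂ : 1 ≤ r₂) (hc₁ : 1 ≤ c₁) (hc₂ : 1 ≤ c₂)
    (q1 : K ^ ((4:ℝ)/3 - ε) < n * r₁ / c₂)
    (q3 : n * r₁ / (c₂ * K ^ ε) < √(n * m * α * β ^ 2) / c₁)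
    (q4 : √(n * m * α * β ^ 2) / c₁ < n * r₁ * K ^ ε / c₂)
    (p1 : r₁ / r₂ < K ^ ε)
    (t1 : m ≤ K * K ^ ε) (t2 : n * r₂ ^ 2 * α ^ 3 * β ^ 2 * γ ^ 2 ≤ K ^ 2 * K ^ ε) :
    let κ := K ^ ε
    let ρ := m * α * β ^ 2 * c₂ ^ 2 / (r₁ ^ 2 * c₁ ^ 2)
    K ≤ n * r₁ / c₂ ∧ K ≤ √(n * m * α * β ^ 2) / c₁ ∧ K ^ 4 ≤ κ ^ 6 * (√(n * m * α * β ^ 2) / c₁) ^ 3 ∧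
    n * r₁ / c₂ ≤ κ ^ 6 * (√(n * m * α * β ^ 2) / c₁) ∧ √(n * m * α * β ^ 2) / c₁ ≤ κ ^ 6 * (n * r₁ / c₂) ∧
    n ≤ κ ^ 2 * ρ ∧ ρ ≤ κ ^ 2 * n ∧ K ^ 2 * c₂ * c₂ ≤ κ ^ 30 * ρ ^ 2 * r₁ ∧ K ^ 2 * c₂ * c₁ ≤ κ ^ 30 * ρ ^ 2 * r₁ ∧
    ρ * m * α * β ^ 2 * c₁ * c₂ ≤ κ ^ 30 * K ^ ((23:ℝ)/6) ∧ n ≤ K ^ 3 ∧ m ≤ K ^ 3 ∧ c₁ ≤ K ^ 3 ∧ c₂ ≤ K ^ 3 := by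
  obtain ⟨L, rfl, hL⟩ : ∃ x, exp x = K ∧ 0 ≤ x := ⟨log K, exp_log (by linarith), log_nonneg hK⟩
  obtain ⟨N, rfl, hN⟩ : ∃ x, exp x = n ∧ 0 ≤ x := ⟨log n, exp_log (by linarith), log_nonneg hn⟩
  obtain ⟨M, rfl, hM⟩ : ∃ x, exp x = m ∧ 0 ≤ x := ⟨log m, exp_log (by linarith), log_nonneg hm⟩
  obtain ⟨A, rfl, hA⟩ : ∃ x, exp x = α ∧ 0 ≤ x := ⟨log α, exp_log (by linarith), log_nonneg hα⟩
  obtain ⟨B, rfl, hB⟩ : ∃ x, exp x = β ∧ 0 ≤ x := ⟨log β, exp_log (by linarith), log_nonneg hβ⟩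
  obtain ⟨G, rfl, hG⟩ : ∃ x, exp x = γ ∧ 0 ≤ x := ⟨log γ, exp_log (by linarith), log_nonneg hγ⟩
  obtain ⟨R1, rfl, hR1⟩ : ∃ x, exp x = r₁ ∧ 0 ≤ x := ⟨log r₁, exp_log (by linarith), log_nonneg hr₁⟩
  obtain ⟨R2, rfl, hR2⟩ : ∃ x, exp x = r₂ ∧ 0 ≤ x := ⟨log r₂, exp_log (by linarith), log_nonneg hr₂⟩
  obtain ⟨C1, rfl, hC1⟩ : ∃ x, exp x = c₁ ∧ 0 ≤ x := ⟨log c₁, exp_log (by linarith), log_nonneg hc₁⟩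
  obtain ⟨C2, rfl, hC2⟩ : ∃ x, exp x = c₂ ∧ 0 ≤ x := ⟨log c₂, exp_log (by linarith), log_nonneg hc₂⟩
  have hsq : ∀ x : ℝ, √(exp x) = exp (x / 2) := fun x => (exp_half x).symm
  obtain ⟨t, ht⟩ : ∃ t, t = L * ε := ⟨_, rfl⟩
  have ht0 : 0 ≤ t := by rw [ht]; positivity
  have htL : 1000 * t ≤ L := by rw [ht]; nlinarith
  simp only [← exp_mul, ← exp_nat_mul, ← exp_add, ← exp_sub, hsq, exp_lt_exp, exp_le_exp, mul_sub, ← ht] at *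
  push_cast at *
  refine ⟨?_, ?_, ?_, ?_, ?_, ?_, ?_, ?_, ?_, ?_, ?_, ?_, ?_, ?_⟩ <;> linarith

end P5d


section P5e
open Real

set_option maxHeartbeats 2000000 in
lemma mainTriple (w : ℝ → ℝ) (M₀ M₁ K ε : ℝ) (a b : ℕ) (hw0 : ∀ u, |w u| ≤ M₀) (hw1 : ∀ x y, |w x - w y| ≤ M₁ * |x - y|)
    (hK : 2 ≤ K) (hε : 0 < ε) (hε1 : ε < 1/1000) (ha : 2 ≤ a) (hab : a ≤ b) (hKa : K ≤ 2 * a) (hb : (b:ℝ) ≤ K + 1)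
    (α β γ r₁ r₂ m c₁ c₂ : ℕ) (hm : 1 ≤ m) (hc₁ : 1 ≤ c₁) (hc₂ : 1 ≤ c₂) (hα : 0 < α) (hβ : 0 < β) (hγ : 0 < γ) (hr₁ : 0 < r₁) (hr : 0 < r₂)
    (p1 : (r₁:ℝ) / r₂ < K ^ ε) (S : Finset ℕ) (N : ℕ)
    (hS : ∀ n ∈ S, 1 ≤ n ∧ n < N ∧ cond2 K ε α β r₁ n m c₁ c₂ ∧ (m:ℝ) ≤ K * K ^ ε ∧ (n : ℝ) * r₂ ^ 2 * α ^ 3 * β ^ 2 * γ ^ 2 ≤ K ^ 2 * K ^ ε) :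
    ∑ n ∈ S, ‖∑ j ∈ Finset.Ico a b, T w K α β γ r₁ r₂ (2*j) n m c₁ c₂‖ ≤
      1500000 * (400 * (M₀ + 2 * M₁)) * HH N * (K ^ ε) ^ 54 * K ^ ((11:ℝ)/12) * (Nf c₂ / (m * c₁ * c₂)) := by
  haveI : NeZero c₁ := ⟨by omega⟩
  haveI : NeZero c₂ := ⟨by omega⟩
  have hM0 : 0 ≤ M₀ := (abs_nonneg _).trans (hw0 0)
  have hM1 : 0 ≤ M₁ := by have := (abs_nonneg _).trans (hw1 1 0); simpa using this
  have hK0 : 0 < K := by linarith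
  set W := 400 * (M₀ + 2 * M₁) with hW
  have hW0 : 0 ≤ W := by positivity
  set κ := K ^ ε with hκdef
  have hκ : 1 ≤ κ := one_le_rpow (by linarith) hε.le
  have hκ0 : 0 < κ := by linarith
  have hmR : (1:ℝ) ≤ m := by exact_mod_cast hm
  have hc₁R : (1:ℝ) ≤ c₁ := by exact_mod_cast hc₁
  have hc₂R : (1:ℝ) ≤ c₂ := by exact_mod_cast hc₂
  have hαR : (1:ℝ) ≤ α := by exact_mod_cast hα
  have hβR : (1:ℝ) ≤ β := by exact_mod_cast hβ
  have hγR : (1:ℝ) ≤ γ := by exact_mod_cast hγ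
  have hr₁R : (1:ℝ) ≤ r₁ := by exact_mod_cast hr₁
  have hr₂R : (1:ℝ) ≤ r₂ := by exact_mod_cast hr
  have hH := HH_nonneg N
  have hK11 : 0 < K ^ ((11:ℝ)/12) := rpow_pos_of_pos hK0 _
  rcases S.eq_empty_or_nonempty with rfl | ⟨n₀, hn₀⟩
  · rw [Finset.sum_empty]; positivity
  have LG : ∀ n ∈ S, _ := fun n hn => logs K ε n m α β γ r₁ r₂ c₁ c₂ (by linarith) hε hε1 (by exact_mod_cast (hS n hn).1) hmR hαR hβR hγR hr₁R hr₂R hc₁R hc₂R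
    (hS n hn).2.2.1.1 (hS n hn).2.2.1.2.2.1 (hS n hn).2.2.1.2.2.2 p1 (hS n hn).2.2.2.1 (hS n hn).2.2.2.2
  simp only at LG
  rw [← hκdef] at LG
  set ρ : ℝ := m * α * β ^ 2 * c₂ ^ 2 / (r₁ ^ 2 * c₁ ^ 2) with hρ
  have hρ0 : 0 < ρ := by positivity
  obtain ⟨-, -, -, -, -, -, -, k1, k2, k3, -, -, -, -⟩ := LG n₀ hn₀
  set P := W * (κ / √(ρ * m)) / (c₁ * c₂) with hP
  have hP0 : 0 ≤ P := by positivity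
  have tb : ∀ n ∈ S, ‖∑ j ∈ Finset.Ico a b, T w K α β γ r₁ r₂ (2*j) n m c₁ c₂‖ ≤
      ‖Kz c₁ ((n : ZMod c₁) * ((α * β ^ 2 : ℕ) : ZMod c₁)) m‖ * ‖Kz c₂ ((n : ZMod c₂) ^ 2) ((r₁ : ZMod c₂) ^ 2)‖ * (P * (144 * K * κ ^ 8 * c₂ / (ρ * r₁))) ∧
      ‖∑ j ∈ Finset.Ico a b, T w K α β γ r₁ r₂ (2*j) n m c₁ c₂‖ * |(n:ℝ) - ρ / 16| ≤
      ‖Kz c₁ ((n : ZMod c₁) * ((α * β ^ 2 : ℕ) : ZMod c₁)) m‖ * ‖Kz c₂ ((n : ZMod c₂) ^ 2) ((r₁ : ZMod c₂) ^ 2)‖ * (P * (250000 * κ ^ 38 * ρ / K)) := by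
    intro n hn
    obtain ⟨l1, l2, l3, l4, l5, l6, l7, -, -, -, -, -, -, -⟩ := LG n hn
    have hnR : (1:ℝ) ≤ n := by exact_mod_cast (hS n hn).1
    have hπ : 12 ≤ 4 * π := by linarith [pi_gt_three]
    obtain ⟨x, hx⟩ : ∃ x : ℝ, x = n * r₁ / c₂ := ⟨_, rfl⟩
    obtain ⟨y, hy⟩ : ∃ y : ℝ, y = √((n : ℝ) * m * α * β ^ 2) / c₁ := ⟨_, rfl⟩
    rw [← hx, ← hy] at l4 l5
    rw [← hx] at l1
    rw [← hy] at l2 l3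
    have hx0 : 0 < x := by linarith
    have hy0 : 0 < y := by linarith
    have hy2 : y ^ 2 = n * m * α * β ^ 2 / c₁ ^ 2 := by
      rw [hy, div_pow, sq_sqrt (by positivity)]
    have hκ6 : 1 ≤ κ ^ 6 := one_le_pow₀ hκ
    have hp0 : 0 ≤ 4 * π := by linarith
    have f1 : 12 * K ≤ 4 * π * x := mul_le_mul hπ l1 hK0.le hp0
    have f2 : 12 * K ≤ 4 * π * y := mul_le_mul hπ l2 hK0.le hp0
    have f3 : K ^ 4 ≤ κ ^ 6 * (4 * π * y) ^ 3 := by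
      refine l3.trans (mul_le_mul_of_nonneg_left (pow_le_pow_left₀ hy0.le ?_ 3) (by positivity))
      exact le_mul_of_one_le_left hy0.le (by linarith)
    have f4 : 4 * π * x ≤ κ ^ 6 * (4 * π * y) := by
      have := mul_le_mul_of_nonneg_left l4 hp0
      rw [mul_left_comm]; exact this
    have f5 : 4 * π * y ≤ κ ^ 6 * (4 * π * x) := by
      have := mul_le_mul_of_nonneg_left l5 hp0
      rw [mul_left_comm]; exact this
    have f6 : n * (4 * π * y) ^ 2 = 16 * (4 * π * x) ^ 2 * (ρ / 16) := by
      rw [mul_pow, mul_pow (4 * π) x, hy2, hx, hρ]; field_simp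
    have ts := Tsum w M₀ M₁ K (κ ^ 6) (ρ / 16) a b hw0 hw1 hK ha hab hKa hb α β γ r₁ r₂ n m c₁ c₂ (hS n hn).1 hm hα hβ hγ hr
      (4 * π * x) (4 * π * y) (by rw [hx]; ring) (by rw [hy]; ring) hκ6 f1 f2 f3 f4 f5 (by positivity) f6
    have hq : Qc α β γ r₁ r₂ n m c₁ c₂ = 1 / √((n:ℝ) * m) * (‖Kz c₂ ((n : ZMod c₂) ^ 2) ((r₁ : ZMod c₂) ^ 2)‖ / c₂) * (‖Kz c₁ ((n : ZMod c₁) * ((α * β ^ 2 : ℕ) : ZMod c₁)) m‖ / c₁) := by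
      unfold Qc
      rw [kloos_eq, kloos_eq]
      push_cast
      rw [mul_assoc (n : ZMod c₁)]
    set g₁ := ‖Kz c₁ ((n : ZMod c₁) * ((α * β ^ 2 : ℕ) : ZMod c₁)) m‖ with hg₁
    set g₂ := ‖Kz c₂ ((n : ZMod c₂) ^ 2) ((r₁ : ZMod c₂) ^ 2)‖ with hg₂
    have g₁0 : 0 ≤ g₁ := norm_nonneg _
    have g₂0 : 0 ≤ g₂ := norm_nonneg _
    have hsq : 1 / √((n:ℝ) * m) ≤ κ / √(ρ * m) := by
      rw [div_le_div_iff₀ (by positivity) (by positivity), one_mul]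
      apply sqrt_le_iff.2
      refine ⟨by positivity, ?_⟩
      rw [mul_pow, sq_sqrt (by positivity), ← mul_assoc]
      exact mul_le_mul_of_nonneg_right l7 (by positivity)
    have hqle : W * (Qc α β γ r₁ r₂ n m c₁ c₂ * v1 (2*b) m * v2 (2*b) ((n : ℝ) * r₂ ^ 2 * α ^ 3 * β ^ 2 * γ ^ 2)) ≤ g₁ * g₂ * P := by
      have hv1 := v1_le (2*b) m (by positivity)
      have hv10 := v1_nonneg (2*b) m (by positivity)
      have hv2 := v2_bds (2*b) (by omega) ((n : ℝ) * r₂ ^ 2 * α ^ 3 * β ^ 2 * γ ^ 2) (by positivity)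
      have hQ0 : 0 ≤ Qc α β γ r₁ r₂ n m c₁ c₂ := by rw [hq]; positivity
      calc _ ≤ W * (Qc α β γ r₁ r₂ n m c₁ c₂ * 1 * 1) := by
            refine mul_le_mul_of_nonneg_left ?_ hW0
            exact mul_le_mul (mul_le_mul_of_nonneg_left hv1 hQ0) hv2.2 hv2.1 (by simpa using hQ0)
        _ = W * (1 / √((n:ℝ) * m) * ((g₂ / c₂) * (g₁ / c₁))) := by rw [hq]; ring
        _ ≤ W * (κ / √(ρ * m) * ((g₂ / c₂) * (g₁ / c₁))) :=
            mul_le_mul_of_nonneg_left (mul_le_mul_of_nonneg_right hsq (by positivity)) hW0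
        _ = _ := by rw [hP]; field_simp
    have hgP : 0 ≤ g₁ * g₂ * P := by positivity
    constructor
    · refine ts.1.trans ?_
      rw [← mul_assoc (g₁ * g₂)]
      refine mul_le_mul hqle ?_ (by positivity) hgP
      have h1 : ρ * r₁ ≤ κ ^ 2 * c₂ * (4 * π * x) := by
        have : x * c₂ = n * r₁ := by rw [hx]; field_simp
        calc ρ * r₁ ≤ κ ^ 2 * n * r₁ := mul_le_mul_of_nonneg_right l7 (by positivity)
          _ = κ ^ 2 * c₂ * x := by rw [mul_assoc, ← this]; ring
          _ ≤ κ ^ 2 * c₂ * (4 * π * x) := mul_le_mul_of_nonneg_left (le_mul_of_one_le_left hx0.le (by linarith)) (by positivity)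
      rw [div_le_div_iff₀ (by positivity) (by positivity)]
      calc 144 * K * κ ^ 6 * (ρ * r₁) ≤ 144 * K * κ ^ 6 * (κ ^ 2 * c₂ * (4 * π * x)) := mul_le_mul_of_nonneg_left h1 (by positivity)
        _ = _ := by ring
    · refine ts.2.trans ?_
      rw [← mul_assoc (g₁ * g₂)]
      refine mul_le_mul hqle ?_ (by positivity) hgP
      refine div_le_div_of_nonneg_right ?_ hK0.le
      have h2 : (κ ^ 6) ^ 3 ≤ κ ^ 38 := by
        rw [← pow_mul]; exact pow_le_pow_right₀ hκ (by norm_num)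
      refine mul_le_mul (mul_le_mul_of_nonneg_left h2 (by norm_num)) (by linarith) (by positivity) (by positivity)
  have hUD : ∀ c : ℝ, 0 ≤ c → K ^ 2 * c₂ * c ≤ κ ^ 30 * ρ ^ 2 * r₁ → P * (144 * K * κ ^ 8 * c₂ / (ρ * r₁)) * c ≤ P * (250000 * κ ^ 38 * ρ / K) := by
    intro c hc h
    rw [mul_assoc]
    refine mul_le_mul_of_nonneg_left ?_ hP0
    rw [div_mul_eq_mul_div, div_le_div_iff₀ (by positivity) hK0]
    calc 144 * K * κ ^ 8 * c₂ * c * K = 144 * κ ^ 8 * (K ^ 2 * c₂ * c) := by ring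
      _ ≤ 144 * κ ^ 8 * (κ ^ 30 * ρ ^ 2 * r₁) := mul_le_mul_of_nonneg_left h (by positivity)
      _ = 144 * (κ ^ 38 * ρ ^ 2 * r₁) := by ring
      _ ≤ 250000 * (κ ^ 38 * ρ ^ 2 * r₁) := mul_le_mul_of_nonneg_right (by norm_num) (by positivity)
      _ = _ := by ring
  have hmain := CSl c₁ c₂ (fun x => ‖Kz c₁ (x * ((α * β ^ 2 : ℕ) : ZMod c₁)) m‖) (fun x => ‖Kz c₂ (x ^ 2) ((r₁ : ZMod c₂) ^ 2)‖)
    (fun _ => norm_nonneg _) (fun _ => norm_nonneg _) _ _ (Kz_mul_sum c₁ (α * β ^ 2) (by positivity) m) (Kz_sq_sum c₂ _)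
    (fun n => ‖∑ j ∈ Finset.Ico a b, T w K α β γ r₁ r₂ (2*j) n m c₁ c₂‖) S N (fun n hn => (hS n hn).2.1)
    (P * (144 * K * κ ^ 8 * c₂ / (ρ * r₁))) (P * (250000 * κ ^ 38 * ρ / K)) (ρ / 16) (by positivity) (by positivity) (fun _ _ => norm_nonneg _)
    ?_ ?_ ?_ ?_
  · refine le_of_sq_le_sq ?_ (by positivity)
    refine hmain.trans ?_
    have e23 : K ^ ((23:ℝ)/6) = (K ^ ((11:ℝ)/12)) ^ 2 * K ^ 2 := by
      rw [← rpow_natCast (K ^ ((11:ℝ)/12)) 2, ← rpow_mul hK0.le, ← rpow_natCast K 2, ← rpow_add hK0]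
      norm_num
    rw [e23] at k3
    have hN1 : (1:ℝ) ≤ Nf c₂ := by exact_mod_cast Nf_pos c₂ hc₂
    have hPs : P ^ 2 = W ^ 2 * κ ^ 2 / (ρ * m * (c₁ * c₂) ^ 2) := by
      rw [hP, div_pow, mul_pow, div_pow, sq_sqrt (by positivity)]
      field_simp
    set F := 1500000 * W * HH N * κ ^ 39 / (K * (m * c₁ * c₂)) with hF
    calc _ = F ^ 2 * (ρ * m * α * β ^ 2 * c₁ * c₂) * Nf c₂ := by
          rw [mul_pow, hPs, hF]
          push_cast
          field_simp
          ring
      _ ≤ F ^ 2 * (κ ^ 30 * ((K ^ ((11:ℝ)/12)) ^ 2 * K ^ 2)) * (Nf c₂) ^ 2 := by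
          refine mul_le_mul (mul_le_mul_of_nonneg_left k3 (by positivity)) ?_ (by positivity) (by positivity)
          exact le_self_pow₀ hN1 (by norm_num)
      _ = _ := by
          rw [hF]
          field_simp
  · exact fun n hn => (tb n hn).1
  · exact fun n hn => (tb n hn).2
  · exact hUD c₁ (by positivity) k2
  · exact hUD c₂ (by positivity) k1

end P5e


section P6a
open Real

noncomputable def CA (A : ℕ) : ℝ := (10 + (A:ℝ)) ^ (A + 8) * ((Nat.factorial 8 : ℝ) * 12 ^ 16) + 10 ^ 8 * ((Nat.factorial (A + 8) : ℝ) * (12 + (A:ℝ)) ^ (A + 8) * (12 + (A:ℝ)) ^ (A + 8))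

lemma v1d (k A : ℕ) (K ξ : ℝ) (hK : 1 ≤ K) (hk : (k:ℝ) ≤ 2 * K) (hξ : 0 ≤ ξ) : v1 k ξ * ξ ^ (A + 8) ≤ (10 + (A:ℝ)) ^ (A + 8) * K ^ (A + 8) := by
  refine (v1_decay k (A + 8) ξ hξ).trans ?_
  rw [← mul_pow]
  refine pow_le_pow_left₀ (by positivity) ?_ _
  push_cast
  have : (A:ℝ) ≤ A * K := le_mul_of_one_le_right (by positivity) hK
  linarith

lemma v2d (k A : ℕ) (K ξ : ℝ) (hk1 : 1 ≤ k) (hK : 1 ≤ K) (hk : (k:ℝ) ≤ 2 * K) (hξ : 0 < ξ) :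
    v2 k ξ * ξ ^ (A + 8) ≤ ((Nat.factorial (A + 8) : ℝ) * (12 + (A:ℝ)) ^ (A + 8) * (12 + (A:ℝ)) ^ (A + 8)) * (K ^ 2) ^ (A + 8) := by
  refine (v2_decay k (A + 8) hk1 ξ hξ).trans ?_
  have h : (2 * (k:ℝ) + ((A + 8 : ℕ):ℝ)) ^ (A + 8) ≤ (12 + (A:ℝ)) ^ (A + 8) * K ^ (A + 8) := by
    rw [← mul_pow]
    refine pow_le_pow_left₀ (by positivity) ?_ _
    push_cast
    have : (A:ℝ) ≤ A * K := le_mul_of_one_le_right (by positivity) hK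
    linarith
  calc _ ≤ (Nat.factorial (A + 8) : ℝ) * ((12 + (A:ℝ)) ^ (A + 8) * K ^ (A + 8)) * ((12 + (A:ℝ)) ^ (A + 8) * K ^ (A + 8)) := by
        refine mul_le_mul (mul_le_mul_of_nonneg_left h (by positivity)) h (by positivity) (by positivity)
    _ = _ := by rw [pow_right_comm, sq]; ring

lemma vv (k A : ℕ) (K κ m ξ : ℝ) (hk1 : 1 ≤ k) (hK : 1 ≤ K) (hk : (k:ℝ) ≤ 2 * K) (hm : 0 < m) (hξ : 0 < ξ) (hκ : 0 < κ)
    (h : (K * κ) ^ A ≤ m ^ A ∨ (K ^ 2 * κ) ^ A ≤ ξ ^ A) :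
    v1 k m * v2 k ξ * (m ^ 8 * ξ ^ 8) * κ ^ A ≤ CA A * K ^ 24 := by
  have hv1 := v1_nonneg k m hm.le
  have hv2 := (v2_bds k hk1 ξ hξ).1
  have a0 := v1d k 0 K m hK hk hm.le
  have b0 := v2d k 0 K ξ hk1 hK hk hξ
  have hK0 : 0 < K := by linarith
  simp only [zero_add, Nat.cast_zero, add_zero] at a0 b0
  rcases h with h | h
  · have a1 := v1d k A K m hK hk hm.le
    have a2 : v1 k m * m ^ 8 * κ ^ A ≤ (10 + (A:ℝ)) ^ (A + 8) * K ^ 8 := by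
      have hKA : 0 < K ^ A := by positivity
      refine le_of_mul_le_mul_right ?_ hKA
      calc v1 k m * m ^ 8 * κ ^ A * K ^ A = v1 k m * m ^ 8 * (K * κ) ^ A := by rw [mul_pow]; ring
        _ ≤ v1 k m * m ^ 8 * m ^ A := mul_le_mul_of_nonneg_left h (by positivity)
        _ = v1 k m * m ^ (A + 8) := by rw [pow_add]; ring
        _ ≤ _ := a1
        _ = _ := by rw [pow_add K]; ring
    calc _ = (v1 k m * m ^ 8 * κ ^ A) * (v2 k ξ * ξ ^ 8) := by ring
      _ ≤ ((10 + (A:ℝ)) ^ (A + 8) * K ^ 8) * ((Nat.factorial 8 : ℝ) * 12 ^ 8 * 12 ^ 8 * (K ^ 2) ^ 8) := mul_le_mul a2 b0 (by positivity) (by positivity)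
      _ = ((10 + (A:ℝ)) ^ (A + 8) * ((Nat.factorial 8 : ℝ) * 12 ^ 16)) * K ^ 24 := by ring
      _ ≤ _ := by
        unfold CA
        refine mul_le_mul_of_nonneg_right (le_add_of_nonneg_right (by positivity)) (by positivity)
  · have a1 := v2d k A K ξ hk1 hK hk hξ
    obtain ⟨E, hE⟩ : ∃ E : ℝ, E = (Nat.factorial (A + 8) : ℝ) * (12 + (A:ℝ)) ^ (A + 8) * (12 + (A:ℝ)) ^ (A + 8) := ⟨_, rfl⟩
    rw [← hE] at a1
    have hE0 : 0 ≤ E := by rw [hE]; positivity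
    have a2 : v2 k ξ * ξ ^ 8 * κ ^ A ≤ E * (K ^ 2) ^ 8 := by
      have hKA : 0 < (K ^ 2) ^ A := by positivity
      refine le_of_mul_le_mul_right ?_ hKA
      calc v2 k ξ * ξ ^ 8 * κ ^ A * (K ^ 2) ^ A = v2 k ξ * ξ ^ 8 * (K ^ 2 * κ) ^ A := by rw [mul_pow]; ring
        _ ≤ v2 k ξ * ξ ^ 8 * ξ ^ A := mul_le_mul_of_nonneg_left h (by positivity)
        _ = v2 k ξ * ξ ^ (A + 8) := by rw [pow_add]; ring
        _ ≤ _ := a1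
        _ = _ := by rw [pow_add (K ^ 2)]; ring
    calc _ = (v1 k m * m ^ 8) * (v2 k ξ * ξ ^ 8 * κ ^ A) := by ring
      _ ≤ (10 ^ 8 * K ^ 8) * (E * (K ^ 2) ^ 8) := mul_le_mul a0 a2 (by positivity) (by positivity)
      _ = (10 ^ 8 * E) * K ^ 24 := by ring
      _ ≤ _ := by
        unfold CA
        rw [← hE]
        refine mul_le_mul_of_nonneg_right (le_add_of_nonneg_left (by positivity)) (by positivity)

lemma T_le (w : ℝ → ℝ) (M₀ K : ℝ) (hw0 : ∀ u, |w u| ≤ M₀) (hK : 1 ≤ K) (α β γ r₁ r₂ j n m c₁ c₂ : ℕ) (hj : 1 ≤ j) (hjK : (j:ℝ) ≤ K)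
    (hn : 1 ≤ n) (hm : 1 ≤ m) (hα : 0 < α) (hβ : 0 < β) (hγ : 0 < γ) (hr : 0 < r₂) :
    ‖T w K α β γ r₁ r₂ (2*j) n m c₁ c₂‖ ≤ 2 * M₀ * (v1 (2*j) m * v2 (2*j) ((n : ℝ) * r₂ ^ 2 * α ^ 3 * β ^ 2 * γ ^ 2)) := by
  have h1 : (1:ℝ) ≤ m := by exact_mod_cast hm
  have h2 : (1:ℝ) ≤ n := by exact_mod_cast hn
  have hαR : (0:ℝ) < α := by exact_mod_cast hα
  have hβR : (0:ℝ) < β := by exact_mod_cast hβ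
  have hγR : (0:ℝ) < γ := by exact_mod_cast hγ
  have hrR : (0:ℝ) < r₂ := by exact_mod_cast hr
  have hjR : (1:ℝ) ≤ j := by exact_mod_cast hj
  have hM0 : 0 ≤ M₀ := (abs_nonneg _).trans (hw0 0)
  have hξ : 0 < (n : ℝ) * r₂ ^ 2 * α ^ 3 * β ^ 2 * γ ^ 2 := by positivity
  unfold T
  rw [V1_eq _ (by omega) _ (by linarith), V2_eq _ (by omega) _ hξ, besselJ_eq_JJ, besselJ_eq_JJ]
  have hv1 := v1_nonneg (2*j) m (by linarith)
  have hv2 := (v2_bds (2*j) (by omega) _ hξ).1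
  simp only [norm_mul, norm_div, norm_pow, Complex.norm_I, one_pow, one_mul, Complex.norm_real, Complex.norm_natCast]
  rw [Real.norm_of_nonneg hv1, Real.norm_of_nonneg hv2]
  have e1 : ‖w (((2 * j : ℕ):ℝ) / K)‖ * (‖((2 * j : ℕ):ℝ) - 1‖ / ‖K‖) / ‖√((n:ℝ) * m)‖ ≤ 2 * M₀ := by
    have g1 : 1 ≤ ‖√((n:ℝ) * m)‖ := by
      rw [Real.norm_of_nonneg (sqrt_nonneg _)]
      exact one_le_sqrt.2 (by nlinarith)
    have g2 : ‖((2 * j : ℕ):ℝ) - 1‖ / ‖K‖ ≤ 2 := by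
      push_cast
      rw [Real.norm_of_nonneg (by linarith), Real.norm_of_nonneg (by linarith), div_le_iff₀ (by linarith)]
      linarith
    calc _ ≤ ‖w (((2 * j : ℕ):ℝ) / K)‖ * (‖((2 * j : ℕ):ℝ) - 1‖ / ‖K‖) := div_le_self (by positivity) g1
      _ ≤ M₀ * 2 := mul_le_mul (hw0 _) g2 (by positivity) hM0
      _ = _ := by ring
  have e2 : ‖kloos ((n : ℤ) ^ 2) ((r₁ : ℤ) ^ 2) c₂‖ / c₂ ≤ 1 := div_le_one_of_le₀ (kloos_le _ _ _) (by positivity)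
  have e3 : ‖kloos ((n : ℤ) * α * β ^ 2) (m : ℤ) c₁‖ / c₁ ≤ 1 := div_le_one_of_le₀ (kloos_le _ _ _) (by positivity)
  rw [← mul_assoc (2*M₀)]
  refine mul_le_mul_of_nonneg_right (mul_le_mul_of_nonneg_right ?_ hv1) hv2
  refine (mul_le_of_le_one_right (by positivity) (JJ_norm_le_one _ _)).trans ?_
  refine (mul_le_of_le_one_right (by positivity) (JJ_norm_le_one _ _)).trans ?_
  refine (mul_le_of_le_one_right (by positivity) e3).trans ?_
  exact (mul_le_of_le_one_right (by positivity) e2).trans e1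

lemma cbd (K ε n m α β γ r₁ r₂ c₁ c₂ : ℝ) (hK : 1 ≤ K) (hε : 0 < ε) (hε1 : ε < 1/1000)
    (hn : 1 ≤ n) (hm : 1 ≤ m) (hα : 1 ≤ α) (hβ : 1 ≤ β) (hγ : 1 ≤ γ) (hr₁ : 1 ≤ r₁) (hr₂ : 1 ≤ r₂) (hc₁ : 1 ≤ c₁) (hc₂ : 1 ≤ c₂)
    (q1 : K ^ ((4:ℝ)/3 - ε) < n * r₁ / c₂)
    (q3 : n * r₁ / (c₂ * K ^ ε) < √(n * m * α * β ^ 2) / c₁)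
    (p1 : r₁ / r₂ < K ^ ε) :
    (n * m * c₁ * c₂) ^ 2 ≤ (K ^ ε) ^ 2 * (m ^ 8 * (n * r₂ ^ 2 * α ^ 3 * β ^ 2 * γ ^ 2) ^ 8) := by
  obtain ⟨L, rfl, hL⟩ : ∃ x, exp x = K ∧ 0 ≤ x := ⟨log K, exp_log (by linarith), log_nonneg hK⟩
  obtain ⟨N, rfl, hN⟩ : ∃ x, exp x = n ∧ 0 ≤ x := ⟨log n, exp_log (by linarith), log_nonneg hn⟩
  obtain ⟨M, rfl, hM⟩ : ∃ x, exp x = m ∧ 0 ≤ x := ⟨log m, exp_log (by linarith), log_nonneg hm⟩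
  obtain ⟨A, rfl, hA⟩ : ∃ x, exp x = α ∧ 0 ≤ x := ⟨log α, exp_log (by linarith), log_nonneg hα⟩
  obtain ⟨B, rfl, hB⟩ : ∃ x, exp x = β ∧ 0 ≤ x := ⟨log β, exp_log (by linarith), log_nonneg hβ⟩
  obtain ⟨G, rfl, hG⟩ : ∃ x, exp x = γ ∧ 0 ≤ x := ⟨log γ, exp_log (by linarith), log_nonneg hγ⟩
  obtain ⟨R1, rfl, hR1⟩ : ∃ x, exp x = r₁ ∧ 0 ≤ x := ⟨log r₁, exp_log (by linarith), log_nonneg hr₁⟩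
  obtain ⟨R2, rfl, hR2⟩ : ∃ x, exp x = r₂ ∧ 0 ≤ x := ⟨log r₂, exp_log (by linarith), log_nonneg hr₂⟩
  obtain ⟨C1, rfl, hC1⟩ : ∃ x, exp x = c₁ ∧ 0 ≤ x := ⟨log c₁, exp_log (by linarith), log_nonneg hc₁⟩
  obtain ⟨C2, rfl, hC2⟩ : ∃ x, exp x = c₂ ∧ 0 ≤ x := ⟨log c₂, exp_log (by linarith), log_nonneg hc₂⟩
  have hsq : ∀ x : ℝ, √(exp x) = exp (x / 2) := fun x => (exp_half x).symm
  obtain ⟨t, ht⟩ : ∃ t, t = L * ε := ⟨_, rfl⟩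
  have ht0 : 0 ≤ t := by rw [ht]; positivity
  have htL : 1000 * t ≤ L := by rw [ht]; nlinarith
  simp only [← exp_mul, ← exp_nat_mul, ← exp_add, ← exp_sub, hsq, exp_lt_exp, exp_le_exp, mul_sub, ← ht] at *
  push_cast at *
  linarith

lemma termBd (w : ℝ → ℝ) (M₀ K ε : ℝ) (hw0 : ∀ u, |w u| ≤ M₀) (hK : 1 ≤ K) (hε : 0 < ε) (hε1 : ε < 1/1000) (α β γ r₁ r₂ j n m c₁ c₂ A : ℕ) (hj : 1 ≤ j) (hjK : (j:ℝ) ≤ K)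
    (hn : 1 ≤ n) (hm : 1 ≤ m) (hc₁ : 1 ≤ c₁) (hc₂ : 1 ≤ c₂) (hα : 0 < α) (hβ : 0 < β) (hγ : 0 < γ) (hr₁ : 0 < r₁) (hr : 0 < r₂)
    (p1 : (r₁:ℝ) / r₂ < K ^ ε) (hc : cond2 K ε α β r₁ n m c₁ c₂)
    (h : (K * K ^ ε) ^ A ≤ (m:ℝ) ^ A ∨ (K ^ 2 * K ^ ε) ^ A ≤ ((n : ℝ) * r₂ ^ 2 * α ^ 3 * β ^ 2 * γ ^ 2) ^ A) :
    ‖T w K α β γ r₁ r₂ (2*j) n m c₁ c₂‖ * (((n:ℝ) * m * c₁ * c₂) ^ 2 * (K ^ ε) ^ A) ≤ 2 * M₀ * (CA A * K ^ 24 * (K ^ ε) ^ 2) := by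
  have hmR : (1:ℝ) ≤ m := by exact_mod_cast hm
  have hnR : (1:ℝ) ≤ n := by exact_mod_cast hn
  have hc₁R : (1:ℝ) ≤ c₁ := by exact_mod_cast hc₁
  have hc₂R : (1:ℝ) ≤ c₂ := by exact_mod_cast hc₂
  have hαR : (1:ℝ) ≤ α := by exact_mod_cast hα
  have hβR : (1:ℝ) ≤ β := by exact_mod_cast hβ
  have hγR : (1:ℝ) ≤ γ := by exact_mod_cast hγ
  have hr₁R : (1:ℝ) ≤ r₁ := by exact_mod_cast hr₁
  have hr₂R : (1:ℝ) ≤ r₂ := by exact_mod_cast hr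
  have hM0 : 0 ≤ M₀ := (abs_nonneg _).trans (hw0 0)
  have hκ0 : 0 < K ^ ε := rpow_pos_of_pos (by linarith) _
  have h1 := T_le w M₀ K hw0 hK α β γ r₁ r₂ j n m c₁ c₂ hj hjK hn hm hα hβ hγ hr
  have h2 := cbd K ε n m α β γ r₁ r₂ c₁ c₂ hK hε hε1 hnR hmR hαR hβR hγR hr₁R hr₂R hc₁R hc₂R hc.1 hc.2.2.1 p1
  set ξ : ℝ := (n : ℝ) * r₂ ^ 2 * α ^ 3 * β ^ 2 * γ ^ 2 with hξdef
  have hξ : 0 < ξ := by positivity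
  have h3 := vv (2*j) A K (K ^ ε) m ξ (by omega) hK (by push_cast; linarith) (by linarith) hξ hκ0 h
  have hv1 := v1_nonneg (2*j) m (by linarith)
  have hv2 := (v2_bds (2*j) (by omega) _ hξ).1
  calc _ ≤ 2 * M₀ * (v1 (2*j) m * v2 (2*j) ξ) * (((K ^ ε) ^ 2 * (m ^ 8 * ξ ^ 8)) * (K ^ ε) ^ A) := by
        refine mul_le_mul h1 (mul_le_mul_of_nonneg_right h2 (by positivity)) (by positivity) (by positivity)
    _ = 2 * M₀ * ((v1 (2*j) m * v2 (2*j) ξ * (m ^ 8 * ξ ^ 8) * (K ^ ε) ^ A) * (K ^ ε) ^ 2) := by ring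
    _ ≤ _ := by
        refine mul_le_mul_of_nonneg_left (mul_le_mul_of_nonneg_right h3 (by positivity)) (by positivity)

end P6a


section P6b
open Real

def Rm (K ε : ℝ) (α β γ r₁ r₂ : ℕ) (q : ℕ × ℕ × ℕ × ℕ) : Prop :=
  (1 ≤ q.1 ∧ 1 ≤ q.2.1 ∧ 1 ≤ q.2.2.1 ∧ 1 ≤ q.2.2.2 ∧ cond2 K ε α β r₁ q.1 q.2.1 q.2.2.1 q.2.2.2) ∧
    (q.2.1:ℝ) ≤ K * K ^ ε ∧ (q.1 : ℝ) * r₂ ^ 2 * α ^ 3 * β ^ 2 * γ ^ 2 ≤ K ^ 2 * K ^ ε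

lemma HH_le (K ε : ℝ) (hK : 2 ≤ K) (hε : 0 < ε) (N : ℕ) (hN : (N:ℝ) ≤ K ^ 3 + 1) : HH N ≤ (1 + 4 / ε) * K ^ ε := by
  have hκ : 1 ≤ K ^ ε := one_le_rpow (by linarith) hε.le
  rcases Nat.eq_zero_or_pos N with rfl | h0
  · simp only [HH]; simp; positivity
  have h1 : HH N ≤ 1 + log N := by
    have h2 := harmonic_le_one_add_log N
    refine le_trans (le_of_eq ?_) h2
    unfold HH
    rw [harmonic_eq_sum_Icc]
    push_cast
    exact Finset.sum_congr rfl fun t _ => one_div _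
  have h2 : log N ≤ 4 * log K := by
    rw [show (4:ℝ) * log K = log (K ^ 4) by rw [log_pow]; norm_num]
    apply log_le_log (by exact_mod_cast h0)
    have : 2 ^ 3 ≤ K ^ 3 := pow_le_pow_left₀ (by norm_num) hK 3
    nlinarith
  have h3 : log K ≤ K ^ ε / ε := log_le_rpow_div (by linarith) hε
  calc HH N ≤ 1 + 4 * (K ^ ε / ε) := by linarith
    _ ≤ K ^ ε + 4 * (K ^ ε / ε) := by linarith
    _ = _ := by ring

open scoped Classical in
lemma mainSum (w : ℝ → ℝ) (M₀ M₁ K ε : ℝ) (a b : ℕ) (hw0 : ∀ u, |w u| ≤ M₀) (hw1 : ∀ x y, |w x - w y| ≤ M₁ * |x - y|)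
    (hK : 2 ≤ K) (hε : 0 < ε) (hε1 : ε < 1/1000) (ha : 2 ≤ a) (hab : a ≤ b) (hKa : K ≤ 2 * a) (hb : (b:ℝ) ≤ K + 1)
    (α β γ r₁ r₂ : ℕ) (hα : 0 < α) (hβ : 0 < β) (hγ : 0 < γ) (hr₁ : 0 < r₁) (hr : 0 < r₂)
    (p1 : (r₁:ℝ) / r₂ < K ^ ε) (s : Finset (ℕ × ℕ × ℕ × ℕ)) :
    ∑ q ∈ s, (if Rm K ε α β γ r₁ r₂ q then ‖∑ j ∈ Finset.Ico a b, T w K α β γ r₁ r₂ (2*j) q.1 q.2.1 q.2.2.1 q.2.2.2‖ else 0) ≤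
      1500000 * (400 * (M₀ + 2 * M₁)) * (K ^ ε) ^ 54 * K ^ ((11:ℝ)/12) * ((1 + 4 / ε) * K ^ ε) ^ 6 := by
  have hM0 : 0 ≤ M₀ := (abs_nonneg _).trans (hw0 0)
  have hM1 : 0 ≤ M₁ := by have := (abs_nonneg _).trans (hw1 1 0); simpa using this
  have hK0 : 0 < K := by linarith
  have hκ : 1 ≤ K ^ ε := one_le_rpow (by linarith) hε.le
  set Mx := ⌊K ^ 3⌋₊ with hMx
  have hMx1 : (Mx:ℝ) ≤ K ^ 3 := Nat.floor_le (by positivity)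
  set I := Finset.Icc 1 Mx with hI
  set f : ℕ × ℕ × ℕ × ℕ → ℝ := fun q => if Rm K ε α β γ r₁ r₂ q then ‖∑ j ∈ Finset.Ico a b, T w K α β γ r₁ r₂ (2*j) q.1 q.2.1 q.2.2.1 q.2.2.2‖ else 0 with hf
  have hf0 : ∀ q, 0 ≤ f q := by intro q; simp only [hf]; split_ifs <;> positivity
  have hbox : ∀ q, q ∉ I ×ˢ I ×ˢ I ×ˢ I → f q = 0 := by
    rintro ⟨n, m, c₁, c₂⟩ hq
    simp only [hf]
    rw [if_neg]
    rintro ⟨⟨hn, hm, hc₁, hc₂, hc⟩, t1, t2⟩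
    apply hq
    simp only at hn hm hc₁ hc₂ hc t1 t2
    obtain ⟨-, -, -, -, -, -, -, -, -, -, l1, l2, l3, l4⟩ := logs K ε n m α β γ r₁ r₂ c₁ c₂ (by linarith) hε hε1 (by exact_mod_cast hn) (by exact_mod_cast hm) (by exact_mod_cast hα) (by exact_mod_cast hβ) (by exact_mod_cast hγ) (by exact_mod_cast hr₁) (by exact_mod_cast hr) (by exact_mod_cast hc₁) (by exact_mod_cast hc₂)
      hc.1 hc.2.2.1 hc.2.2.2 p1 t1 t2
    simp only [Finset.mem_product, hI, Finset.mem_Icc]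
    exact ⟨⟨hn, Nat.le_floor l1⟩, ⟨hm, Nat.le_floor l2⟩, ⟨hc₁, Nat.le_floor l3⟩, ⟨hc₂, Nat.le_floor l4⟩⟩
  have e1 : ∑ q ∈ s, f q ≤ ∑ q ∈ I ×ˢ I ×ˢ I ×ˢ I, f q := by
    rw [← Finset.sum_filter_add_sum_filter_not s (fun q => q ∈ I ×ˢ I ×ˢ I ×ˢ I)]
    rw [Finset.sum_eq_zero (s := s.filter (fun q => q ∉ I ×ˢ I ×ˢ I ×ˢ I)) (fun q hq => hbox q (Finset.mem_filter.1 hq).2), add_zero]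
    exact Finset.sum_le_sum_of_subset_of_nonneg (fun q hq => (Finset.mem_filter.1 hq).2) (fun q _ _ => hf0 q)
  refine e1.trans ?_
  set Hb := (1 + 4 / ε) * K ^ ε with hHb
  have H1 : HH Mx ≤ Hb := HH_le K ε hK hε Mx (by linarith)
  have H2 : HH (Mx + 1) ≤ Hb := HH_le K ε hK hε (Mx + 1) (by push_cast; linarith)
  have hH0 := HH_nonneg Mx
  have hHb0 : 0 ≤ Hb := hH0.trans H1
  rw [Finset.sum_product_right]
  set Cc := 1500000 * (400 * (M₀ + 2 * M₁)) * Hb * (K ^ ε) ^ 54 * K ^ ((11:ℝ)/12) with hCc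
  have hK11 : 0 < K ^ ((11:ℝ)/12) := rpow_pos_of_pos hK0 _
  have hCc0 : 0 ≤ Cc := by positivity
  have e2 : ∀ p ∈ I ×ˢ I ×ˢ I, ∑ n ∈ I, f (n, p) ≤ Cc * (1 / (p.1:ℝ) * (1 / (p.2.1:ℝ) * ((Nf p.2.2:ℝ) / p.2.2))) := by
    rintro ⟨m, c₁, c₂⟩ hp
    simp only [Finset.mem_product, hI, Finset.mem_Icc] at hp
    simp only [hf]
    rw [← Finset.sum_filter]
    refine (mainTriple w M₀ M₁ K ε a b hw0 hw1 hK hε hε1 ha hab hKa hb α β γ r₁ r₂ m c₁ c₂ hp.1.1 hp.2.1.1 hp.2.2.1 hα hβ hγ hr₁ hr p1 _ (Mx + 1) ?_).trans ?_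
    · intro n hn
      rw [Finset.mem_filter, hI, Finset.mem_Icc] at hn
      obtain ⟨hn1, ⟨h1, h2, h3, h4, h5⟩, h6, h7⟩ := hn
      exact ⟨h1, by omega, h5, h6, h7⟩
    · have : (Nf c₂:ℝ) / (m * c₁ * c₂) = 1 / (m:ℝ) * (1 / (c₁:ℝ) * ((Nf c₂:ℝ) / c₂)) := by
        rw [div_mul_div_comm, div_mul_div_comm]
        ring
      rw [this]
      refine mul_le_mul_of_nonneg_right ?_ (by positivity)
      rw [hCc]
      refine mul_le_mul_of_nonneg_right (mul_le_mul_of_nonneg_right (mul_le_mul_of_nonneg_left H2 (by positivity)) (by positivity)) (by positivity)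
  refine (Finset.sum_le_sum e2).trans ?_
  rw [← Finset.mul_sum, Finset.sum_product]
  simp_rw [← Finset.mul_sum]
  rw [← Finset.sum_mul, Finset.sum_product]
  simp_rw [← Finset.mul_sum]
  rw [← Finset.sum_mul]
  have e3 := Nf_sum Mx
  have e4 : ∑ i ∈ I, 1 / (i:ℝ) = HH Mx := rfl
  rw [e4]
  calc Cc * (HH Mx * (HH Mx * ∑ c ∈ I, (Nf c : ℝ) / c)) ≤ Cc * (Hb * (Hb * Hb ^ 3)) := by
        have h3 : HH Mx ^ 3 ≤ Hb ^ 3 := pow_le_pow_left₀ hH0 H1 3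
        have h4 : 0 ≤ ∑ c ∈ I, (Nf c : ℝ) / c := Finset.sum_nonneg fun c _ => by positivity
        refine mul_le_mul_of_nonneg_left ?_ hCc0
        exact mul_le_mul H1 (mul_le_mul H1 (e3.trans h3) h4 hHb0) (mul_nonneg hH0 h4) hHb0
    _ = _ := by rw [hCc]; ring

end P6b


section P6c
open Real

lemma nested (f : ℕ × ℕ × ℕ × ℕ → ℂ) (hf : Summable f) :
    ∑' n, ∑' m, ∑' c₁, ∑' c₂, f (n, m, c₁, c₂) = ∑' q, f q := by
  rw [hf.tsum_prod]
  refine tsum_congr fun n => ?_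
  have h1 := hf.prod_factor n
  rw [h1.tsum_prod]
  refine tsum_congr fun m => ?_
  have h2 := h1.prod_factor m
  rw [h2.tsum_prod]

noncomputable def Pq (q : ℕ × ℕ × ℕ × ℕ) : ℝ := 1 / (q.1:ℝ) ^ 2 * (1 / (q.2.1:ℝ) ^ 2 * (1 / (q.2.2.1:ℝ) ^ 2 * (1 / (q.2.2.2:ℝ) ^ 2)))

lemma Pq_nonneg (q) : 0 ≤ Pq q := by unfold Pq; positivity

lemma Pq_summable : Summable Pq := by
  have h : Summable (fun n : ℕ => 1 / (n:ℝ) ^ 2) := summable_one_div_nat_pow.2 (by norm_num)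
  have h0 : 0 ≤ (fun n : ℕ => 1 / (n:ℝ) ^ 2) := fun n => by positivity
  have h2 := h.mul_of_nonneg h h0 h0
  have h3 := h.mul_of_nonneg h2 h0 (fun q => by simp only [Pi.zero_apply]; positivity)
  have h4 := h.mul_of_nonneg h3 h0 (fun q => by simp only [Pi.zero_apply]; positivity)
  exact h4

lemma Pq_eq (q : ℕ × ℕ × ℕ × ℕ) : Pq q = 1 / ((q.1:ℝ) * q.2.1 * q.2.2.1 * q.2.2.2) ^ 2 := by
  unfold Pq
  rw [mul_pow, mul_pow, mul_pow, one_div_mul_one_div, one_div_mul_one_div, one_div_mul_one_div]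
  ring_nf

open scoped Classical in
noncomputable def Fq (w : ℝ → ℝ) (K ε : ℝ) (α β γ r₁ r₂ k : ℕ) (q : ℕ × ℕ × ℕ × ℕ) : ℂ :=
  if 1 ≤ q.1 ∧ 1 ≤ q.2.1 ∧ 1 ≤ q.2.2.1 ∧ 1 ≤ q.2.2.2 ∧ cond2 K ε α β r₁ q.1 q.2.1 q.2.2.1 q.2.2.2 then
    T w K α β γ r₁ r₂ k q.1 q.2.1 q.2.2.1 q.2.2.2 else 0

lemma CA_nonneg (A : ℕ) : 0 ≤ CA A := by unfold CA; positivity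

lemma Fq_bd (w : ℝ → ℝ) (M₀ K ε : ℝ) (hw0 : ∀ u, |w u| ≤ M₀) (hK : 1 ≤ K) (hε : 0 < ε) (hε1 : ε < 1/1000) (α β γ r₁ r₂ j A : ℕ) (q : ℕ × ℕ × ℕ × ℕ) (hj : 1 ≤ j) (hjK : (j:ℝ) ≤ K)
    (hα : 0 < α) (hβ : 0 < β) (hγ : 0 < γ) (hr₁ : 0 < r₁) (hr : 0 < r₂)
    (p1 : (r₁:ℝ) / r₂ < K ^ ε) (h : A = 0 ∨ ¬ Rm K ε α β γ r₁ r₂ q) :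
    ‖Fq w K ε α β γ r₁ r₂ (2*j) q‖ ≤ 2 * M₀ * (CA A * K ^ 24 * (K ^ ε) ^ 2) / (K ^ ε) ^ A * Pq q := by
  have hM0 : 0 ≤ M₀ := (abs_nonneg _).trans (hw0 0)
  have hκ0 : 0 < K ^ ε := rpow_pos_of_pos (by linarith) _
  have hCA := CA_nonneg A
  have hP := Pq_nonneg q
  have hK0 : 0 < K := by linarith
  unfold Fq
  split_ifs with hq
  · obtain ⟨hn, hm, hc₁, hc₂, hc⟩ := hq
    have h' : (K * K ^ ε) ^ A ≤ (q.2.1:ℝ) ^ A ∨ (K ^ 2 * K ^ ε) ^ A ≤ ((q.1 : ℝ) * r₂ ^ 2 * α ^ 3 * β ^ 2 * γ ^ 2) ^ A := by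
      rcases h with h | h
      · left; rw [h]; simp
      · by_cases h1 : (q.2.1:ℝ) ≤ K * K ^ ε
        · right
          have h2 : ¬ ((q.1 : ℝ) * r₂ ^ 2 * α ^ 3 * β ^ 2 * γ ^ 2 ≤ K ^ 2 * K ^ ε) := fun h2 => h ⟨⟨hn, hm, hc₁, hc₂, hc⟩, h1, h2⟩
          exact pow_le_pow_left₀ (by positivity) (not_le.1 h2).le _
        · left
          exact pow_le_pow_left₀ (by positivity) (not_le.1 h1).le _
    have := termBd w M₀ K ε hw0 hK hε hε1 α β γ r₁ r₂ j q.1 q.2.1 q.2.2.1 q.2.2.2 A hj hjK hn hm hc₁ hc₂ hα hβ hγ hr₁ hr p1 hc h'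
    have hpos : 0 < ((q.1:ℝ) * q.2.1 * q.2.2.1 * q.2.2.2) ^ 2 * (K ^ ε) ^ A := by
      have a1 : (0:ℝ) < q.1 := by exact_mod_cast hn
      have a2 : (0:ℝ) < q.2.1 := by exact_mod_cast hm
      have a3 : (0:ℝ) < q.2.2.1 := by exact_mod_cast hc₁
      have a4 : (0:ℝ) < q.2.2.2 := by exact_mod_cast hc₂
      positivity
    rw [Pq_eq, div_mul_div_comm, mul_one, mul_comm ((K ^ ε) ^ A), le_div_iff₀ hpos]
    exact this
  · rw [norm_zero]; positivity

lemma w_lip (w : ℝ → ℝ) (hsm : ContDiff ℝ (⊤ : ℕ∞) w) (M₁ : ℝ) (h : ∀ u, |iteratedDeriv 1 w u| ≤ M₁) (x y : ℝ) : |w x - w y| ≤ M₁ * |x - y| := by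
  have hd : Differentiable ℝ w := hsm.differentiable (by simp)
  have := Convex.norm_image_sub_le_of_norm_deriv_le (f := w) (s := Set.univ) (C := M₁) (x := y) (y := x) (fun z _ => hd z)
    (fun z _ => by have := h z; rw [iteratedDeriv_one] at this; exact this) convex_univ (Set.mem_univ _) (Set.mem_univ _)
  exact this

lemma Esum (w : ℝ → ℝ) (M₀ M₁ K ε : ℝ) (a b A : ℕ) (hw0 : ∀ u, |w u| ≤ M₀) (hw1 : ∀ x y, |w x - w y| ≤ M₁ * |x - y|)
    (hK : 2 ≤ K) (hε : 0 < ε) (hε1 : ε < 1/1000) (ha : 2 ≤ a) (hab : a ≤ b) (hKa : K ≤ 2 * a) (hb : (b:ℝ) ≤ K + 1)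
    (α β γ r₁ r₂ : ℕ) (hα : 0 < α) (hβ : 0 < β) (hγ : 0 < γ) (hr₁ : 0 < r₁) (hr : 0 < r₂)
    (p1 : (r₁:ℝ) / r₂ < K ^ ε) (hA : K ^ 27 ≤ (K ^ ε) ^ A) :
    (∀ j ∈ Finset.Ico a b, Summable (Fq w K ε α β γ r₁ r₂ (2*j))) ∧
    ‖∑ j ∈ Finset.Ico a b, ∑' q, Fq w K ε α β γ r₁ r₂ (2*j) q‖ ≤
      1500000 * (400 * (M₀ + 2 * M₁)) * (K ^ ε) ^ 54 * K ^ ((11:ℝ)/12) * ((1 + 4 / ε) * K ^ ε) ^ 6 + 4 * M₀ * CA A * ∑' q, Pq q := by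
  classical
  have hM0 : 0 ≤ M₀ := (abs_nonneg _).trans (hw0 0)
  have hK0 : 0 < K := by linarith
  have hκ1 : 1 ≤ K ^ ε := one_le_rpow (by linarith) hε.le
  have hκ0 : 0 < K ^ ε := rpow_pos_of_pos (by linarith) _
  have hCA := CA_nonneg A
  have hj : ∀ j ∈ Finset.Ico a b, 1 ≤ j ∧ (j:ℝ) ≤ K := by
    intro j hj
    rw [Finset.mem_Ico] at hj
    refine ⟨by omega, ?_⟩
    have : (j:ℝ) + 1 ≤ b := by exact_mod_cast hj.2
    linarith
  have hsum : ∀ j ∈ Finset.Ico a b, Summable (Fq w K ε α β γ r₁ r₂ (2*j)) := by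
    intro j hjm
    refine Summable.of_norm_bounded (Pq_summable.mul_left (2 * M₀ * (CA 0 * K ^ 24 * (K ^ ε) ^ 2) / (K ^ ε) ^ 0)) fun q => ?_
    exact Fq_bd w M₀ K ε hw0 (by linarith) hε hε1 α β γ r₁ r₂ j 0 q (hj j hjm).1 (hj j hjm).2 hα hβ hγ hr₁ hr p1 (Or.inl rfl)
  refine ⟨hsum, ?_⟩
  rw [← Summable.tsum_finsetSum hsum]
  have hκK : K ^ ε ≤ K := by
    calc K ^ ε ≤ K ^ (1:ℝ) := rpow_le_rpow_of_exponent_le (by linarith) (by linarith)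
      _ = K := rpow_one K
  have hterm : ∀ q, ‖∑ j ∈ Finset.Ico a b, Fq w K ε α β γ r₁ r₂ (2*j) q‖ ≤
      (if Rm K ε α β γ r₁ r₂ q then ‖∑ j ∈ Finset.Ico a b, T w K α β γ r₁ r₂ (2*j) q.1 q.2.1 q.2.2.1 q.2.2.2‖ else 0) + 4 * M₀ * CA A * Pq q := by
    intro q
    have hP := Pq_nonneg q
    by_cases hR : Rm K ε α β γ r₁ r₂ q
    · rw [if_pos hR]
      have : ∀ j ∈ Finset.Ico a b, Fq w K ε α β γ r₁ r₂ (2*j) q = T w K α β γ r₁ r₂ (2*j) q.1 q.2.1 q.2.2.1 q.2.2.2 := by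
        intro j _
        unfold Fq
        rw [if_pos hR.1]
      rw [Finset.sum_congr rfl this]
      exact le_add_of_nonneg_right (by positivity)
    · rw [if_neg hR, zero_add]
      have hb1 : ∀ j ∈ Finset.Ico a b, ‖Fq w K ε α β γ r₁ r₂ (2*j) q‖ ≤ 2 * M₀ * CA A * Pq q / K := by
        intro j hjm
        refine (Fq_bd w M₀ K ε hw0 (by linarith) hε hε1 α β γ r₁ r₂ j A q (hj j hjm).1 (hj j hjm).2 hα hβ hγ hr₁ hr p1 (Or.inr hR)).trans ?_
        rw [div_mul_eq_mul_div, div_le_div_iff₀ (by positivity) hK0]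
        have h2 : (K ^ ε) ^ 2 ≤ K ^ 2 := pow_le_pow_left₀ hκ0.le hκK 2
        calc 2 * M₀ * (CA A * K ^ 24 * (K ^ ε) ^ 2) * Pq q * K ≤ 2 * M₀ * (CA A * K ^ 24 * K ^ 2) * Pq q * K := by
              refine mul_le_mul_of_nonneg_right (mul_le_mul_of_nonneg_right (mul_le_mul_of_nonneg_left (mul_le_mul_of_nonneg_left h2 (by positivity)) (by positivity)) hP) hK0.le
          _ = 2 * M₀ * CA A * Pq q * K ^ 27 := by ring
          _ ≤ _ := mul_le_mul_of_nonneg_left hA (by positivity)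
      refine (norm_sum_le_of_le _ hb1).trans ?_
      rw [Finset.sum_const, nsmul_eq_mul, Nat.card_Ico]
      have hba : ((b - a : ℕ):ℝ) ≤ 2 * K := by
        rw [Nat.cast_sub hab]
        have : (0:ℝ) ≤ a := Nat.cast_nonneg a
        linarith
      calc _ ≤ 2 * K * (2 * M₀ * CA A * Pq q / K) := mul_le_mul_of_nonneg_right hba (by positivity)
        _ = _ := by field_simp; ring
  set Bd := 1500000 * (400 * (M₀ + 2 * M₁)) * (K ^ ε) ^ 54 * K ^ ((11:ℝ)/12) * ((1 + 4 / ε) * K ^ ε) ^ 6 + 4 * M₀ * CA A * ∑' q, Pq q with hBd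
  have hfin : ∀ s : Finset (ℕ × ℕ × ℕ × ℕ), ∑ q ∈ s, ‖∑ j ∈ Finset.Ico a b, Fq w K ε α β γ r₁ r₂ (2*j) q‖ ≤ Bd := by
    intro s
    refine (Finset.sum_le_sum fun q _ => hterm q).trans ?_
    rw [Finset.sum_add_distrib, ← Finset.mul_sum]
    refine add_le_add (mainSum w M₀ M₁ K ε a b hw0 hw1 hK hε hε1 ha hab hKa hb α β γ r₁ r₂ hα hβ hγ hr₁ hr p1 s) ?_
    exact mul_le_mul_of_nonneg_left (Pq_summable.sum_le_tsum s (fun q _ => Pq_nonneg q)) (by positivity)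
  have hsn : Summable fun q => ‖∑ j ∈ Finset.Ico a b, Fq w K ε α β γ r₁ r₂ (2*j) q‖ := summable_of_sum_le (fun _ => norm_nonneg _) hfin
  exact (norm_tsum_le_tsum_norm hsn).trans (hsn.tsum_le_of_sum_le hfin)

end P6c


section P7
open Real

lemma T_zero (w : ℝ → ℝ) (hsupp : Function.support w ⊆ Set.Ioo 1 2) (K : ℝ) (hK : 2 ≤ K) (j : ℕ)
    (h : ¬ (⌊K/2⌋₊+1 ≤ j ∧ j < ⌊K⌋₊+1)) (α β γ r₁ r₂ n m c₁ c₂ : ℕ) : T w K α β γ r₁ r₂ (2*j) n m c₁ c₂ = 0 := by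
  have hw : w (((2*j : ℕ):ℝ) / K) = 0 := by
    by_contra hne
    have hm := hsupp (Function.mem_support.2 hne)
    rw [Set.mem_Ioo, lt_div_iff₀ (by linarith), div_lt_iff₀ (by linarith)] at hm
    push_cast at hm
    apply h
    constructor
    · exact Nat.succ_le_of_lt ((Nat.floor_lt (by linarith)).2 (by linarith))
    · exact Nat.lt_succ_of_le (Nat.le_floor (by linarith))
  unfold T
  rw [hw]
  simp

lemma Kfin (K ε X Y S : ℝ) (hK : 2 ≤ K) (hε : 0 < ε) (hε1 : ε < 1/4000) (hX : 0 ≤ X) (hY : 0 ≤ Y)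
    (hS : S ≤ X * (K ^ ε) ^ 54 * K ^ ((11:ℝ)/12) * ((1 + 4 / ε) * K ^ ε) ^ 6 + Y) :
    1 / (π * K) * S ≤ (X * (1 + 4 / ε) ^ 6 + Y) * K ^ (-(1/15 : ℝ)) := by
  have hK0 : 0 < K := by linarith
  have h1 : X * (K ^ ε) ^ 54 * K ^ ((11:ℝ)/12) * ((1 + 4 / ε) * K ^ ε) ^ 6 = X * (1 + 4 / ε) ^ 6 * K ^ (60 * ε + 11/12) := by
    have : K ^ (60 * ε + 11/12) = (K ^ ε) ^ 60 * K ^ ((11:ℝ)/12) := by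
      rw [rpow_add hK0, mul_comm 60 ε, rpow_mul hK0.le]
      norm_cast
    rw [this]; ring
  have h2 : K ^ (60 * ε + 11/12) ≤ K ^ ((14:ℝ)/15) := rpow_le_rpow_of_exponent_le (by linarith) (by linarith)
  have h3 : 1 ≤ K ^ ((14:ℝ)/15) := one_le_rpow (by linarith) (by norm_num)
  have h4 : K ^ (-(1/15 : ℝ)) = K ^ ((14:ℝ)/15) / K := by
    rw [← rpow_sub_one hK0.ne']; norm_num
  have hZ : 0 ≤ X * (1 + 4 / ε) ^ 6 := by positivity
  have h5 : S ≤ (X * (1 + 4 / ε) ^ 6 + Y) * K ^ ((14:ℝ)/15) := by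
    rw [h1] at hS
    nlinarith [mul_le_mul_of_nonneg_left h2 hZ, mul_le_mul_of_nonneg_left h3 hY]
  have hpi : 1 ≤ π := by linarith [pi_gt_three]
  have h6 : 0 ≤ (X * (1 + 4 / ε) ^ 6 + Y) * K ^ ((14:ℝ)/15) := by positivity
  calc 1 / (π * K) * S ≤ 1 / (π * K) * ((X * (1 + 4 / ε) ^ 6 + Y) * K ^ ((14:ℝ)/15)) := mul_le_mul_of_nonneg_left h5 (by positivity)
    _ ≤ 1 / K * ((X * (1 + 4 / ε) ^ 6 + Y) * K ^ ((14:ℝ)/15)) := by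
        refine mul_le_mul_of_nonneg_right ?_ h6
        exact one_div_le_one_div_of_le hK0 (by nlinarith)
    _ = _ := by rw [h4]; ring

end P7


open scoped Classical in
theorem stmt7 (w : ℝ → ℝ)
    (hsm : ContDiff ℝ (⊤ : ℕ∞) w) (hnn : ∀ u, 0 ≤ w u)
    (hsupp : Function.support w ⊆ Set.Ioo 1 2)
    (hbd : ∀ B : ℕ, ∃ M : ℝ, ∀ u, |iteratedDeriv B w u| ≤ M) :
    ∃ ε₀ : ℝ, 0 < ε₀ ∧ ∀ ε : ℝ, 0 < ε → ε < ε₀ →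
    ∃ C : ℝ, ∀ K : ℝ, 2 ≤ K → ∀ α β γ r₁ r₂ : ℕ,
      0 < α → 0 < β → 0 < γ → 0 < r₁ → 0 < r₂ →
      K ^ (-ε) < (r₁ : ℝ) / r₂ → (r₁ : ℝ) / r₂ < K ^ ε →
      ‖((1 / (Real.pi * K) : ℝ) : ℂ) *
        ∑' k : ℕ, if Even k ∧ 2 ≤ k then
          ∑' n : ℕ, ∑' m : ℕ, ∑' c₁ : ℕ, ∑' c₂ : ℕ,
            (if 1 ≤ n ∧ 1 ≤ m ∧ 1 ≤ c₁ ∧ 1 ≤ c₂ ∧ cond2 K ε α β r₁ n m c₁ c₂ then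
              T w K α β γ r₁ r₂ k n m c₁ c₂ else 0)
        else 0‖ ≤ C * K ^ (-(1/15 : ℝ)) := by
  obtain ⟨M₀, hM₀⟩ := hbd 0
  obtain ⟨M₁, hM₁⟩ := hbd 1
  have hw0 : ∀ u, |w u| ≤ M₀ := fun u => by have := hM₀ u; rwa [iteratedDeriv_zero] at this
  have hw1 := w_lip w hsm M₁ hM₁
  have hM0 : 0 ≤ M₀ := (abs_nonneg _).trans (hw0 0)
  have hM1 : 0 ≤ M₁ := (abs_nonneg _).trans (hM₁ 0)
  refine ⟨1/4000, by norm_num, fun ε hε hε1 => ?_⟩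
  refine ⟨1500000 * (400 * (M₀ + 2 * M₁)) * (1 + 4 / ε) ^ 6 + 4 * M₀ * CA ⌈27/ε⌉₊ * ∑' q, Pq q, ?_⟩
  intro K hK α β γ r₁ r₂ hα hβ hγ hr₁ hr _ p1
  have hK0 : 0 < K := by linarith
  have hA : K ^ 27 ≤ (K ^ ε) ^ ⌈27/ε⌉₊ := by
    rw [← Real.rpow_natCast (K ^ ε), ← Real.rpow_mul hK0.le, ← Real.rpow_natCast K]
    refine Real.rpow_le_rpow_of_exponent_le (by linarith) ?_
    have := Nat.le_ceil (27/ε)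
    rw [div_le_iff₀ hε] at this
    push_cast
    linarith
  have hf1 := Nat.lt_floor_add_one (K/2)
  have hf2 := Nat.floor_le (show 0 ≤ K by linarith)
  obtain ⟨hsum, hE⟩ := Esum w M₀ M₁ K ε (⌊K/2⌋₊+1) (⌊K⌋₊+1) ⌈27/ε⌉₊ hw0 hw1 hK hε (by linarith)
    (by have : 1 ≤ ⌊K/2⌋₊ := Nat.le_floor (by push_cast; linarith)
        omega)
    (Nat.succ_le_succ (Nat.floor_le_floor (by linarith)))
    (by push_cast; linarith) (by push_cast; linarith) α β γ r₁ r₂ hα hβ hγ hr₁ hr p1 hA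
  have key : (∑' k : ℕ, if Even k ∧ 2 ≤ k then
          ∑' n : ℕ, ∑' m : ℕ, ∑' c₁ : ℕ, ∑' c₂ : ℕ,
            (if 1 ≤ n ∧ 1 ≤ m ∧ 1 ≤ c₁ ∧ 1 ≤ c₂ ∧ cond2 K ε α β r₁ n m c₁ c₂ then
              T w K α β γ r₁ r₂ k n m c₁ c₂ else 0)
        else 0) = ∑ j ∈ Finset.Ico (⌊K/2⌋₊+1) (⌊K⌋₊+1), ∑' q, Fq w K ε α β γ r₁ r₂ (2*j) q := by
    rw [tsum_eq_sum (s := (Finset.Ico (⌊K/2⌋₊+1) (⌊K⌋₊+1)).image (fun j => 2*j))]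
    · rw [Finset.sum_image (fun x _ y _ h => by simpa using h)]
      refine Finset.sum_congr rfl fun j hj => ?_
      have hj1 := Finset.mem_Ico.1 hj
      rw [if_pos ⟨even_two_mul j, by omega⟩, ← nested _ (hsum j hj)]
      rfl
    · intro k hk
      split_ifs with h
      · obtain ⟨⟨j, rfl⟩, _⟩ := h
        rw [← two_mul] at hk ⊢
        have hn : ¬ (⌊K/2⌋₊+1 ≤ j ∧ j < ⌊K⌋₊+1) := fun hh =>
          hk (Finset.mem_image.2 ⟨j, Finset.mem_Ico.2 hh, rfl⟩)
        simp only [T_zero w hsupp K hK j hn, ite_self, tsum_zero]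
      · rfl
  rw [key, norm_mul, Complex.norm_real, Real.norm_of_nonneg (by positivity)]
  have hP : 0 ≤ ∑' q, Pq q := tsum_nonneg Pq_nonneg
  have hCA := CA_nonneg ⌈27/ε⌉₊
  exact Kfin K ε _ _ _ hK hε hε1 (by positivity) (by positivity) hE
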